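/- arXiv:1312.3688 — 2 statements merged into one kernel-verified Lean document; each statement's English description precedes it below -/
import Mathlib

section
/- Let ψ̊₁ : [0,∞) → (0,∞) be a C² form factor (x ↦ ψ̊₁(|x|) is C² and square integrable on ℝ³, solving Δ(ψ̊₁(|x|)) = G′₁(ψ̊₁(|x|)²)ψ̊₁(|x|)) satisfying the decay conditions θ²|ψ̊₁(θ)| ≤ C and θ³|ψ̊₁′(θ)| ≤ C for all θ ≥ 1. Let a_n, R_n > 0 satisfy a_nR_n^{−4} → 0, a_n → 0, R_n → 0. Let ψ_n be the wave-corpuscle solutions ψ_n(t,x) = e^{iS(t,x−r(t))} a_n^{−3/2}ψ̊₁(a_n^{−1}|x − r(t)|) of the NLS equation with nonlinearity G′_{a_n} and with potentials of the special form admitting wave-corpuscles (moving-frame form φ = φ₀(t) + y·φ₁(t) + φ₂, A = A₀(t) + A₁(t)y + ∇P₃, with the compatible quadratic part φ₂ and phase S constructed for a trajectory r(t) satisfying Newton's law m∂_t²r = qE(t,r) + (q/c)∂_tr×B(t,r)). Then the sequence ψ_n concentrates at the trajectory r̂(t) = r(t) in the sense of the concentration definition below. -/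
noncomputable section

open MeasureTheory Complex Filter Topology Metric

/-- Physical space `ℝ³` with the Euclidean metric. -/
abbrev V3 : Type := EuclideanSpace ℝ (Fin 3)

/-- Dot product of two triples of reals. -/
def dot3 (v w : Fin 3 → ℝ) : ℝ := ∑ i, v i * w i

/-- Cross product in `ℝ³`. -/
def cross3 (v w : Fin 3 → ℝ) : Fin 3 → ℝ :=
  ![v 1 * w 2 - v 2 * w 1, v 2 * w 0 - v 0 * w 2, v 0 * w 1 - v 1 * w 0]

/-- Matrix (as nested function) applied to a vector. -/
def matVec (M : Fin 3 → Fin 3 → ℝ) (v : Fin 3 → ℝ) : Fin 3 → ℝ := fun j => ∑ i, M j i * v i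

/-- Partial derivative in time of a function of `(t, x)`. -/
def ptD {F : Type} [NormedAddCommGroup F] [NormedSpace ℝ F]
    (f : ℝ × V3 → F) (p : ℝ × V3) : F := fderiv ℝ f p (1, 0)

/-- Partial derivative in the `i`-th spatial direction of a function of `(t, x)`. -/
def pxD {F : Type} [NormedAddCommGroup F] [NormedSpace ℝ F]
    (i : Fin 3) (f : ℝ × V3 → F) (p : ℝ × V3) : F :=
  fderiv ℝ f p (0, EuclideanSpace.single i 1)

/-- Partial derivative in the `i`-th direction of a function on space only. -/
def pxS {F : Type} [NormedAddCommGroup F] [NormedSpace ℝ F]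
    (i : Fin 3) (f : V3 → F) (x : V3) : F :=
  fderiv ℝ f x (EuclideanSpace.single i 1)

/-- Laplacian of a scalar function on `ℝ³`. -/
def lap3 (f : V3 → ℝ) (x : V3) : ℝ := ∑ i, pxS i (pxS i f) x

/-- Covariant time derivative `∂̃_t = ∂_t + i (q/χ) φ`. -/
def covT (χ q : ℝ) (φ : ℝ × V3 → ℝ) (ψ : ℝ × V3 → ℂ) (p : ℝ × V3) : ℂ :=
  ptD ψ p + Complex.I * ((q / χ : ℝ) : ℂ) * ((φ p : ℝ) : ℂ) * ψ p

/-- Covariant spatial derivative `∂̃_i = ∂_i − i (q/(χc)) A_i`. -/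
def covX (χ q c : ℝ) (A : ℝ × V3 → Fin 3 → ℝ) (i : Fin 3)
    (ψ : ℝ × V3 → ℂ) (p : ℝ × V3) : ℂ :=
  pxD i ψ p - Complex.I * ((q / (χ * c) : ℝ) : ℂ) * ((A p i : ℝ) : ℂ) * ψ p

/-- The NLS equation `i ∂̃_t ψ = (χ/(2m)) ( −∇̃²ψ + G'_a(|ψ|²) ψ )` at a point,
with the scaled nonlinearity `G'_a(s) = a⁻² G'₁(a³ s)`. -/
def SatisfiesNLS (χ m q c a : ℝ) (G1' : ℝ → ℝ) (φ : ℝ × V3 → ℝ)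
    (A : ℝ × V3 → Fin 3 → ℝ) (ψ : ℝ × V3 → ℂ) (p : ℝ × V3) : Prop :=
  Complex.I * covT χ q φ ψ p =
    ((χ / (2 * m) : ℝ) : ℂ) *
      (-(∑ i, covX χ q c A i (covX χ q c A i ψ) p) +
        (((a ^ (2 : ℕ))⁻¹ * G1' (a ^ (3 : ℕ) * Complex.normSq (ψ p)) : ℝ) : ℂ) * ψ p)

/-- The NLS equation with an unscaled nonlinearity `G'`. -/
def SatisfiesNLS' (χ m q c : ℝ) (G' : ℝ → ℝ) (φ : ℝ × V3 → ℝ)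
    (A : ℝ × V3 → Fin 3 → ℝ) (ψ : ℝ × V3 → ℂ) (p : ℝ × V3) : Prop :=
  Complex.I * covT χ q φ ψ p =
    ((χ / (2 * m) : ℝ) : ℂ) *
      (-(∑ i, covX χ q c A i (covX χ q c A i ψ) p) +
        ((G' (Complex.normSq (ψ p)) : ℝ) : ℂ) * ψ p)

/-- Charge density `ρ = q |ψ|²`. -/
def rhoD (q : ℝ) (ψ : ℝ × V3 → ℂ) (p : ℝ × V3) : ℝ := q * Complex.normSq (ψ p)

/-- Current density `J = −i (qχ/(2m)) (ψ* ∇̃ψ − ψ (∇̃ψ)*)`. -/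
def JD (χ m q c : ℝ) (A : ℝ × V3 → Fin 3 → ℝ) (ψ : ℝ × V3 → ℂ)
    (p : ℝ × V3) : Fin 3 → ℝ := fun i =>
  (-Complex.I * ((q * χ / (2 * m) : ℝ) : ℂ) *
    ((starRingEnd ℂ) (ψ p) * covX χ q c A i ψ p
      - ψ p * (starRingEnd ℂ) (covX χ q c A i ψ p))).re

/-- Momentum density `P = (iχ/2) (ψ (∇̃ψ)* − ψ* ∇̃ψ)`. -/
def PD (χ q c : ℝ) (A : ℝ × V3 → Fin 3 → ℝ) (ψ : ℝ × V3 → ℂ)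
    (p : ℝ × V3) : Fin 3 → ℝ := fun i =>
  (Complex.I * ((χ / 2 : ℝ) : ℂ) *
    (ψ p * (starRingEnd ℂ) (covX χ q c A i ψ p)
      - (starRingEnd ℂ) (ψ p) * covX χ q c A i ψ p)).re

/-- Energy density `u = (χ²/(2m)) ( |∇̃ψ|² + G_a(|ψ|²) )` for an antiderivative `Ga`. -/
def uD (χ m q c : ℝ) (Ga : ℝ → ℝ) (A : ℝ × V3 → Fin 3 → ℝ) (ψ : ℝ × V3 → ℂ)
    (p : ℝ × V3) : ℝ :=
  (χ ^ 2 / (2 * m)) * ((∑ i, Complex.normSq (covX χ q c A i ψ p)) + Ga (Complex.normSq (ψ p)))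

/-- Entries `T^{ij}` of the energy–momentum (stress) tensor of the NLS. -/
def TD (χ m q c : ℝ) (Ga : ℝ → ℝ) (φ : ℝ × V3 → ℝ) (A : ℝ × V3 → Fin 3 → ℝ)
    (ψ : ℝ × V3 → ℂ) (i j : Fin 3) (p : ℝ × V3) : ℝ :=
  if i = j then
    uD χ m q c Ga A ψ p - (χ ^ 2 / m) * Complex.normSq (covX χ q c A i ψ p)
      + (Complex.I * ((χ / 2 : ℝ) : ℂ) *
          (ψ p * (starRingEnd ℂ) (covT χ q φ ψ p)
            - (starRingEnd ℂ) (ψ p) * covT χ q φ ψ p)).re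
  else
    (-(((χ ^ 2 / (2 * m) : ℝ)) : ℂ) *
        (covX χ q c A i ψ p * (starRingEnd ℂ) (covX χ q c A j ψ p)
          + covX χ q c A j ψ p * (starRingEnd ℂ) (covX χ q c A i ψ p))).re

/-- Electric field `E = −∇φ − (1/c) ∂_t A`. -/
def ED (c : ℝ) (φ : ℝ × V3 → ℝ) (A : ℝ × V3 → Fin 3 → ℝ) (p : ℝ × V3) : Fin 3 → ℝ :=
  fun i => -(pxD i φ p) - (1 / c) * ptD A p i

/-- Magnetic field `B = ∇ × A`. -/
def BD (A : ℝ × V3 → Fin 3 → ℝ) (p : ℝ × V3) : Fin 3 → ℝ :=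
  ![pxD 1 A p 2 - pxD 2 A p 1, pxD 2 A p 0 - pxD 0 A p 2, pxD 0 A p 1 - pxD 1 A p 0]

/-- Lorentz force density `f = ρ E + (1/c) J × B`. -/
def fD (χ m q c : ℝ) (φ : ℝ × V3 → ℝ) (A : ℝ × V3 → Fin 3 → ℝ) (ψ : ℝ × V3 → ℂ)
    (p : ℝ × V3) : Fin 3 → ℝ := fun j =>
  rhoD q ψ p * ED c φ A p j + (1 / c) * cross3 (JD χ m q c A ψ p) (BD A p) j

/-- A tubular neighborhood `Ω̂` of a trajectory. -/
def Tube (Tm Tp : ℝ) (r : ℝ → V3) (R : ℝ) : Set (ℝ × V3) :=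
  {p | p.1 ∈ Set.Icc Tm Tp ∧ ‖p.2 - r p.1‖ ≤ R}

/-- Outward unit normal on the sphere of radius `R` centered at `ctr`. -/
def nrm (ctr : V3) (R : ℝ) (x : V3) : Fin 3 → ℝ := fun i => (x i - ctr i) / R

/-- A trajectory: a `C²` curve with bounded first and second derivatives on `[T₋, T₊]`. -/
def IsTrajectory (Tm Tp : ℝ) (r : ℝ → V3) : Prop :=
  ContDiff ℝ 2 r ∧ ∃ C : ℝ, ∀ t ∈ Set.Icc Tm Tp, ‖deriv r t‖ ≤ C ∧ ‖deriv (deriv r) t‖ ≤ C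

/-- Adjacent (restricted) charge value `ρ̄_n(t)`. -/
def rbar (q : ℝ) (rhat : ℝ → V3) (R : ℕ → ℝ) (ψ : ℕ → ℝ × V3 → ℂ) (n : ℕ) (t : ℝ) : ℝ :=
  ∫ x in closedBall (rhat t) (R n), rhoD q (ψ n) (t, x)

/-- Adjacent charge center `r_n(t)`. -/
def rcen (q : ℝ) (rhat : ℝ → V3) (R : ℕ → ℝ) (ψ : ℕ → ℝ × V3 → ℂ) (n : ℕ) (t : ℝ) : V3 :=
  (rbar q rhat R ψ n t)⁻¹ • ∫ x in closedBall (rhat t) (R n), rhoD q (ψ n) (t, x) • x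

/-- Velocity of the adjacent charge center. -/
def vcen (Tm Tp q : ℝ) (rhat : ℝ → V3) (R : ℕ → ℝ) (ψ : ℕ → ℝ × V3 → ℂ)
    (n : ℕ) (t : ℝ) : V3 :=
  derivWithin (rcen q rhat R ψ n) (Set.Icc Tm Tp) t

end

noncomputable section
open MeasureTheory Complex Filter Topology Metric

/-- Sphere-tangent (antisymmetric) part `Ă(t,y) = (1/2)(A₁ − A₁ᵀ) y`. -/
def breveA (A1 : ℝ → Fin 3 → Fin 3 → ℝ) (t : ℝ) (y : Fin 3 → ℝ) : Fin 3 → ℝ :=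
  fun j => (1 / 2) * ∑ i, (A1 t j i - A1 t i j) * y i

/-- Quadratic potential `P₂(t,y) = (1/2) y · A₁(t) y`. -/
def P2q (A1 : ℝ → Fin 3 → Fin 3 → ℝ) (t : ℝ) (y : Fin 3 → ℝ) : ℝ :=
  (1 / 2) * dot3 y (matVec (A1 t) y)

/-- Compatible quadratic part `φ₂` of the electric potential of a wave-corpuscle. -/
def phi2WC (m q c : ℝ) (r : ℝ → V3) (A1 : ℝ → Fin 3 → Fin 3 → ℝ)
    (P3 : ℝ → V3 → ℝ) (t : ℝ) (y : V3) : ℝ :=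
  -(q / (2 * m * c ^ 2)) * (∑ i, (breveA A1 t (fun i => y i) i) ^ 2)
    - (1 / c) * deriv (fun s => P2q A1 s (fun i => y i) + P3 s y) t
    + (1 / c) * dot3 (fun i => deriv r t i) (fun j => pxS j (P3 t) y)

/-- The electric potential `φ(t,x) = φ₀(t) + y·φ₁(t) + φ₂(t,y)`, `y = x − r(t)`. -/
def phiWC (m q c : ℝ) (r : ℝ → V3) (φ0 : ℝ → ℝ) (φ1 : ℝ → Fin 3 → ℝ)
    (A1 : ℝ → Fin 3 → Fin 3 → ℝ) (P3 : ℝ → V3 → ℝ) (p : ℝ × V3) : ℝ :=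
  φ0 p.1 + dot3 (fun i => p.2 i - r p.1 i) (φ1 p.1)
    + phi2WC m q c r A1 P3 p.1 (p.2 - r p.1)

/-- The magnetic potential `A(t,x) = A₀(t) + A₁(t) y + ∇_y P₃(t,y)`, `y = x − r(t)`. -/
def AWC (r : ℝ → V3) (A0 : ℝ → Fin 3 → ℝ) (A1 : ℝ → Fin 3 → Fin 3 → ℝ)
    (P3 : ℝ → V3 → ℝ) (p : ℝ × V3) : Fin 3 → ℝ := fun j =>
  A0 p.1 j + matVec (A1 p.1) (fun i => p.2 i - r p.1 i) j + pxS j (P3 p.1) (p.2 - r p.1)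

/-- The purely time-dependent part `s_p(t)` of the phase of a wave-corpuscle. -/
def spWC (χ m q c : ℝ) (r : ℝ → V3) (φ0 : ℝ → ℝ) (A0 : ℝ → Fin 3 → ℝ) (t : ℝ) : ℝ :=
  χ⁻¹ * ∫ t' in (0 : ℝ)..t,
    ((1 / 2) * m * (∑ i, (deriv r t' i) ^ 2)
      + (q / c) * dot3 (fun i => deriv r t' i) (A0 t') - q * φ0 t')

/-- The higher-order part `s_{p2}(t,y)` of the phase of a wave-corpuscle. -/
def sp2WC (χ q c : ℝ) (A1 : ℝ → Fin 3 → Fin 3 → ℝ) (P3 : ℝ → V3 → ℝ)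
    (t : ℝ) (y : V3) : ℝ :=
  (q / (2 * χ * c)) * dot3 (fun i => y i) (matVec (A1 t) (fun i => y i))
    + (q / (3 * χ * c)) * dot3 (fun i => y i) (fun j => pxS j (P3 t) y)

/-- The phase `S(t,y)` of a wave-corpuscle. -/
def SWC (χ m q c : ℝ) (r : ℝ → V3) (φ0 : ℝ → ℝ) (A0 : ℝ → Fin 3 → ℝ)
    (A1 : ℝ → Fin 3 → Fin 3 → ℝ) (P3 : ℝ → V3 → ℝ) (t : ℝ) (y : V3) : ℝ :=
  (m / χ) * dot3 (fun i => deriv r t i) (fun i => y i)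
    + (q / (χ * c)) * dot3 (fun i => y i) (A0 t)
    + spWC χ m q c r φ0 A0 t + sp2WC χ q c A1 P3 t y

/-- The wave-corpuscle `ψ(t,x) = e^{i S(t, x − r(t))} ψ̊(|x − r(t)|)`. -/
def psiWC (χ m q c : ℝ) (r : ℝ → V3) (φ0 : ℝ → ℝ) (A0 : ℝ → Fin 3 → ℝ)
    (A1 : ℝ → Fin 3 → Fin 3 → ℝ) (P3 : ℝ → V3 → ℝ) (ψ0 : ℝ → ℝ) (p : ℝ × V3) : ℂ :=
  Complex.exp (Complex.I * ((SWC χ m q c r φ0 A0 A1 P3 p.1 (p.2 - r p.1) : ℝ) : ℂ))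
    * ((ψ0 ‖p.2 - r p.1‖ : ℝ) : ℂ)

noncomputable section
open MeasureTheory Complex Filter Topology Metric

/-- A sequence `ψ_n` of solutions of the NLS equation *concentrates* at the trajectory
`r̂` (Definitions "localized NLS equations" and "concentrating solutions" of the paper):
the nonlinearity satisfies the regularity condition; `a_n → 0`, `R_n → 0`, `R_n/a_n → ∞`;
the `C²` potentials `φ_n, A_n` are uniformly bounded with their first derivatives on the
tubes `Ω̂_n` and converge there, with first derivatives, to limit potentials `φ_∞, A_∞`
which are linear in `x − r̂(t)` with bounded coefficients; each `ψ_n` is a `C²` solution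
of the NLS on `Ω̂_n`; the local momenta are bounded; the adjacent charge values `ρ̄_n`
are bounded above and below and converge at `t₀` to `ρ̄_∞`; the surface integrals
`Q₀, Q₀₁, Q₂₀, Q₂₂, Q₂₃` vanish uniformly; and the volume integrals `Q₃₀ + Q₃₁`
built from `E_n − E_∞`, `B_n − B_∞` vanish uniformly. -/
structure Concentrates (χ m q c : ℝ) (G1' G1 : ℝ → ℝ) (Tm Tp t₀ : ℝ)
    (rhat : ℝ → V3) (a R : ℕ → ℝ)
    (φn : ℕ → ℝ × V3 → ℝ) (An : ℕ → ℝ × V3 → Fin 3 → ℝ)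
    (φinf : ℝ × V3 → ℝ) (Ainf : ℝ × V3 → Fin 3 → ℝ)
    (ψ : ℕ → ℝ × V3 → ℂ) (ρinf : ℝ) : Prop where
  ht0 : t₀ ∈ Set.Icc Tm Tp
  htraj : IsTrajectory Tm Tp rhat
  hG1'cont : ContinuousOn G1' (Set.Ioi 0)
  hG1deriv : ∀ s ∈ Set.Ioi (0 : ℝ), HasDerivAt G1 (G1' s) s
  hG1cont : ContinuousOn G1 (Set.Ici 0)
  hgcont : Continuous fun z : ℂ =>
    if z = 0 then (0 : ℂ) else ((G1' (Complex.normSq z) : ℝ) : ℂ) * z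
  hapos : ∀ n, 0 < a n
  hRpos : ∀ n, 0 < R n
  ha0 : Tendsto a atTop (nhds 0)
  hR0 : Tendsto R atTop (nhds 0)
  hratio : Tendsto (fun n => R n / a n) atTop atTop
  hφsmooth : ∀ n, ContDiffOn ℝ 2 (φn n) (Tube Tm Tp rhat (R n))
  hAsmooth : ∀ n, ContDiffOn ℝ 2 (An n) (Tube Tm Tp rhat (R n))
  hφbound : ∃ C, ∀ n, ∀ p ∈ Tube Tm Tp rhat (R n),
    |φn n p| ≤ C ∧ |ptD (φn n) p| ≤ C ∧ ∀ i, |pxD i (φn n) p| ≤ C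
  hAbound : ∃ C, ∀ n, ∀ p ∈ Tube Tm Tp rhat (R n),
    ‖An n p‖ ≤ C ∧ ‖ptD (An n) p‖ ≤ C ∧ ∀ i, ‖pxD i (An n) p‖ ≤ C
  hφconv : ∀ ε > (0 : ℝ), ∃ N, ∀ n ≥ N, ∀ p ∈ Tube Tm Tp rhat (R n),
    |φn n p - φinf p| + |ptD (φn n) p - ptD φinf p|
      + (∑ i, |pxD i (φn n) p - pxD i φinf p|) < ε
  hAconv : ∀ ε > (0 : ℝ), ∃ N, ∀ n ≥ N, ∀ p ∈ Tube Tm Tp rhat (R n),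
    ‖An n p - Ainf p‖ + ‖ptD (An n) p - ptD Ainf p‖
      + (∑ i, ‖pxD i (An n) p - pxD i Ainf p‖) < ε
  hφlin : ∃ φ0 : ℝ → ℝ, ∃ φ1 : ℝ → Fin 3 → ℝ, ContDiff ℝ 1 φ0 ∧ ContDiff ℝ 1 φ1 ∧
    (∃ C, ∀ t ∈ Set.Icc Tm Tp,
      |φ0 t| ≤ C ∧ ‖φ1 t‖ ≤ C ∧ |deriv φ0 t| ≤ C ∧ ‖deriv φ1 t‖ ≤ C) ∧
    ∀ p : ℝ × V3, φinf p = φ0 p.1 + dot3 (fun i => p.2 i - rhat p.1 i) (φ1 p.1)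
  hAlin : ∃ A0 : ℝ → Fin 3 → ℝ, ∃ A1 : ℝ → Fin 3 → Fin 3 → ℝ,
    ContDiff ℝ 1 A0 ∧ ContDiff ℝ 1 A1 ∧
    (∃ C, ∀ t ∈ Set.Icc Tm Tp,
      ‖A0 t‖ ≤ C ∧ ‖A1 t‖ ≤ C ∧ ‖deriv A0 t‖ ≤ C ∧ ‖deriv A1 t‖ ≤ C) ∧
    ∀ p : ℝ × V3, ∀ j, Ainf p j = A0 p.1 j + ∑ i, (p.2 i - rhat p.1 i) * A1 p.1 i j
  hψsmooth : ∀ n, ContDiffOn ℝ 2 (ψ n) (Tube Tm Tp rhat (R n))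
  hsolves : ∀ n, ∀ p ∈ Tube Tm Tp rhat (R n),
    SatisfiesNLS χ m q c (a n) G1' (φn n) (An n) (ψ n) p
  hPbound : ∃ C, ∀ n, ∀ t ∈ Set.Icc Tm Tp,
    ‖∫ x in closedBall (rhat t) (R n), PD χ q c (An n) (ψ n) (t, x)‖ ≤ C
  hρbound : ∃ c₀ > (0 : ℝ), ∃ C, ∃ n₀, ∀ n ≥ n₀, ∀ t ∈ Set.Icc Tm Tp,
    c₀ ≤ rbar q rhat R ψ n t ∧ rbar q rhat R ψ n t ≤ C
  hρconv : Tendsto (fun n => rbar q rhat R ψ n t₀) atTop (nhds ρinf)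
  hQ0 : TendstoUniformlyOn
    (fun n t => ∫ t' in t₀..t, ∫ x in sphere (rhat t') (R n),
      (fun j => ∑ i, nrm (rhat t') (R n) x i *
        TD χ m q c (fun s => ((a n) ^ (5 : ℕ))⁻¹ * G1 ((a n) ^ (3 : ℕ) * s))
          (φn n) (An n) (ψ n) i j (t', x)) ∂μH[2])
    (fun _ => 0) atTop (Set.Icc Tm Tp)
  hQ01 : TendstoUniformlyOn
    (fun n t => ∫ t' in t₀..t, ∫ x in sphere (rhat t') (R n),
      dot3 (fun i => deriv rhat t' i) (nrm (rhat t') (R n) x) •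
        PD χ q c (An n) (ψ n) (t', x) ∂μH[2])
    (fun _ => 0) atTop (Set.Icc Tm Tp)
  hQ20 : TendstoUniformlyOn
    (fun n t => ∫ x in sphere (rhat t) (R n),
      (dot3 (fun i => deriv rhat t i) (nrm (rhat t) (R n) x) * rhoD q (ψ n) (t, x)) •
        (fun i => x i - rcen q rhat R ψ n t i) ∂μH[2])
    (fun _ => 0) atTop (Set.Icc Tm Tp)
  hQ22 : TendstoUniformlyOn
    (fun n t => ∫ x in sphere (rhat t) (R n),
      dot3 (nrm (rhat t) (R n) x) (JD χ m q c (An n) (ψ n) (t, x)) •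
        (fun i => x i - rcen q rhat R ψ n t i) ∂μH[2])
    (fun _ => 0) atTop (Set.Icc Tm Tp)
  hQ23 : TendstoUniformlyOn
    (fun n t => ∫ t' in t₀..t, ∫ x in sphere (rhat t') (R n),
      (rhoD q (ψ n) (t', x) * dot3 (fun i => deriv rhat t' i) (nrm (rhat t') (R n) x)
        - dot3 (nrm (rhat t') (R n) x) (JD χ m q c (An n) (ψ n) (t', x))) ∂μH[2])
    (fun _ => 0) atTop (Set.Icc Tm Tp)
  hQ3 : TendstoUniformlyOn
    (fun n t => ∫ t' in t₀..t, ∫ x in closedBall (rhat t') (R n),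
      (fun j => rhoD q (ψ n) (t', x) * (ED c (φn n) (An n) (t', x) j - ED c φinf Ainf (t', x) j)
        + (1 / c) * cross3 (JD χ m q c (An n) (ψ n) (t', x))
            (fun k => BD (An n) (t', x) k - BD Ainf (t', x) k) j))
    (fun _ => 0) atTop (Set.Icc Tm Tp)



lemma aux_unit_sphere : μH[2] (sphere (0:V3) 1) < ⊤ := by
  let f : (Fin 2 → ℝ) → V3 := fun v =>
    !₂[Real.sin (v 0) * Real.cos (v 1), Real.sin (v 0) * Real.sin (v 1), Real.cos (v 0)]
  let s : Set (Fin 2 → ℝ) := Set.Icc (fun _ => -4) (fun _ => 4)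
  have hf : ContDiff ℝ 1 f := by
    rw [contDiff_euclidean]
    intro i
    fin_cases i <;> simp [f] <;> fun_prop
  obtain ⟨K, hK⟩ := hf.contDiffOn.exists_lipschitzOnWith (s := s) (by norm_num) (convex_Icc _ _) isCompact_Icc
  have h1 := hK.hausdorffMeasure_image_le (d := 2) (by norm_num)
  have h2 : sphere (0:V3) 1 ⊆ f '' s := by
    intro x hx
    have hx' : x 0 ^ 2 + x 1 ^ 2 + x 2 ^ 2 = 1 := by
      have := mem_sphere_zero_iff_norm.1 hx
      have h3 := EuclideanSpace.norm_sq_eq x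
      rw [this] at h3
      simp [Fin.sum_univ_three] at h3
      linarith
    let w : ℂ := ⟨x 0, x 1⟩
    have hz1 : -1 ≤ x 2 := by nlinarith [sq_nonneg (x 0), sq_nonneg (x 1)]
    have hz2 : x 2 ≤ 1 := by nlinarith [sq_nonneg (x 0), sq_nonneg (x 1)]
    have hw : Real.sin (Real.arccos (x 2)) = ‖w‖ := by
      rw [Real.sin_arccos, Complex.norm_def, Complex.normSq_apply]
      congr 1
      simp only [w]; linarith
    refine ⟨![Real.arccos (x 2), Complex.arg w], ?_, ?_⟩
    · have := Real.arccos_nonneg (x 2)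
      have := Real.arccos_le_pi (x 2)
      have := Complex.neg_pi_lt_arg w
      have := Complex.arg_le_pi w
      have := Real.pi_lt_four
      simp only [s, Set.mem_Icc, Pi.le_def, Fin.forall_fin_two]
      simp
      refine ⟨⟨?_, ?_⟩, ?_, ?_⟩ <;> linarith
    · ext i
      have e1 := Complex.norm_mul_cos_arg w
      have e2 := Complex.norm_mul_sin_arg w
      fin_cases i
      · simp [f, hw]; rfl
      · simp [f, hw]; rfl
      · simp [f, Real.cos_arccos hz1 hz2]
  refine (measure_mono h2).trans_lt (h1.trans_lt ?_)
  have h3 : (μH[2] : Measure (Fin 2 → ℝ)) = volume := by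
    have := hausdorffMeasure_pi_real (ι := Fin 2)
    simpa using this
  rw [h3]
  apply ENNReal.mul_lt_top
  · simp
  · exact isCompact_Icc.measure_lt_top

lemma aux_sphere : ∃ C : ℝ, 0 ≤ C ∧ ∀ (x : V3) (R : ℝ), 0 < R →
    μH[2] (sphere x R) < ⊤ ∧ (μH[2] : Measure V3).real (sphere x R) = C * R ^ 2 := by
  refine ⟨(μH[2] : Measure V3).real (sphere 0 1), measureReal_nonneg, fun x R hR => ?_⟩
  have h1 : sphere x R = (IsometryEquiv.vaddConst x) '' (AffineMap.homothety (0:V3) R '' sphere (0:V3) 1) := by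
    ext y
    simp only [Set.mem_image, mem_sphere_iff_norm, sub_zero]
    constructor
    · intro h
      refine ⟨y - x, ⟨R⁻¹ • (y - x), ?_, ?_⟩, ?_⟩
      · rw [norm_smul, h]; simp [abs_of_pos hR, hR.ne']
      · simp [AffineMap.homothety_apply, smul_smul, hR.ne']
      · simp
    · rintro ⟨_, ⟨z, hz, rfl⟩, rfl⟩
      simp [AffineMap.homothety_apply, norm_smul, abs_of_pos hR, hz]
  have h2 : μH[2] (sphere x R) = ENNReal.ofReal (R^2) * μH[2] (sphere (0:V3) 1) := by
    rw [h1, IsometryEquiv.hausdorffMeasure_image, hausdorffMeasure_homothety_image (by norm_num) _ hR.ne']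
    rw [ENNReal.smul_def, smul_eq_mul]
    congr 1
    rw [← ENNReal.ofReal_coe_nnreal]
    congr 1
    simp
  constructor
  · rw [h2]; exact ENNReal.mul_lt_top (by simp) aux_unit_sphere
  · rw [measureReal_def, h2, ENNReal.toReal_mul, ENNReal.toReal_ofReal (by positivity), mul_comm]
    rfl

/-- Odd functions on a sphere have zero integral. -/
lemma aux_sphere_odd {F : Type*} [NormedAddCommGroup F] [NormedSpace ℝ F] (x : V3) (R : ℝ) (f : V3 → F)
    (hf : ∀ y, f (x - y) = - f (x + y)) : ∫ y in sphere x R, f y ∂μH[2] = 0 := by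
  have h := (IsometryEquiv.subLeft (x + x)).measurePreserving_hausdorffMeasure 2
  have h2 := h.setIntegral_preimage_emb
    (IsometryEquiv.subLeft (x + x)).toHomeomorph.measurableEmbedding f (sphere x R)
  have h3 : (IsometryEquiv.subLeft (x + x)) ⁻¹' (sphere x R) = sphere x R := by
    ext y
    simp only [Set.mem_preimage, mem_sphere_iff_norm, IsometryEquiv.subLeft_apply]
    rw [← norm_neg, show -(x + x - y - x) = y - x by abel]
  rw [h3] at h2
  have h4 : ∀ y, f ((IsometryEquiv.subLeft (x + x)) y) = - f y := by
    intro y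
    have := hf (y - x)
    rw [IsometryEquiv.subLeft_apply, show x + x - y = x - (y - x) by abel, this]
    congr 2
    abel
  simp only [h4, integral_neg] at h2
  have h5 : (2:ℝ) • ∫ y in sphere x R, f y ∂μH[2] = 0 := by
    rw [two_smul]; nth_rewrite 1 [← h2]; simp
  simpa using h5


/-- Passage to the moving frame. -/
def PhiM (r : ℝ → V3) (p : ℝ × V3) : ℝ × V3 := (p.1, p.2 - r p.1)

lemma PhiM_contDiff {n : WithTop ℕ∞} {r : ℝ → V3} (hr : ContDiff ℝ n r) : ContDiff ℝ n (PhiM r) := by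
  unfold PhiM
  exact contDiff_fst.prodMk (contDiff_snd.sub (hr.comp contDiff_fst))

lemma PhiM_hasFDerivAt {r : ℝ → V3} {p : ℝ × V3} (hr : DifferentiableAt ℝ r p.1) :
    HasFDerivAt (PhiM r) ((ContinuousLinearMap.fst ℝ ℝ V3).prod
      (ContinuousLinearMap.snd ℝ ℝ V3 -
        (ContinuousLinearMap.fst ℝ ℝ V3).smulRight (deriv r p.1))) p := by
  unfold PhiM
  refine hasFDerivAt_fst.prodMk (hasFDerivAt_snd.sub ?_)
  exact hr.hasDerivAt.hasFDerivAt.comp p hasFDerivAt_fst |>.congr_fderiv (by ext <;> simp)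

section gen
variable {F : Type} [NormedAddCommGroup F] [NormedSpace ℝ F]

lemma fderiv_comp_PhiM {r : ℝ → V3} {p : ℝ × V3} (hr : DifferentiableAt ℝ r p.1)
    {H : ℝ × V3 → F} (hH : DifferentiableAt ℝ H (PhiM r p)) (v : ℝ × V3) :
    fderiv ℝ (fun p => H (PhiM r p)) p v = fderiv ℝ H (PhiM r p) (v.1, v.2 - v.1 • deriv r p.1) := by
  have := (hH.hasFDerivAt.comp p (PhiM_hasFDerivAt hr)).fderiv
  change fderiv ℝ (H ∘ PhiM r) p v = _
  rw [this]; simp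

lemma V3_sum (v : V3) : v = ∑ i, v i • EuclideanSpace.single i (1:ℝ) := by
  ext j
  fin_cases j <;> simp [Fin.sum_univ_three]

lemma fderiv_space (H : ℝ × V3 → F) (p : ℝ × V3) (v : V3) :
    fderiv ℝ H p (0, v) = ∑ i, v i • pxD i H p := by
  unfold pxD
  conv_lhs => rw [V3_sum v]
  have : ((0:ℝ), ∑ i, v i • EuclideanSpace.single i (1:ℝ))
      = ∑ i, v i • ((0:ℝ), (EuclideanSpace.single i (1:ℝ) : V3)) := by
    simp [Fin.sum_univ_three]
  rw [this, map_sum]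
  exact Finset.sum_congr rfl fun i _ => map_smul _ _ _

lemma fderivS_space (H : V3 → F) (p : V3) (v : V3) :
    fderiv ℝ H p v = ∑ i, v i • pxS i H p := by
  unfold pxS
  conv_lhs => rw [V3_sum v]
  rw [map_sum]
  simp

lemma pxD_comp_PhiM {r : ℝ → V3} {p : ℝ × V3} (hr : DifferentiableAt ℝ r p.1)
    {H : ℝ × V3 → F} (hH : DifferentiableAt ℝ H (PhiM r p)) (i : Fin 3) :
    pxD i (fun p => H (PhiM r p)) p = pxD i H (PhiM r p) := by
  unfold pxD
  rw [fderiv_comp_PhiM hr hH]; simp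

lemma ptD_comp_PhiM {r : ℝ → V3} {p : ℝ × V3} (hr : DifferentiableAt ℝ r p.1)
    {H : ℝ × V3 → F} (hH : DifferentiableAt ℝ H (PhiM r p)) :
    ptD (fun p => H (PhiM r p)) p
      = ptD H (PhiM r p) - ∑ i, deriv r p.1 i • pxD i H (PhiM r p) := by
  unfold ptD
  rw [fderiv_comp_PhiM hr hH, ← fderiv_space, ← map_sub]; simp

lemma pxS_slice {H : ℝ × V3 → F} {t : ℝ} {y : V3} (hH : DifferentiableAt ℝ H (t, y)) (i : Fin 3) :
    pxS i (fun y => H (t, y)) y = pxD i H (t, y) := by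
  unfold pxS pxD
  have := (hH.hasFDerivAt.comp y (hasFDerivAt_prodMk_right t y)).fderiv
  change fderiv ℝ (H ∘ fun y => (t, y)) y _ = _
  rw [this]; simp

lemma hasDerivAt_slice {H : ℝ × V3 → F} {t : ℝ} {y : V3} (hH : DifferentiableAt ℝ H (t, y)) :
    HasDerivAt (fun s => H (s, y)) (ptD H (t, y)) t := by
  unfold ptD
  have := (hH.hasFDerivAt.comp t (hasFDerivAt_prodMk_left t y)).hasDerivAt
  simpa [Function.comp_def] using this

lemma hasDerivAt_sliceX {H : ℝ × V3 → F} {t : ℝ} {y : V3} (hH : DifferentiableAt ℝ H (t, y)) (i : Fin 3) :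
    HasDerivAt (fun s : ℝ => H (t, y + s • EuclideanSpace.single i (1:ℝ))) (pxD i H (t, y)) 0 := by
  unfold pxD
  have h1 : HasDerivAt (fun s : ℝ => (t, y + s • (EuclideanSpace.single i (1:ℝ) : V3)))
      ((0:ℝ), (EuclideanSpace.single i (1:ℝ) : V3)) 0 := by
    refine (hasDerivAt_const _ _).prodMk ?_
    simpa using ((hasDerivAt_id (0:ℝ)).smul_const (EuclideanSpace.single i (1:ℝ) : V3)).const_add y
  have := HasFDerivAt.comp_hasDerivAt (f := fun s : ℝ => (t, y + s • (EuclideanSpace.single i (1:ℝ) : V3)))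
    (0:ℝ) (l := H) (l' := fderiv ℝ H (t, y)) (by simpa using hH.hasFDerivAt) h1
  simpa [Function.comp_def] using this

lemma pxD_contDiff {n k : WithTop ℕ∞} {H : ℝ × V3 → F} (hH : ContDiff ℝ n H) (hk : k + 1 ≤ n) (i : Fin 3) :
    ContDiff ℝ k (pxD i H) := by
  unfold pxD
  exact (hH.fderiv_right hk).clm_apply contDiff_const

lemma ptD_contDiff {n k : WithTop ℕ∞} {H : ℝ × V3 → F} (hH : ContDiff ℝ n H) (hk : k + 1 ≤ n) :
    ContDiff ℝ k (ptD H) := by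
  unfold ptD
  exact (hH.fderiv_right hk).clm_apply contDiff_const

lemma fderiv_zero_of_hom {H : ℝ × V3 → F} {t : ℝ} (hH : DifferentiableAt ℝ H (t, 0))
    (h0 : ∀ s, H (s, 0) = 0) (k : ℝ) (hk : k ≠ 2) (hhom : ∀ y : V3, H (t, (2:ℝ) • y) = k • H (t, y)) :
    fderiv ℝ H (t, 0) = 0 := by
  have h1 : ptD H (t, 0) = 0 := by
    have := hasDerivAt_slice hH
    simp only [h0] at this
    exact this.unique (hasDerivAt_const _ _)
  have h2 : ∀ i, pxD i H (t, 0) = 0 := by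
    intro i
    have a1 := hasDerivAt_sliceX hH i
    have a2 := a1.const_smul k
    simp only [zero_add] at a1 a2
    have a3 : HasDerivAt (fun s : ℝ => H (t, (2 * s) • EuclideanSpace.single i (1:ℝ)))
        ((2:ℝ) • pxD i H (t, 0)) 0 := by
      have := HasDerivAt.scomp (𝕜 := ℝ) (h := fun s : ℝ => 2 * s) (h' := 2) (0:ℝ)
        (g₁ := fun s : ℝ => H (t, s • EuclideanSpace.single i (1:ℝ))) (g₁' := pxD i H (t, 0))
        (by simpa using a1) (by simpa using (hasDerivAt_id (0:ℝ)).const_mul 2)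
      exact this
    have a4 : (fun s : ℝ => H (t, (2 * s) • EuclideanSpace.single i (1:ℝ)))
        = k • fun s : ℝ => H (t, s • EuclideanSpace.single i (1:ℝ)) := by
      ext s
      rw [Pi.smul_apply, ← hhom, smul_smul]
    rw [a4] at a3
    have a5 := a3.unique a2
    have : (2 - k) • pxD i H (t, 0) = 0 := by rw [sub_smul, a5, sub_self]
    rcases smul_eq_zero.1 this with h | h
    · exact absurd (by linarith) hk
    · exact h
  refine ContinuousLinearMap.ext fun v => ?_
  have h3 := fderiv_space H (t, 0) v.2
  have h4 : v = v.1 • ((1:ℝ), (0:V3)) + (0, v.2) := by ext <;> simp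
  rw [h4, map_add, map_smul, h3]
  simp only [ptD] at h1
  simp [h2, h1]

end gen

lemma tube_small {Tm Tp : ℝ} {r : ℝ → V3} (hr : Continuous r) {R : ℕ → ℝ}
    (hR0 : Tendsto R atTop (nhds 0)) {D : ℝ × V3 → ℝ} (hD : Continuous D)
    (hz : ∀ t, D (t, r t) = 0) {ε : ℝ} (hε : 0 < ε) :
    ∃ N, ∀ n ≥ N, ∀ p ∈ Tube Tm Tp r (R n), D p < ε := by
  let Ψ : ℝ × V3 → ℝ × V3 := fun p => (p.1, p.2 + r p.1)
  have hΨ : Continuous Ψ := by fun_prop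
  have ho : IsOpen {p | D (Ψ p) < ε} := isOpen_lt (hD.comp hΨ) continuous_const
  obtain ⟨u, v, hu, hv, hIu, h0v, huv⟩ := generalized_tube_lemma (s := Set.Icc Tm Tp) isCompact_Icc
    (t := {(0:V3)}) isCompact_singleton ho (by
      rintro ⟨t, y⟩ ⟨_, hy⟩
      simp only [Set.mem_singleton_iff] at hy
      subst hy
      simp [Ψ, hz, hε])
  obtain ⟨δ, hδ, hb⟩ := Metric.isOpen_iff.1 hv 0 (h0v rfl)
  obtain ⟨N, hN⟩ := eventually_atTop.1 (hR0.eventually (gt_mem_nhds hδ))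
  refine ⟨N, fun n hn p hp => ?_⟩
  have h1 : (p.1, p.2 - r p.1) ∈ u ×ˢ v := by
    refine ⟨hIu hp.1, hb ?_⟩
    rw [mem_ball_zero_iff]
    exact hp.2.trans_lt (hN n hn)
  have := huv h1
  simpa [Ψ] using this

lemma tube_bdd {Tm Tp : ℝ} {r : ℝ → V3} (hr : Continuous r) {R : ℕ → ℝ}
    (hR0 : Tendsto R atTop (nhds 0)) {F : Type*} [NormedAddCommGroup F] {D : ℝ × V3 → F} (hD : Continuous D) :
    ∃ C, 0 ≤ C ∧ ∀ n, ∀ p ∈ Tube Tm Tp r (R n), ‖D p‖ ≤ C := by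
  obtain ⟨M, hM⟩ := hR0.bddAbove_range
  let Ψ : ℝ × V3 → ℝ × V3 := fun p => (p.1, p.2 + r p.1)
  have hΨ : Continuous Ψ := by fun_prop
  obtain ⟨C, hC⟩ := ((isCompact_Icc (a := Tm) (b := Tp)).prod (isCompact_closedBall (0:V3) M)).exists_bound_of_continuousOn
    (hD.comp hΨ).continuousOn
  refine ⟨max C 0, le_max_right _ _, fun n p hp => le_max_of_le_left ?_⟩
  have := hC (p.1, p.2 - r p.1) ⟨hp.1, by
    rw [mem_closedBall_zero_iff]
    exact hp.2.trans (hM ⟨n, rfl⟩)⟩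
  simpa [Ψ] using this


lemma coord_contDiff {n : WithTop ℕ∞} (i : Fin 3) : ContDiff ℝ n (fun p : ℝ × V3 => p.2 i) := by
  have h : ContDiff ℝ n (fun x : V3 => x i) := contDiff_euclidean.1 contDiff_id i
  exact h.comp contDiff_snd

lemma derivV_contDiff {n : WithTop ℕ∞} {r : ℝ → V3} (hr : ContDiff ℝ n (deriv r)) (i : Fin 3) :
    ContDiff ℝ n (fun p : ℝ × V3 => deriv r p.1 i) :=
  (contDiff_euclidean.1 hr i).comp contDiff_fst

lemma comp1_contDiff {n : WithTop ℕ∞} {f : ℝ → Fin 3 → ℝ} (hf : ContDiff ℝ n f) (i : Fin 3) :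
    ContDiff ℝ n (fun p : ℝ × V3 => f p.1 i) :=
  (contDiff_pi.1 hf i).comp contDiff_fst

lemma comp2_contDiff {n : WithTop ℕ∞} {f : ℝ → Fin 3 → Fin 3 → ℝ} (hf : ContDiff ℝ n f) (i j : Fin 3) :
    ContDiff ℝ n (fun p : ℝ × V3 => f p.1 i j) :=
  (contDiff_pi.1 (contDiff_pi.1 hf i) j).comp contDiff_fst

/-- The cubic potential as a function on space-time. -/
def Pj (P3 : ℝ → V3 → ℝ) (p : ℝ × V3) : ℝ := P3 p.1 p.2

lemma pxS_P3 {P3 : ℝ → V3 → ℝ} (h : Differentiable ℝ (Pj P3)) (j : Fin 3) (t : ℝ) (y : V3) :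
    pxS j (P3 t) y = pxD j (Pj P3) (t, y) := pxS_slice (H := Pj P3) (h _) j

lemma pxD_hom {H : ℝ × V3 → ℝ} (hH : Differentiable ℝ H) {k : ℝ} {t : ℝ}
    (hhom : ∀ y : V3, H (t, (2:ℝ) • y) = k * H (t, y)) (i : Fin 3) (y : V3) :
    pxD i H (t, (2:ℝ) • y) = (k / 2) * pxD i H (t, y) := by
  have a1 := hasDerivAt_sliceX (hH (t, (2:ℝ) • y)) i
  have a2 := hasDerivAt_sliceX (hH (t, y)) i
  have a3 : HasDerivAt (fun s : ℝ => k * H (t, y + ((1/2) * s) • EuclideanSpace.single i (1:ℝ)))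
        (k * (pxD i H (t, y) * (1 / 2))) 0 := by
    have := HasDerivAt.comp (h := fun s : ℝ => (1/2) * s) (h' := 1/2) (0:ℝ)
        (h₂ := fun s : ℝ => H (t, y + s • EuclideanSpace.single i (1:ℝ))) (h₂' := pxD i H (t, y))
        (by simpa using a2) (by simpa only [mul_one, id] using (hasDerivAt_id (0:ℝ)).const_mul (1/2:ℝ))
    exact this.const_mul k
  have a4 : (fun s : ℝ => H (t, (2:ℝ) • y + s • EuclideanSpace.single i (1:ℝ)))
      = fun s : ℝ => k * H (t, y + ((1/2) * s) • EuclideanSpace.single i (1:ℝ)) := by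
    ext s
    rw [← hhom, smul_add, smul_smul]
    congr 5; ring
  rw [a4] at a1
  rw [a1.unique a3]; ring

lemma ptD_hom {H : ℝ × V3 → ℝ} (hH : Differentiable ℝ H) {k : ℝ}
    (hhom : ∀ t, ∀ y : V3, H (t, (2:ℝ) • y) = k * H (t, y)) (t : ℝ) (y : V3) :
    ptD H (t, (2:ℝ) • y) = k * ptD H (t, y) := by
  have a1 := hasDerivAt_slice (hH (t, (2:ℝ) • y))
  have a2 := (hasDerivAt_slice (hH (t, y))).const_mul k
  simp only [hhom] at a1
  exact a1.unique a2

lemma hom_zero {H : ℝ × V3 → ℝ} {k : ℝ} (hk : k ≠ 1) {t : ℝ}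
    (hhom : ∀ y : V3, H (t, (2:ℝ) • y) = k * H (t, y)) : H (t, 0) = 0 := by
  have := hhom 0
  rw [smul_zero] at this
  have h2 : (k - 1) * H (t, 0) = 0 := by linarith
  rcases mul_eq_zero.1 h2 with h | h
  · exact absurd (by linarith) hk
  · exact h

lemma fderiv_zero_of_hom' {H : ℝ × V3 → ℝ} (hH : Differentiable ℝ H) (k : ℝ) (hk : k ≠ 2) (hk1 : k ≠ 1)
    (hhom : ∀ t, ∀ y : V3, H (t, (2:ℝ) • y) = k * H (t, y)) (t : ℝ) :
    H (t, 0) = 0 ∧ fderiv ℝ H (t, 0) = 0 :=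
  ⟨hom_zero hk1 (hhom t), fderiv_zero_of_hom (hH _) (fun s => hom_zero hk1 (hhom s)) k hk
    (by simpa using hhom t)⟩

lemma Pj_hom {P3 : ℝ → V3 → ℝ}
    (hP3hom : ∀ t : ℝ, ∀ ζ > (0 : ℝ), ∀ y : V3, P3 t (ζ • y) = ζ ^ 3 * P3 t y) (t : ℝ) (y : V3) :
    Pj P3 (t, (2:ℝ) • y) = 8 * Pj P3 (t, y) := by
  simp only [Pj]; rw [hP3hom t 2 (by norm_num) y]; norm_num

lemma Pj_euler {P3 : ℝ → V3 → ℝ} (h : Differentiable ℝ (Pj P3))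
    (hP3hom : ∀ t : ℝ, ∀ ζ > (0 : ℝ), ∀ y : V3, P3 t (ζ • y) = ζ ^ 3 * P3 t y) (t : ℝ) (y : V3) :
    ∑ i, y i * pxD i (Pj P3) (t, y) = 3 * Pj P3 (t, y) := by
  have h1 : HasDerivAt (fun s : ℝ => Pj P3 (t, s • y)) (fderiv ℝ (Pj P3) (t, y) (0, y)) 1 := by
    have h1 : HasDerivAt (fun s : ℝ => (t, s • y)) ((0:ℝ), y) 1 := by
      refine (hasDerivAt_const _ _).prodMk ?_
      simpa using ((hasDerivAt_id (1:ℝ)).smul_const y)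
    have := HasFDerivAt.comp_hasDerivAt (f := fun s : ℝ => (t, s • y))
      (1:ℝ) (l := Pj P3) (l' := fderiv ℝ (Pj P3) (t, y)) (by simpa using (h (t,y)).hasFDerivAt) h1
    exact this
  have h2 : HasDerivAt (fun s : ℝ => s ^ 3 * Pj P3 (t, y)) (3 * Pj P3 (t, y)) 1 := by
    simpa using ((hasDerivAt_id (1:ℝ)).pow 3).mul_const (Pj P3 (t, y))
  have h3 : (fun s : ℝ => Pj P3 (t, s • y)) =ᶠ[𝓝 1] (fun s : ℝ => s ^ 3 * Pj P3 (t, y)) := by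
    filter_upwards [lt_mem_nhds (zero_lt_one (α := ℝ))] with s hs
    exact hP3hom t s hs y
  have h4 := (h2.congr_of_eventuallyEq h3).unique h1
  rw [h4, fderiv_space]; simp

/-- Explicit form of the quadratic part. -/
noncomputable def phi2E (m q c : ℝ) (r : ℝ → V3) (A1 : ℝ → Fin 3 → Fin 3 → ℝ)
    (P3 : ℝ → V3 → ℝ) (p : ℝ × V3) : ℝ :=
  -(q / (2 * m * c ^ 2)) * (∑ i, (breveA A1 p.1 (fun i => p.2 i) i) ^ 2)
    - (1 / c) * P2q (deriv A1) p.1 (fun i => p.2 i) - (1 / c) * ptD (Pj P3) p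
    + (1 / c) * ∑ i, deriv r p.1 i * pxD i (Pj P3) p

lemma deriv_P2q {A1 : ℝ → Fin 3 → Fin 3 → ℝ} (hA1 : Differentiable ℝ A1) (t : ℝ) (y : Fin 3 → ℝ) :
    HasDerivAt (fun s => P2q A1 s y) (P2q (deriv A1) t y) t := by
  have h : ∀ i j, HasDerivAt (fun s => A1 s i j) (deriv A1 t i j) t := fun i j =>
    hasDerivAt_pi.1 (hasDerivAt_pi.1 (hA1 t).hasDerivAt i) j
  unfold P2q dot3 matVec
  refine HasDerivAt.const_mul _ (HasDerivAt.fun_sum fun i _ => HasDerivAt.const_mul _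
    (HasDerivAt.fun_sum fun j _ => (h i j).mul_const _))

lemma phi2_eq {m q c : ℝ} {r : ℝ → V3} {A1 : ℝ → Fin 3 → Fin 3 → ℝ} {P3 : ℝ → V3 → ℝ}
    (hA1 : Differentiable ℝ A1) (hP : Differentiable ℝ (Pj P3)) (p : ℝ × V3) :
    phi2WC m q c r A1 P3 p.1 p.2 = phi2E m q c r A1 P3 p := by
  unfold phi2WC phi2E
  have h1 := ((deriv_P2q hA1 p.1 (fun i => p.2 i)).add (hasDerivAt_slice (hP (p.1, p.2)))).deriv
  have h2 : deriv (fun s => P2q A1 s (fun i => p.2 i) + P3 s p.2) p.1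
    = P2q (deriv A1) p.1 (fun i => p.2 i) + ptD (Pj P3) (p.1, p.2) := h1
  rw [h2]
  simp only [pxS_P3 hP, dot3, Prod.mk.eta]
  ring

lemma breve_contDiff {n : WithTop ℕ∞} {A1 : ℝ → Fin 3 → Fin 3 → ℝ} (hA1 : ContDiff ℝ n A1) (i : Fin 3) :
    ContDiff ℝ n (fun p : ℝ × V3 => breveA A1 p.1 (fun i => p.2 i) i) := by
  unfold breveA
  refine contDiff_const.mul (ContDiff.sum fun j _ => ?_)
  exact ((comp2_contDiff hA1 _ _).sub (comp2_contDiff hA1 _ _)).mul (coord_contDiff j)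

lemma P2q_contDiff {n : WithTop ℕ∞} {A1 : ℝ → Fin 3 → Fin 3 → ℝ} (hA1 : ContDiff ℝ n A1) :
    ContDiff ℝ n (fun p : ℝ × V3 => P2q A1 p.1 (fun i => p.2 i)) := by
  unfold P2q dot3 matVec
  refine contDiff_const.mul (ContDiff.sum fun i _ => (coord_contDiff i).mul (ContDiff.sum fun j _ => ?_))
  exact (comp2_contDiff hA1 _ _).mul (coord_contDiff j)

lemma phi2E_contDiff {n : WithTop ℕ∞} (hn : n ≤ 2) {m q c : ℝ} {r : ℝ → V3} {A1 : ℝ → Fin 3 → Fin 3 → ℝ}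
    {P3 : ℝ → V3 → ℝ} (hr : ContDiff ℝ n (deriv r)) (hA1 : ContDiff ℝ 3 A1) (hP : ContDiff ℝ 4 (Pj P3)) :
    ContDiff ℝ n (phi2E m q c r A1 P3) := by
  have hA1' : ContDiff ℝ 2 (deriv A1) := ((contDiff_succ_iff_deriv (n := 2)).1 (by norm_num; exact hA1)).2.2
  have hpt : ContDiff ℝ 2 (ptD (Pj P3)) := ptD_contDiff hP (by norm_num)
  have hpx : ∀ i, ContDiff ℝ 2 (pxD i (Pj P3)) := fun i => pxD_contDiff hP (by norm_num) i
  unfold phi2E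
  refine (((contDiff_const.mul (ContDiff.sum fun i _ => (((breve_contDiff hA1 i).of_le ?_).pow 2))).sub
    (contDiff_const.mul ((P2q_contDiff hA1').of_le hn))).sub (contDiff_const.mul (hpt.of_le hn))).add
    (contDiff_const.mul (ContDiff.sum fun i _ => (derivV_contDiff hr i).mul ((hpx i).of_le hn)))
  exact hn.trans (by norm_num)

lemma phi2E_zero {m q c : ℝ} {r : ℝ → V3} {A1 : ℝ → Fin 3 → Fin 3 → ℝ}
    {P3 : ℝ → V3 → ℝ} (hr : ContDiff ℝ 1 (deriv r)) (hA1 : ContDiff ℝ 3 A1) (hP : ContDiff ℝ 4 (Pj P3))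
    (hP3hom : ∀ t : ℝ, ∀ ζ > (0 : ℝ), ∀ y : V3, P3 t (ζ • y) = ζ ^ 3 * P3 t y) (t : ℝ) :
    phi2E m q c r A1 P3 (t, 0) = 0 ∧ fderiv ℝ (phi2E m q c r A1 P3) (t, 0) = 0 := by
  have hA1' : ContDiff ℝ 2 (deriv A1) := ((contDiff_succ_iff_deriv (n := 2)).1 (by norm_num; exact hA1)).2.2
  have hPd : Differentiable ℝ (Pj P3) := hP.differentiable (by norm_num)
  have hpt : ContDiff ℝ 2 (ptD (Pj P3)) := ptD_contDiff hP (by norm_num)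
  have hpx : ∀ i, ContDiff ℝ 2 (pxD i (Pj P3)) := fun i => pxD_contDiff hP (by norm_num) i
  have f1 : ContDiff ℝ 1 (fun p : ℝ × V3 => -(q / (2 * m * c ^ 2)) * (∑ i, (breveA A1 p.1 (fun i => p.2 i) i) ^ 2)
    - (1 / c) * P2q (deriv A1) p.1 (fun i => p.2 i)
    + (1 / c) * ∑ i, deriv r p.1 i * pxD i (Pj P3) p) := 
    (((contDiff_const.mul (ContDiff.sum fun i _ => (((breve_contDiff hA1 i).of_le (by norm_num)).pow 2))).sub
    (contDiff_const.mul ((P2q_contDiff hA1').of_le (by norm_num))))).add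
    (contDiff_const.mul (ContDiff.sum fun i _ => (derivV_contDiff hr i).mul ((hpx i).of_le (by norm_num))))
  have e1 := fderiv_zero_of_hom' (f1.differentiable (by norm_num)) 4 (by norm_num) (by norm_num) (by
    intro t y
    simp only [pxD_hom hPd (Pj_hom hP3hom t), breveA, P2q, dot3, matVec, Fin.sum_univ_three, PiLp.smul_apply, smul_eq_mul]
    ring) t
  have f2 := hpt.differentiable (by norm_num)
  have e2 := fderiv_zero_of_hom' f2 8 (by norm_num) (by norm_num)
    (ptD_hom hPd (Pj_hom hP3hom)) t
  have e3 : phi2E m q c r A1 P3 = fun p => (-(q / (2 * m * c ^ 2)) * (∑ i, (breveA A1 p.1 (fun i => p.2 i) i) ^ 2)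
    - (1 / c) * P2q (deriv A1) p.1 (fun i => p.2 i)
    + (1 / c) * ∑ i, deriv r p.1 i * pxD i (Pj P3) p) - (1 / c) * ptD (Pj P3) p := by
    ext p; unfold phi2E; ring
  rw [e3]
  constructor
  · beta_reduce; rw [e1.1, e2.1]; simp
  · rw [fderiv_fun_sub (f1.differentiable (by norm_num) _) ((f2 _).const_mul _), e1.2,
      fderiv_const_mul (f2 _), e2.2]; simp

lemma gradP_zero {P3 : ℝ → V3 → ℝ} (hP : ContDiff ℝ 4 (Pj P3))
    (hP3hom : ∀ t : ℝ, ∀ ζ > (0 : ℝ), ∀ y : V3, P3 t (ζ • y) = ζ ^ 3 * P3 t y) (t : ℝ) :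
    (fun j => pxD j (Pj P3) (t, 0)) = 0 ∧ fderiv ℝ (fun p j => pxD j (Pj P3) p) (t, 0) = 0 := by
  have hPd : Differentiable ℝ (Pj P3) := hP.differentiable (by norm_num)
  have hpx : ∀ i, Differentiable ℝ (pxD i (Pj P3)) := fun i =>
    (pxD_contDiff (k := 2) hP (by norm_num) i).differentiable (by norm_num)
  have e : ∀ j, _ := fun j => fderiv_zero_of_hom' (hpx j) 4 (by norm_num) (by norm_num) (by
    intro t y
    rw [pxD_hom hPd (Pj_hom hP3hom t)]; norm_num) t
  constructor
  · ext j; exact (e j).1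
  · rw [fderiv_pi (fun j => hpx j _)]
    refine ContinuousLinearMap.ext fun v => funext fun j => ?_
    simp [(e j).2]


lemma fderiv_pi_apply {A : ℝ × V3 → Fin 3 → ℝ} {p : ℝ × V3} (hA : DifferentiableAt ℝ A p) (v : ℝ × V3) (j : Fin 3) :
    fderiv ℝ A p v j = fderiv ℝ (fun p => A p j) p v := by
  have h := hasFDerivAt_pi'.1 hA.hasFDerivAt j
  rw [h.fderiv]; rfl

lemma pxD_pi {A : ℝ × V3 → Fin 3 → ℝ} {p : ℝ × V3} (hA : DifferentiableAt ℝ A p) (i j : Fin 3) :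
    pxD i A p j = pxD i (fun p => A p j) p := fderiv_pi_apply hA _ j

lemma ptD_pi {A : ℝ × V3 → Fin 3 → ℝ} {p : ℝ × V3} (hA : DifferentiableAt ℝ A p) (j : Fin 3) :
    ptD A p j = ptD (fun p => A p j) p := fderiv_pi_apply hA _ j

lemma ptD_of {F : Type} [NormedAddCommGroup F] [NormedSpace ℝ F] {H : ℝ × V3 → F} {t : ℝ} {y : V3}
    (hH : DifferentiableAt ℝ H (t, y)) {d : F} (h : HasDerivAt (fun s => H (s, y)) d t) :
    ptD H (t, y) = d := (hasDerivAt_slice hH).unique h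

lemma pxD_of {F : Type} [NormedAddCommGroup F] [NormedSpace ℝ F] {H : ℝ × V3 → F} {t : ℝ} {y : V3}
    (hH : DifferentiableAt ℝ H (t, y)) {d : F} {i : Fin 3}
    (h : HasDerivAt (fun s : ℝ => H (t, y + s • EuclideanSpace.single i (1:ℝ))) d 0) :
    pxD i H (t, y) = d := (hasDerivAt_sliceX hH i).unique h

/-- Linear part of the electric potential in the moving frame. -/
noncomputable def phiL (φ0 : ℝ → ℝ) (φ1 : ℝ → Fin 3 → ℝ) (p : ℝ × V3) : ℝ :=
  φ0 p.1 + dot3 (fun i => p.2 i) (φ1 p.1)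

/-- Linear part of the magnetic potential in the moving frame. -/
noncomputable def AL (A0 : ℝ → Fin 3 → ℝ) (A1 : ℝ → Fin 3 → Fin 3 → ℝ) (p : ℝ × V3) : Fin 3 → ℝ := fun j =>
  A0 p.1 j + matVec (A1 p.1) (fun i => p.2 i) j

/-- Gradient of the cubic potential. -/
noncomputable def gP (P3 : ℝ → V3 → ℝ) (p : ℝ × V3) : Fin 3 → ℝ := fun j => pxD j (Pj P3) p

lemma phiL_contDiff {n : WithTop ℕ∞} {φ0 : ℝ → ℝ} {φ1 : ℝ → Fin 3 → ℝ} (h0 : ContDiff ℝ n φ0) (h1 : ContDiff ℝ n φ1) :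
    ContDiff ℝ n (phiL φ0 φ1) := by
  unfold phiL dot3
  exact (h0.comp contDiff_fst).add (ContDiff.sum fun i _ => (coord_contDiff i).mul (comp1_contDiff h1 i))

lemma AL_contDiff {n : WithTop ℕ∞} {A0 : ℝ → Fin 3 → ℝ} {A1 : ℝ → Fin 3 → Fin 3 → ℝ} (h0 : ContDiff ℝ n A0)
    (h1 : ContDiff ℝ n A1) : ContDiff ℝ n (AL A0 A1) := by
  rw [contDiff_pi]
  intro j
  unfold AL matVec
  exact (comp1_contDiff h0 j).add (ContDiff.sum fun i _ => (comp2_contDiff h1 j i).mul (coord_contDiff i))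

lemma gP_contDiff {P3 : ℝ → V3 → ℝ} (hP : ContDiff ℝ 4 (Pj P3)) : ContDiff ℝ 3 (gP P3) := by
  rw [contDiff_pi]
  intro j
  exact pxD_contDiff hP (by norm_num) j

lemma pxD_phiL {φ0 : ℝ → ℝ} {φ1 : ℝ → Fin 3 → ℝ} (h0 : ContDiff ℝ 1 φ0) (h1 : ContDiff ℝ 1 φ1) (i : Fin 3) (p : ℝ × V3) :
    pxD i (phiL φ0 φ1) p = φ1 p.1 i := by
  obtain ⟨t, y⟩ := p
  refine pxD_of ((phiL_contDiff h0 h1).differentiable (by norm_num) _) ?_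
  have h : HasDerivAt (fun s : ℝ => phiL φ0 φ1 (t, y) + s * φ1 t i) (φ1 t i) 0 := by
    simpa using ((hasDerivAt_id (0:ℝ)).mul_const (φ1 t i)).const_add (phiL φ0 φ1 (t, y))
  refine h.congr_of_eventuallyEq (Eventually.of_forall fun s => ?_)
  fin_cases i <;> simp [phiL, dot3, Fin.sum_univ_three] <;> ring

lemma AL_diff {A0 : ℝ → Fin 3 → ℝ} {A1 : ℝ → Fin 3 → Fin 3 → ℝ} (h0 : ContDiff ℝ 2 A0)
    (h1 : ContDiff ℝ 3 A1) : Differentiable ℝ (AL A0 A1) :=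
  (AL_contDiff h0 (h1.of_le (by norm_num))).differentiable (by norm_num)

lemma pxD_AL {A0 : ℝ → Fin 3 → ℝ} {A1 : ℝ → Fin 3 → Fin 3 → ℝ} (h0 : ContDiff ℝ 2 A0)
    (h1 : ContDiff ℝ 3 A1) (i j : Fin 3) (p : ℝ × V3) :
    pxD i (AL A0 A1) p j = A1 p.1 j i := by
  obtain ⟨t, y⟩ := p
  have hd := AL_diff h0 h1
  rw [pxD_pi (hd _)]
  refine pxD_of (differentiable_pi.1 hd j _) ?_
  have h : HasDerivAt (fun s : ℝ => AL A0 A1 (t, y) j + s * A1 t j i) (A1 t j i) 0 := by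
    simpa using ((hasDerivAt_id (0:ℝ)).mul_const (A1 t j i)).const_add (AL A0 A1 (t, y) j)
  refine h.congr_of_eventuallyEq (Eventually.of_forall fun s => ?_)
  fin_cases i <;> simp [AL, matVec, Fin.sum_univ_three] <;> ring

lemma ptD_AL {A0 : ℝ → Fin 3 → ℝ} {A1 : ℝ → Fin 3 → Fin 3 → ℝ} (h0 : ContDiff ℝ 2 A0)
    (h1 : ContDiff ℝ 3 A1) (j : Fin 3) (p : ℝ × V3) :
    ptD (AL A0 A1) p j = deriv A0 p.1 j + ∑ i, deriv A1 p.1 j i * p.2 i := by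
  obtain ⟨t, y⟩ := p
  have hd := AL_diff h0 h1
  rw [ptD_pi (hd _)]
  refine ptD_of (differentiable_pi.1 hd j _) ?_
  have e0 : HasDerivAt (fun s => A0 s j) (deriv A0 t j) t :=
    hasDerivAt_pi.1 ((h0.differentiable (by norm_num)) t).hasDerivAt j
  have e1 : ∀ i j, HasDerivAt (fun s => A1 s i j) (deriv A1 t i j) t := fun i j =>
    hasDerivAt_pi.1 (hasDerivAt_pi.1 ((h1.differentiable (by norm_num)) t).hasDerivAt i) j
  unfold AL matVec
  exact e0.add (HasDerivAt.fun_sum fun i _ => (e1 j i).mul_const (y i))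

lemma phiWC_eq {m q c : ℝ} {r : ℝ → V3} {φ0 : ℝ → ℝ} {φ1 : ℝ → Fin 3 → ℝ} {A1 : ℝ → Fin 3 → Fin 3 → ℝ} {P3 : ℝ → V3 → ℝ}
    (hA1 : ContDiff ℝ 3 A1) (hP : ContDiff ℝ 4 (Pj P3)) :
    phiWC m q c r φ0 φ1 A1 P3 = fun p => phiL φ0 φ1 (PhiM r p) + phi2E m q c r A1 P3 (PhiM r p) := by
  ext p
  rw [← phi2_eq (hA1.differentiable (by norm_num)) (hP.differentiable (by norm_num))]
  rfl

lemma AWC_eq {r : ℝ → V3} {A0 : ℝ → Fin 3 → ℝ} {A1 : ℝ → Fin 3 → Fin 3 → ℝ} {P3 : ℝ → V3 → ℝ}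
    (hP : ContDiff ℝ 4 (Pj P3)) :
    AWC r A0 A1 P3 = fun p => AL A0 A1 (PhiM r p) + gP P3 (PhiM r p) := by
  ext p j
  unfold AWC
  rw [pxS_P3 (hP.differentiable (by norm_num))]
  rfl

section
variable {m q c : ℝ} {r : ℝ → V3} {φ0 : ℝ → ℝ} {φ1 : ℝ → Fin 3 → ℝ} {A0 : ℝ → Fin 3 → ℝ}
  {A1 : ℝ → Fin 3 → Fin 3 → ℝ} {P3 : ℝ → V3 → ℝ}

lemma deriv_contDiff1 (hr : ContDiff ℝ 2 r) : ContDiff ℝ 1 (deriv r) :=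
  ((contDiff_succ_iff_deriv (n := 1)).1 (by norm_num; exact hr)).2.2

lemma fderiv_phi2_core (hr : ContDiff ℝ 2 r) (hA1 : ContDiff ℝ 3 A1) (hP : ContDiff ℝ 4 (Pj P3))
    (hP3hom : ∀ t : ℝ, ∀ ζ > (0 : ℝ), ∀ y : V3, P3 t (ζ • y) = ζ ^ 3 * P3 t y) (t : ℝ) :
    fderiv ℝ (fun p => phi2E m q c r A1 P3 (PhiM r p)) (t, r t) = 0 := by
  refine ContinuousLinearMap.ext fun v => ?_
  rw [fderiv_comp_PhiM (hr.differentiable (by norm_num) _)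
    ((phi2E_contDiff (by norm_num) (deriv_contDiff1 hr) hA1 hP).differentiable (by norm_num) _)]
  simp [PhiM, (phi2E_zero (deriv_contDiff1 hr) hA1 hP hP3hom t).2]

lemma fderiv_gP_core (hr : ContDiff ℝ 2 r) (hP : ContDiff ℝ 4 (Pj P3))
    (hP3hom : ∀ t : ℝ, ∀ ζ > (0 : ℝ), ∀ y : V3, P3 t (ζ • y) = ζ ^ 3 * P3 t y) (t : ℝ) :
    fderiv ℝ (fun p => gP P3 (PhiM r p)) (t, r t) = 0 := by
  refine ContinuousLinearMap.ext fun v => ?_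
  rw [fderiv_comp_PhiM (hr.differentiable (by norm_num) _)
    ((gP_contDiff hP).differentiable (by norm_num) _)]
  have : fderiv ℝ (gP P3) (t, 0) = 0 := (gradP_zero hP hP3hom t).2
  simp [PhiM, this]

lemma phi_comp_contDiff {n : WithTop ℕ∞} {F : Type*} [NormedAddCommGroup F] [NormedSpace ℝ F] {H : ℝ × V3 → F}
    (hr : ContDiff ℝ n r) (hH : ContDiff ℝ n H) :
    ContDiff ℝ n (fun p => H (PhiM r p)) := hH.comp (PhiM_contDiff hr)

lemma pxD_phi_core (hr : ContDiff ℝ 2 r) (hφ0 : ContDiff ℝ 2 φ0) (hφ1 : ContDiff ℝ 2 φ1)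
    (hA1 : ContDiff ℝ 3 A1) (hP : ContDiff ℝ 4 (Pj P3))
    (hP3hom : ∀ t : ℝ, ∀ ζ > (0 : ℝ), ∀ y : V3, P3 t (ζ • y) = ζ ^ 3 * P3 t y) (t : ℝ) (i : Fin 3) :
    pxD i (phiWC m q c r φ0 φ1 A1 P3) (t, r t) = φ1 t i := by
  rw [phiWC_eq hA1 hP]
  have h1 := (phi_comp_contDiff (hr.of_le (by norm_num)) (phiL_contDiff (n := 1) (hφ0.of_le (by norm_num)) (hφ1.of_le (by norm_num)))).differentiable (by norm_num) (t, r t)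
  have h2 := (phi_comp_contDiff (hr.of_le (by norm_num)) (phi2E_contDiff (m := m) (q := q) (c := c) (n := 1) (by norm_num) (deriv_contDiff1 hr) hA1 hP)).differentiable (by norm_num) (t, r t)
  have : pxD i (fun p => phiL φ0 φ1 (PhiM r p) + phi2E m q c r A1 P3 (PhiM r p)) (t, r t)
    = pxD i (fun p => phiL φ0 φ1 (PhiM r p)) (t, r t) := by
    unfold pxD
    rw [fderiv_fun_add h1 h2, fderiv_phi2_core hr hA1 hP hP3hom]; simp
  rw [this, pxD_comp_PhiM (hr.differentiable (by norm_num) _)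
    ((phiL_contDiff hφ0 hφ1).differentiable (by norm_num) _),
    pxD_phiL (hφ0.of_le (by norm_num)) (hφ1.of_le (by norm_num))]
  rfl

lemma fderiv_A_core (hr : ContDiff ℝ 2 r) (hA0 : ContDiff ℝ 2 A0)
    (hA1 : ContDiff ℝ 3 A1) (hP : ContDiff ℝ 4 (Pj P3))
    (hP3hom : ∀ t : ℝ, ∀ ζ > (0 : ℝ), ∀ y : V3, P3 t (ζ • y) = ζ ^ 3 * P3 t y) (t : ℝ) :
    fderiv ℝ (AWC r A0 A1 P3) (t, r t) = fderiv ℝ (fun p => AL A0 A1 (PhiM r p)) (t, r t) := by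
  rw [AWC_eq hP]
  have h1 := (phi_comp_contDiff hr (AL_contDiff hA0 (hA1.of_le (by norm_num)))).differentiable (by norm_num) (t, r t)
  have h2 := (phi_comp_contDiff hr ((gP_contDiff hP).of_le (by norm_num))).differentiable (by norm_num) (t, r t)
  rw [fderiv_fun_add h1 h2, fderiv_gP_core hr hP hP3hom]; simp

lemma pxD_A_core (hr : ContDiff ℝ 2 r) (hA0 : ContDiff ℝ 2 A0)
    (hA1 : ContDiff ℝ 3 A1) (hP : ContDiff ℝ 4 (Pj P3))
    (hP3hom : ∀ t : ℝ, ∀ ζ > (0 : ℝ), ∀ y : V3, P3 t (ζ • y) = ζ ^ 3 * P3 t y) (t : ℝ) (i j : Fin 3) :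
    pxD i (AWC r A0 A1 P3) (t, r t) j = A1 t j i := by
  have : pxD i (AWC r A0 A1 P3) (t, r t) = pxD i (fun p => AL A0 A1 (PhiM r p)) (t, r t) := by
    unfold pxD; rw [fderiv_A_core hr hA0 hA1 hP hP3hom]
  rw [this, pxD_comp_PhiM (hr.differentiable (by norm_num) _) (AL_diff hA0 hA1 _), pxD_AL hA0 hA1]
  rfl

lemma ptD_A_core (hr : ContDiff ℝ 2 r) (hA0 : ContDiff ℝ 2 A0)
    (hA1 : ContDiff ℝ 3 A1) (hP : ContDiff ℝ 4 (Pj P3))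
    (hP3hom : ∀ t : ℝ, ∀ ζ > (0 : ℝ), ∀ y : V3, P3 t (ζ • y) = ζ ^ 3 * P3 t y) (t : ℝ) (j : Fin 3) :
    ptD (AWC r A0 A1 P3) (t, r t) j = deriv A0 t j - ∑ i, deriv r t i * A1 t j i := by
  have : ptD (AWC r A0 A1 P3) (t, r t) = ptD (fun p => AL A0 A1 (PhiM r p)) (t, r t) := by
    unfold ptD; rw [fderiv_A_core hr hA0 hA1 hP hP3hom]
  rw [this, ptD_comp_PhiM (hr.differentiable (by norm_num) _) (AL_diff hA0 hA1 _)]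
  simp only [Pi.sub_apply, Finset.sum_apply, Pi.smul_apply, pxD_AL hA0 hA1, ptD_AL hA0 hA1]
  simp [PhiM]

lemma newton_explicit (hr : ContDiff ℝ 2 r) (hφ0 : ContDiff ℝ 2 φ0) (hφ1 : ContDiff ℝ 2 φ1) (hA0 : ContDiff ℝ 2 A0)
    (hA1 : ContDiff ℝ 3 A1) (hP : ContDiff ℝ 4 (Pj P3))
    (hP3hom : ∀ t : ℝ, ∀ ζ > (0 : ℝ), ∀ y : V3, P3 t (ζ • y) = ζ ^ 3 * P3 t y)
    (hNewton : ∀ t : ℝ, ∀ j : Fin 3,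
      m * deriv (deriv r) t j
        = q * ED c (phiWC m q c r φ0 φ1 A1 P3) (AWC r A0 A1 P3) (t, r t) j
          + (q / c) * cross3 (fun i => deriv r t i)
              (BD (AWC r A0 A1 P3) (t, r t)) j) (t : ℝ) (j : Fin 3) :
    m * deriv (deriv r) t j = - q * φ1 t j - (q / c) * deriv A0 t j
      + (q / c) * ∑ i, A1 t i j * deriv r t i := by
  rw [hNewton t j]
  unfold ED BD cross3
  simp only [pxD_phi_core hr hφ0 hφ1 hA1 hP hP3hom, pxD_A_core hr hA0 hA1 hP hP3hom,
    ptD_A_core hr hA0 hA1 hP hP3hom, Fin.sum_univ_three]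
  fin_cases j <;> simp <;> ring

lemma r_contDiff3 (hm : 0 < m) (hr : ContDiff ℝ 2 r) (hφ1 : ContDiff ℝ 2 φ1) (hA0 : ContDiff ℝ 2 A0)
    (hA1 : ContDiff ℝ 3 A1)
    (hN : ∀ t j, m * deriv (deriv r) t j = - q * φ1 t j - (q / c) * deriv A0 t j
      + (q / c) * ∑ i, A1 t i j * deriv r t i) : ContDiff ℝ 2 (deriv r) := by
  have hr' := deriv_contDiff1 hr
  have hA0' : ContDiff ℝ 1 (deriv A0) := ((contDiff_succ_iff_deriv (n := 1)).1 (by norm_num; exact hA0)).2.2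
  have h : ContDiff ℝ 1 (deriv (deriv r)) := by
    rw [contDiff_euclidean]
    intro j
    have e : (fun t => deriv (deriv r) t j) = fun t => m⁻¹ * (- q * φ1 t j - (q / c) * deriv A0 t j
      + (q / c) * ∑ i, A1 t i j * deriv r t i) := by
      ext t; rw [← hN]; field_simp
    rw [e]
    refine contDiff_const.mul (((contDiff_const.mul ((contDiff_pi.1 hφ1 j).of_le (by norm_num))).sub
      (contDiff_const.mul (contDiff_pi.1 hA0' j))).add (contDiff_const.mul (ContDiff.sum fun i _ => ?_)))
    exact ((contDiff_pi.1 (contDiff_pi.1 hA1 i) j).of_le (by norm_num)).mul (contDiff_euclidean.1 hr' i)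
  have := (contDiff_succ_iff_deriv (n := 1) (f := deriv r)).2 ⟨hr'.differentiable (by norm_num), by simp, h⟩
  norm_num at this
  exact this
end


lemma fderiv_expI {σ : ℝ × V3 → ℝ} {w : ℝ × V3 → ℂ} {p : ℝ × V3} (hσ : DifferentiableAt ℝ σ p)
    (hw : DifferentiableAt ℝ w p) (v : ℝ × V3) :
    fderiv ℝ (fun p => Complex.exp (Complex.I * ((σ p : ℝ) : ℂ)) * w p) p v
      = Complex.exp (Complex.I * ((σ p : ℝ) : ℂ)) *
        (fderiv ℝ w p v + Complex.I * ((fderiv ℝ σ p v : ℝ) : ℂ) * w p) := by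
  have h1 : HasFDerivAt (fun p => ((σ p : ℝ) : ℂ)) (Complex.ofRealCLM.comp (fderiv ℝ σ p)) p :=
    Complex.ofRealCLM.hasFDerivAt.comp p hσ.hasFDerivAt
  have h2 := (((h1.const_mul Complex.I).cexp).mul hw.hasFDerivAt).fderiv
  change fderiv ℝ ((fun x => Complex.exp (Complex.I * ((σ x:ℝ):ℂ))) * w) p v = _
  rw [h2]
  simp
  ring

lemma fderiv_ofReal {f : ℝ × V3 → ℝ} {p : ℝ × V3} (hf : DifferentiableAt ℝ f p) (v : ℝ × V3) :
    fderiv ℝ (fun p => ((f p : ℝ) : ℂ)) p v = ((fderiv ℝ f p v : ℝ) : ℂ) := by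
  have h1 : HasFDerivAt (fun p => ((f p : ℝ) : ℂ)) (Complex.ofRealCLM.comp (fderiv ℝ f p)) p :=
    Complex.ofRealCLM.hasFDerivAt.comp p hf.hasFDerivAt
  rw [h1.fderiv]; rfl

lemma differentiable_ofReal {f : ℝ × V3 → ℝ} (hf : Differentiable ℝ f) :
    Differentiable ℝ (fun p => ((f p : ℝ) : ℂ)) := fun p =>
  (Complex.ofRealCLM.hasFDerivAt.comp p (hf p).hasFDerivAt).differentiableAt

lemma covX_exp {χ q c : ℝ} {A : ℝ × V3 → Fin 3 → ℝ} {i : Fin 3} {σ : ℝ × V3 → ℝ} {w : ℝ × V3 → ℂ} {p : ℝ × V3}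
    {k : ℝ} (hσ : DifferentiableAt ℝ σ p) (hw : DifferentiableAt ℝ w p)
    (hk : pxD i σ p - q / (χ * c) * A p i = k) :
    covX χ q c A i (fun p => Complex.exp (Complex.I * ((σ p : ℝ) : ℂ)) * w p) p
      = Complex.exp (Complex.I * ((σ p : ℝ) : ℂ)) * (pxD i w p + Complex.I * (k : ℂ) * w p) := by
  subst hk
  unfold covX pxD
  rw [fderiv_expI hσ hw]
  push_cast
  ring

lemma covX_psi {χ q c : ℝ} {A : ℝ × V3 → Fin 3 → ℝ} {i : Fin 3} {σ u : ℝ × V3 → ℝ} {p : ℝ × V3}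
    {k : ℝ} (hσ : DifferentiableAt ℝ σ p) (hu : Differentiable ℝ u)
    (hk : pxD i σ p - q / (χ * c) * A p i = k) :
    covX χ q c A i (fun p => Complex.exp (Complex.I * ((σ p : ℝ) : ℂ)) * ((u p : ℝ) : ℂ)) p
      = Complex.exp (Complex.I * ((σ p : ℝ) : ℂ)) * (((pxD i u p : ℝ) : ℂ) + Complex.I * (k : ℂ) * ((u p : ℝ) : ℂ)) := by
  rw [covX_exp hσ (differentiable_ofReal hu p) hk]
  congr 2
  exact fderiv_ofReal (hu p) _

lemma covT_psi {χ q : ℝ} {φ : ℝ × V3 → ℝ} {σ u : ℝ × V3 → ℝ} {p : ℝ × V3}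
    {k : ℝ} (hσ : DifferentiableAt ℝ σ p) (hu : Differentiable ℝ u)
    (hk : ptD σ p + q / χ * φ p = k) :
    covT χ q φ (fun p => Complex.exp (Complex.I * ((σ p : ℝ) : ℂ)) * ((u p : ℝ) : ℂ)) p
      = Complex.exp (Complex.I * ((σ p : ℝ) : ℂ)) * (((ptD u p : ℝ) : ℂ) + Complex.I * (k : ℂ) * ((u p : ℝ) : ℂ)) := by
  subst hk
  unfold covT ptD
  rw [fderiv_expI hσ (differentiable_ofReal hu p), fderiv_ofReal (hu p)]
  push_cast
  ring

lemma normSq_exp (σ : ℝ) (z : ℂ) : Complex.normSq (Complex.exp (Complex.I * (σ : ℂ)) * z) = Complex.normSq z := by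
  rw [map_mul, Complex.normSq_eq_norm_sq, mul_comm Complex.I, Complex.norm_exp_ofReal_mul_I]; simp

lemma NLS_of {χ m q c a : ℝ} (hm : 0 < m) (hχ : 0 < χ) {G1' : ℝ → ℝ} {φ : ℝ × V3 → ℝ} {A : ℝ × V3 → Fin 3 → ℝ}
    {σ u : ℝ × V3 → ℝ} {K : Fin 3 → ℝ × V3 → ℝ} (hσ : Differentiable ℝ σ) (hu : ContDiff ℝ 2 u)
    (hKd : ∀ i, Differentiable ℝ (K i))
    (hK : ∀ i p, pxD i σ p - q / (χ * c) * A p i = K i p) (hdiv : ∀ i p, pxD i (K i) p = 0) (p : ℝ × V3)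
    (h1 : ∑ i, pxD i (pxD i u) p = ((a ^ 2)⁻¹ * G1' (a ^ 3 * (u p) ^ 2)) * u p)
    (h2 : ptD u p = -(χ / m) * ∑ i, K i p * pxD i u p)
    (h3 : ptD σ p + q / χ * φ p = -(χ / (2 * m)) * ∑ i, (K i p) ^ 2) :
    SatisfiesNLS χ m q c a G1' φ A (fun p => Complex.exp (Complex.I * ((σ p : ℝ) : ℂ)) * ((u p : ℝ) : ℂ)) p := by
  have hud : Differentiable ℝ u := hu.differentiable (by norm_num)
  have hpu : ∀ i, Differentiable ℝ (pxD i u) := fun i => (pxD_contDiff (k := 1) hu (by norm_num) i).differentiable (by norm_num)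
  have e1 : ∀ i, covX χ q c A i (covX χ q c A i (fun p => Complex.exp (Complex.I * ((σ p : ℝ) : ℂ)) * ((u p : ℝ) : ℂ))) p
      = Complex.exp (Complex.I * ((σ p : ℝ) : ℂ)) * (((pxD i (pxD i u) p : ℝ) : ℂ)
        + 2 * Complex.I * (K i p : ℂ) * ((pxD i u p : ℝ) : ℂ) - (K i p : ℂ) ^ 2 * ((u p : ℝ) : ℂ)) := by
    intro i
    have f1 : covX χ q c A i (fun p => Complex.exp (Complex.I * ((σ p : ℝ) : ℂ)) * ((u p : ℝ) : ℂ))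
      = fun p => Complex.exp (Complex.I * ((σ p : ℝ) : ℂ)) * (((pxD i u p : ℝ) : ℂ) + Complex.I * (((K i p * u p : ℝ)) : ℂ)) := by
      ext p
      rw [covX_psi (hσ p) hud (hK i p)]
      push_cast; ring
    have f2 := differentiable_ofReal (hpu i)
    have f3 := differentiable_ofReal ((hKd i).fun_mul hud)
    rw [f1, covX_exp (hσ p) ((f2 p).fun_add ((f3 p).const_mul _)) (hK i p)]
    have f4 : pxD i (fun p => ((pxD i u p : ℝ) : ℂ) + Complex.I * (((K i p * u p : ℝ)) : ℂ)) p
      = ((pxD i (pxD i u) p : ℝ) : ℂ) + Complex.I * ((K i p * pxD i u p : ℝ) : ℂ) := by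
      have g1 := hdiv i p
      have g2 : fderiv ℝ (fun p => K i p * u p) p (0, EuclideanSpace.single i 1) = K i p * pxD i u p := by
        rw [fderiv_fun_mul (hKd i p) (hud p)]
        unfold pxD at g1 ⊢
        simp [g1]
      rw [← g2]
      have g3 : pxD i (fun p => ((pxD i u p : ℝ) : ℂ) + Complex.I * (((K i p * u p : ℝ)) : ℂ)) p
        = fderiv ℝ (fun p => ((pxD i u p : ℝ) : ℂ)) p (0, EuclideanSpace.single i 1)
          + Complex.I * fderiv ℝ (fun p => (((K i p * u p : ℝ)) : ℂ)) p (0, EuclideanSpace.single i 1) := by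
        conv_lhs => rw [pxD]
        rw [fderiv_fun_add (f2 p) ((f3 p).const_mul _), fderiv_const_mul (f3 p)]
        simp
      rw [g3, fderiv_ofReal (hpu i p), fderiv_ofReal (((hKd i).fun_mul hud) p)]
      rfl
    rw [f4]
    push_cast
    linear_combination (Complex.exp (Complex.I * ((σ p : ℝ) : ℂ)) * (K i p : ℂ) ^ 2 * ((u p : ℝ) : ℂ)) * Complex.I_sq
  unfold SatisfiesNLS
  simp only [e1]
  rw [covT_psi (hσ p) hud h3, h2, normSq_exp, Complex.normSq_ofReal]
  have h1' : ∑ i, ((pxD i (pxD i u) p : ℝ) : ℂ) = (((a ^ 2)⁻¹ * G1' (a ^ 3 * (u p * u p)) : ℝ) : ℂ) * ((u p : ℝ) : ℂ) := by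
    rw [← Complex.ofReal_sum, h1, ← Complex.ofReal_mul]; ring_nf
  rw [Fin.sum_univ_three] at h1'
  have hm' : (m : ℂ) ≠ 0 := by exact_mod_cast hm.ne'
  generalize (((a ^ 2)⁻¹ * G1' (a ^ 3 * (u p * u p)) : ℝ) : ℂ) = g at *
  simp only [Fin.sum_univ_three]
  push_cast
  field_simp
  generalize Complex.exp (Complex.I * ((σ p : ℝ) : ℂ)) = E
  generalize (u p : ℂ) = U at *
  ring_nf
  simp only [Complex.I_sq]
  linear_combination (χ : ℂ) * h1'

lemma even_deriv_zero {f : ℝ → ℝ} {d : ℝ} (h : HasDerivAt f d 0) (he : ∀ s, f (-s) = f s) : d = 0 := by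
  have h2 : HasDerivAt (fun s => f (-s)) (d * (-1)) 0 := by
    have := HasDerivAt.comp (h := fun s : ℝ => -s) (h' := -1) (0:ℝ) (h₂ := f) (h₂' := d) (by simpa using h) (hasDerivAt_neg 0)
    exact this
  simp only [he] at h2
  have := h.unique h2
  linarith

lemma radial_orth {f : ℝ → ℝ} {y v : V3} (hf : DifferentiableAt ℝ (fun x : V3 => f ‖x‖) y) (h : inner ℝ y v = 0) :
    fderiv ℝ (fun x : V3 => f ‖x‖) y v = 0 := by
  have h1 : HasDerivAt (fun s : ℝ => y + s • v) v 0 := by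
    simpa using ((hasDerivAt_id (0:ℝ)).smul_const v).const_add y
  have h2 := HasFDerivAt.comp_hasDerivAt (f := fun s : ℝ => y + s • v) (0:ℝ) (l := fun x : V3 => f ‖x‖)
    (l' := fderiv ℝ (fun x : V3 => f ‖x‖) y) (by simpa using hf.hasFDerivAt) h1
  refine even_deriv_zero h2 fun s => ?_
  simp only [Function.comp_apply]
  congr 1
  have e : ∀ s : ℝ, ‖y + s • v‖ ^ 2 = ‖y‖ ^ 2 + s ^ 2 * ‖v‖ ^ 2 := by
    intro s
    rw [norm_add_sq_real, inner_smul_right, h, norm_smul, mul_pow, Real.norm_eq_abs, sq_abs]; ring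
  have : ‖y + (-s) • v‖ ^ 2 = ‖y + s • v‖ ^ 2 := by rw [e, e]; ring
  exact (sq_eq_sq₀ (norm_nonneg _) (norm_nonneg _)).1 this


/-- The integrand of the time-dependent phase. -/
noncomputable def spI (m q c : ℝ) (r : ℝ → V3) (φ0 : ℝ → ℝ) (A0 : ℝ → Fin 3 → ℝ) (t : ℝ) : ℝ :=
  (1 / 2) * m * (∑ i, (deriv r t i) ^ 2) + (q / c) * dot3 (fun i => deriv r t i) (A0 t) - q * φ0 t

/-- The phase in explicit form. -/
noncomputable def SE (χ m q c : ℝ) (r : ℝ → V3) (φ0 : ℝ → ℝ) (A0 : ℝ → Fin 3 → ℝ)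
    (A1 : ℝ → Fin 3 → Fin 3 → ℝ) (P3 : ℝ → V3 → ℝ) (p : ℝ × V3) : ℝ :=
  (m / χ) * (∑ i, deriv r p.1 i * p.2 i) + (q / (χ * c)) * (∑ i, p.2 i * A0 p.1 i)
    + spWC χ m q c r φ0 A0 p.1 + (q / (χ * c)) * (P2q A1 p.1 (fun i => p.2 i) + Pj P3 p)

/-- The wave vector in the moving frame. -/
noncomputable def KE (χ m q c : ℝ) (r : ℝ → V3) (A1 : ℝ → Fin 3 → Fin 3 → ℝ) (i : Fin 3) (p : ℝ × V3) : ℝ :=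
  (m / χ) * deriv r p.1 i - (q / (χ * c)) * breveA A1 p.1 (fun i => p.2 i) i

section
variable {χ m q c : ℝ} {r : ℝ → V3} {φ0 : ℝ → ℝ} {φ1 : ℝ → Fin 3 → ℝ} {A0 : ℝ → Fin 3 → ℝ}
    {A1 : ℝ → Fin 3 → Fin 3 → ℝ} {P3 : ℝ → V3 → ℝ}

lemma SWC_eq (hP : ContDiff ℝ 4 (Pj P3))
    (hP3hom : ∀ t : ℝ, ∀ ζ > (0 : ℝ), ∀ y : V3, P3 t (ζ • y) = ζ ^ 3 * P3 t y) (t : ℝ) (y : V3) :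
    SWC χ m q c r φ0 A0 A1 P3 t y = SE χ m q c r φ0 A0 A1 P3 (t, y) := by
  have hd : Differentiable ℝ (Pj P3) := hP.differentiable (by norm_num)
  unfold SWC SE sp2WC
  have h := Pj_euler hd hP3hom t y
  simp only [pxS_P3 hd, dot3, P2q] at h ⊢
  rw [h]
  ring

lemma spI_contDiff (hr : ContDiff ℝ 1 (deriv r)) (hφ0 : ContDiff ℝ 2 φ0) (hA0 : ContDiff ℝ 2 A0) :
    ContDiff ℝ 1 (spI m q c r φ0 A0) := by
  have h1 := fun i => contDiff_euclidean.1 hr i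
  have h2 := fun i => (contDiff_pi.1 hA0 i).of_le (m := 1) (by norm_num)
  have h3 := hφ0.of_le (m := 1) (by norm_num)
  unfold spI dot3
  exact ((contDiff_const.mul (ContDiff.sum fun i _ => (h1 i).pow 2)).add
    (contDiff_const.mul (ContDiff.sum fun i _ => (h1 i).mul (h2 i)))).sub (contDiff_const.mul h3)

lemma spWC_hasDerivAt (hr : ContDiff ℝ 1 (deriv r)) (hφ0 : ContDiff ℝ 2 φ0) (hA0 : ContDiff ℝ 2 A0) (t : ℝ) :
    HasDerivAt (spWC χ m q c r φ0 A0) (χ⁻¹ * spI m q c r φ0 A0 t) t := by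
  have h := (spI_contDiff (m := m) (q := q) (c := c) hr hφ0 hA0).continuous
  exact (intervalIntegral.integral_hasDerivAt_right (h.intervalIntegrable 0 t)
    h.aestronglyMeasurable.stronglyMeasurableAtFilter h.continuousAt).const_mul χ⁻¹

lemma spWC_contDiff (hr : ContDiff ℝ 1 (deriv r)) (hφ0 : ContDiff ℝ 2 φ0) (hA0 : ContDiff ℝ 2 A0) :
    ContDiff ℝ 2 (spWC χ m q c r φ0 A0) := by
  have h := fun t => spWC_hasDerivAt (χ := χ) (m := m) (q := q) (c := c) hr hφ0 hA0 t
  have : (2 : WithTop ℕ∞) = 1 + 1 := by norm_num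
  rw [this, contDiff_succ_iff_deriv]
  refine ⟨fun t => (h t).differentiableAt, by simp, ?_⟩
  have e : deriv (spWC χ m q c r φ0 A0) = fun t => χ⁻¹ * spI m q c r φ0 A0 t := funext fun t => (h t).deriv
  rw [e]
  exact contDiff_const.mul (spI_contDiff hr hφ0 hA0)

lemma SE_contDiff (hr : ContDiff ℝ 2 (deriv r)) (hφ0 : ContDiff ℝ 2 φ0) (hA0 : ContDiff ℝ 2 A0)
    (hA1 : ContDiff ℝ 3 A1) (hP : ContDiff ℝ 4 (Pj P3)) :
    ContDiff ℝ 2 (SE χ m q c r φ0 A0 A1 P3) := by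
  unfold SE
  exact (((contDiff_const.mul (ContDiff.sum fun i _ => (derivV_contDiff hr i).mul (coord_contDiff i))).add
    (contDiff_const.mul (ContDiff.sum fun i _ => (coord_contDiff i).mul (comp1_contDiff hA0 i)))).add
    ((spWC_contDiff (hr.of_le (by norm_num)) hφ0 hA0).comp contDiff_fst)).add
    (contDiff_const.mul ((P2q_contDiff (hA1.of_le (by norm_num))).add (hP.of_le (by norm_num))))

lemma pxD_SE (hr : ContDiff ℝ 2 (deriv r)) (hφ0 : ContDiff ℝ 2 φ0) (hA0 : ContDiff ℝ 2 A0)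
    (hA1 : ContDiff ℝ 3 A1) (hP : ContDiff ℝ 4 (Pj P3)) (i : Fin 3) (p : ℝ × V3) :
    pxD i (SE χ m q c r φ0 A0 A1 P3) p = (m / χ) * deriv r p.1 i + (q / (χ * c)) * A0 p.1 i
      + (q / (χ * c)) * ((1 / 2) * ∑ k, (A1 p.1 i k + A1 p.1 k i) * p.2 k + pxD i (Pj P3) p) := by
  obtain ⟨t, y⟩ := p
  refine pxD_of ((SE_contDiff hr hφ0 hA0 hA1 hP).differentiable (by norm_num) _) ?_
  have hPd := hasDerivAt_sliceX (hP.differentiable (by norm_num) (t, y)) i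
  have hc : ∀ j, HasDerivAt (fun s : ℝ => (y + s • EuclideanSpace.single i (1:ℝ)) j) (if j = i then 1 else 0) 0 := by
    intro j
    have : HasDerivAt (fun s : ℝ => y j + s * (if j = i then 1 else 0)) (if j = i then 1 else 0) 0 := by
      simpa using ((hasDerivAt_id (0:ℝ)).mul_const (if j = i then (1:ℝ) else 0)).const_add (y j)
    refine this.congr_of_eventuallyEq (Eventually.of_forall fun s => ?_)
    simp
  have key := (((HasDerivAt.fun_sum fun j (_ : j ∈ Finset.univ) => (hc j).const_mul (deriv r t j)).const_mul (m / χ)).add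
    ((HasDerivAt.fun_sum fun j (_ : j ∈ Finset.univ) => (hc j).mul_const (A0 t j)).const_mul (q / (χ * c)))).add_const
      (spWC χ m q c r φ0 A0 t)
  have key2 := key.add (((((HasDerivAt.fun_sum fun j (_ : j ∈ Finset.univ) => (hc j).mul
      (HasDerivAt.fun_sum fun k (_ : k ∈ Finset.univ) => (hc k).const_mul (A1 t j k)))).const_mul (1 / 2)).add hPd).const_mul (q / (χ * c)))
  refine HasDerivAt.congr_deriv (f := fun s : ℝ => SE χ m q c r φ0 A0 A1 P3 (t, y + s • EuclideanSpace.single i (1:ℝ))) key2 ?_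
  fin_cases i <;> simp [Fin.sum_univ_three] <;> (left; ring)

lemma ptD_SE (hr : ContDiff ℝ 2 (deriv r)) (hφ0 : ContDiff ℝ 2 φ0) (hA0 : ContDiff ℝ 2 A0)
    (hA1 : ContDiff ℝ 3 A1) (hP : ContDiff ℝ 4 (Pj P3)) (p : ℝ × V3) :
    ptD (SE χ m q c r φ0 A0 A1 P3) p = (m / χ) * (∑ i, deriv (deriv r) p.1 i * p.2 i)
      + (q / (χ * c)) * (∑ i, p.2 i * deriv A0 p.1 i) + χ⁻¹ * spI m q c r φ0 A0 p.1
      + (q / (χ * c)) * (P2q (deriv A1) p.1 (fun i => p.2 i) + ptD (Pj P3) p) := by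
  obtain ⟨t, y⟩ := p
  refine ptD_of ((SE_contDiff hr hφ0 hA0 hA1 hP).differentiable (by norm_num) _) ?_
  have hPd := hasDerivAt_slice (hP.differentiable (by norm_num) (t, y))
  have h1 : ∀ i, HasDerivAt (fun s => deriv r s i) (deriv (deriv r) t i) t := by
    intro i
    have := (hr.differentiable (by norm_num) t).hasDerivAt
    exact ((EuclideanSpace.proj (𝕜 := ℝ) i).hasFDerivAt (x := deriv r t)).comp_hasDerivAt t this
  have h2 : ∀ i, HasDerivAt (fun s => A0 s i) (deriv A0 t i) t := fun i =>
    hasDerivAt_pi.1 (hA0.differentiable (by norm_num) t).hasDerivAt i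
  have h3 := deriv_P2q (hA1.differentiable (by norm_num)) t (fun i => y i)
  exact ((((HasDerivAt.fun_sum fun i (_ : i ∈ Finset.univ) => (h1 i).mul_const (y i)).const_mul (m / χ)).add
    ((HasDerivAt.fun_sum fun i (_ : i ∈ Finset.univ) => (h2 i).const_mul (y i)).const_mul (q / (χ * c)))).add
    (spWC_hasDerivAt (hr.of_le (by norm_num)) hφ0 hA0 t)).add ((h3.add hPd).const_mul (q / (χ * c)))

lemma KE_contDiff (hr : ContDiff ℝ 2 (deriv r)) (hA1 : ContDiff ℝ 3 A1) (i : Fin 3) :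
    ContDiff ℝ 2 (KE χ m q c r A1 i) := by
  unfold KE
  exact (contDiff_const.mul (derivV_contDiff hr i)).sub (contDiff_const.mul ((breve_contDiff hA1 i).of_le (by norm_num)))

lemma pxD_KE (hr : ContDiff ℝ 2 (deriv r)) (hA1 : ContDiff ℝ 3 A1) (i : Fin 3) (p : ℝ × V3) :
    pxD i (KE χ m q c r A1 i) p = 0 := by
  obtain ⟨t, y⟩ := p
  refine pxD_of ((KE_contDiff hr hA1 i).differentiable (by norm_num) _) ?_
  have : (fun s : ℝ => KE χ m q c r A1 i (t, y + s • EuclideanSpace.single i (1:ℝ))) = fun _ => KE χ m q c r A1 i (t, y) := by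
    ext s
    fin_cases i <;> simp [KE, breveA, Fin.sum_univ_three]
  rw [this]
  exact hasDerivAt_const _ _

lemma KE_eq (hr : ContDiff ℝ 2 (deriv r)) (hφ0 : ContDiff ℝ 2 φ0) (hA0 : ContDiff ℝ 2 A0)
    (hA1 : ContDiff ℝ 3 A1) (hP : ContDiff ℝ 4 (Pj P3)) (i : Fin 3) (p : ℝ × V3) :
    pxD i (SE χ m q c r φ0 A0 A1 P3) p - q / (χ * c) * (AL A0 A1 p i + gP P3 p i) = KE χ m q c r A1 i p := by
  rw [pxD_SE hr hφ0 hA0 hA1 hP]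
  unfold AL gP KE breveA matVec
  fin_cases i <;> simp [Fin.sum_univ_three] <;> ring

lemma phase_t (hχ : 0 < χ) (hm : 0 < m) (hc : 0 < c) (hr : ContDiff ℝ 2 (deriv r)) (hφ0 : ContDiff ℝ 2 φ0) (hA0 : ContDiff ℝ 2 A0)
    (hA1 : ContDiff ℝ 3 A1) (hP : ContDiff ℝ 4 (Pj P3))
    (hN : ∀ t j, m * deriv (deriv r) t j = - q * φ1 t j - (q / c) * deriv A0 t j
      + (q / c) * ∑ i, A1 t i j * deriv r t i) (p : ℝ × V3) :
    (ptD (SE χ m q c r φ0 A0 A1 P3) p - ∑ i, deriv r p.1 i * pxD i (SE χ m q c r φ0 A0 A1 P3) p)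
      + q / χ * (phiL φ0 φ1 p + phi2E m q c r A1 P3 p) = -(χ / (2 * m)) * ∑ i, (KE χ m q c r A1 i p) ^ 2 := by
  have hk : ∀ x b : ℝ, -(χ / (2 * m)) * ((m / χ) * x - (q / (χ * c)) * b) ^ 2
      = -(1 / 2) * (m / χ) * x ^ 2 + (q / (χ * c)) * x * b - (q / χ) * (q / (2 * m * c ^ 2)) * b ^ 2 := by
    intro x b; field_simp; ring
  have hk' : -(χ / (2 * m)) * ∑ i, (KE χ m q c r A1 i p) ^ 2 = ∑ i, (-(1 / 2) * (m / χ) * (deriv r p.1 i) ^ 2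
      + (q / (χ * c)) * (deriv r p.1 i) * (breveA A1 p.1 (fun i => p.2 i) i)
      - (q / χ) * (q / (2 * m * c ^ 2)) * (breveA A1 p.1 (fun i => p.2 i) i) ^ 2) := by
    rw [Finset.mul_sum]
    exact Finset.sum_congr rfl fun i _ => hk _ _
  rw [hk', ptD_SE hr hφ0 hA0 hA1 hP]
  clear hk hk'
  simp only [pxD_SE hr hφ0 hA0 hA1 hP]
  have h := fun j => hN p.1 j
  obtain ⟨t, y⟩ := p
  have h0 := h 0
  have h1 := h 1
  have h2 := h 2
  simp only [KE, breveA, phiL, phi2E, spI, P2q, dot3, matVec, Fin.sum_univ_three] at *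
  linear_combination (exp := 1) (y 0 / χ) * h0 + (y 1 / χ) * h1 + (y 2 / χ) * h2
end


section
variable {χ m q c : ℝ} {φ : ℝ × V3 → ℝ} {A : ℝ × V3 → Fin 3 → ℝ} {σ u : ℝ × V3 → ℝ} {p : ℝ × V3}

/-- Polar form of a wave function. -/
noncomputable def polar (σ u : ℝ × V3 → ℝ) (p : ℝ × V3) : ℂ :=
  Complex.exp (Complex.I * ((σ p : ℝ) : ℂ)) * ((u p : ℝ) : ℂ)

lemma expI_conj (s : ℝ) : Complex.exp (Complex.I * (s : ℂ)) * (starRingEnd ℂ) (Complex.exp (Complex.I * (s : ℂ))) = 1 := by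
  rw [Complex.mul_conj, Complex.normSq_eq_norm_sq, mul_comm Complex.I, Complex.norm_exp_ofReal_mul_I]; simp

lemma rhoD_polar : rhoD q (polar σ u) p = q * (u p) ^ 2 := by
  unfold rhoD polar
  rw [normSq_exp, Complex.normSq_ofReal, sq]

lemma conj_pair (s U x y : ℝ) :
    (starRingEnd ℂ) (Complex.exp (Complex.I * (s : ℂ)) * (U : ℂ)) * (Complex.exp (Complex.I * (s : ℂ)) * ((x : ℂ) + Complex.I * (y : ℂ)))
      = ((U * x : ℝ) : ℂ) + Complex.I * ((U * y : ℝ) : ℂ) := by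
  have h := expI_conj s
  simp only [map_mul, Complex.conj_ofReal]
  push_cast
  linear_combination ((U : ℂ) * (x + Complex.I * y)) * h

lemma pair_conj (s U x y : ℝ) :
    (Complex.exp (Complex.I * (s : ℂ)) * (U : ℂ)) * (starRingEnd ℂ) (Complex.exp (Complex.I * (s : ℂ)) * ((x : ℂ) + Complex.I * (y : ℂ)))
      = ((U * x : ℝ) : ℂ) - Complex.I * ((U * y : ℝ) : ℂ) := by
  have h := expI_conj s
  simp only [map_mul, map_add, Complex.conj_ofReal, Complex.conj_I]
  push_cast
  linear_combination ((U : ℂ) * (x - Complex.I * y)) * h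

lemma conj_pair2 (s x y x' y' : ℝ) :
    (Complex.exp (Complex.I * (s : ℂ)) * ((x : ℂ) + Complex.I * (y : ℂ))) * (starRingEnd ℂ) (Complex.exp (Complex.I * (s : ℂ)) * ((x' : ℂ) + Complex.I * (y' : ℂ)))
      = ((x * x' + y * y' : ℝ) : ℂ) + Complex.I * ((y * x' - x * y' : ℝ) : ℂ) := by
  have h := expI_conj s
  simp only [map_mul, map_add, Complex.conj_ofReal, Complex.conj_I]
  push_cast
  linear_combination ((x + Complex.I * y) * ((x' : ℂ) - Complex.I * y')) * h - ((y : ℂ) * y') * Complex.I_sq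

lemma covX_polar {i : Fin 3} {k : ℝ} (hσ : DifferentiableAt ℝ σ p) (hu : Differentiable ℝ u)
    (hk : pxD i σ p - q / (χ * c) * A p i = k) :
    covX χ q c A i (polar σ u) p
      = Complex.exp (Complex.I * ((σ p : ℝ) : ℂ)) * (((pxD i u p : ℝ) : ℂ) + Complex.I * ((k * u p : ℝ) : ℂ)) := by
  unfold polar
  rw [covX_psi hσ hu hk]; push_cast; ring

lemma covT_polar {k : ℝ} (hσ : DifferentiableAt ℝ σ p) (hu : Differentiable ℝ u)
    (hk : ptD σ p + q / χ * φ p = k) :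
    covT χ q φ (polar σ u) p
      = Complex.exp (Complex.I * ((σ p : ℝ) : ℂ)) * (((ptD u p : ℝ) : ℂ) + Complex.I * ((k * u p : ℝ) : ℂ)) := by
  unfold polar
  rw [covT_psi hσ hu hk]; push_cast; ring

lemma PD_polar {i : Fin 3} {k : ℝ} (hσ : DifferentiableAt ℝ σ p) (hu : Differentiable ℝ u)
    (hk : pxD i σ p - q / (χ * c) * A p i = k) :
    PD χ q c A (polar σ u) p i = χ * k * (u p) ^ 2 := by
  unfold PD
  rw [covX_polar hσ hu hk]
  conv_lhs => rw [polar]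
  rw [conj_pair, pair_conj]
  simp
  ring

lemma JD_polar {i : Fin 3} {k : ℝ} (hσ : DifferentiableAt ℝ σ p) (hu : Differentiable ℝ u)
    (hk : pxD i σ p - q / (χ * c) * A p i = k) :
    JD χ m q c A (polar σ u) p i = (q * χ / m) * k * (u p) ^ 2 := by
  unfold JD
  rw [covX_polar hσ hu hk]
  conv_lhs => rw [polar]
  rw [conj_pair, pair_conj]
  have key : ∀ z x y : ℝ, (-Complex.I * (z : ℂ) * ((x : ℂ) + Complex.I * (y : ℂ) - ((x : ℂ) - Complex.I * (y : ℂ)))).re = 2 * z * y := by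
    intro z x y
    simp
    ring
  rw [key]
  ring

lemma normSq_covX_polar {i : Fin 3} {k : ℝ} (hσ : DifferentiableAt ℝ σ p) (hu : Differentiable ℝ u)
    (hk : pxD i σ p - q / (χ * c) * A p i = k) :
    Complex.normSq (covX χ q c A i (polar σ u) p) = (pxD i u p) ^ 2 + k ^ 2 * (u p) ^ 2 := by
  rw [covX_polar hσ hu hk, normSq_exp, Complex.normSq_apply]
  simp
  ring

lemma TD_polar {Ga : ℝ → ℝ} {K : Fin 3 → ℝ} (hσ : DifferentiableAt ℝ σ p) (hu : Differentiable ℝ u)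
    (hk : ∀ i, pxD i σ p - q / (χ * c) * A p i = K i)
    (ht : ptD σ p + q / χ * φ p = -(χ / (2 * m)) * ∑ i, (K i) ^ 2) (i j : Fin 3) :
    TD χ m q c Ga φ A (polar σ u) i j p = (if i = j then (χ ^ 2 / (2 * m)) * Ga ((u p) ^ 2) else 0)
      + ((if i = j then (χ ^ 2 / (2 * m)) * ∑ k, (pxD k u p) ^ 2 else 0)
        - (χ ^ 2 / m) * (pxD i u p * pxD j u p + K i * K j * (u p) ^ 2)) := by
  unfold TD
  split_ifs with h
  · subst h
    unfold uD
    simp only [normSq_covX_polar hσ hu (hk _)]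
    rw [covT_polar hσ hu ht]
    have e : Complex.normSq (polar σ u p) = (u p) ^ 2 := by
      unfold polar; rw [normSq_exp, Complex.normSq_ofReal, sq]
    rw [e]
    conv_lhs => rw [polar]
    rw [conj_pair, pair_conj]
    have : ∀ x y : ℝ, (Complex.I * ((χ / 2 : ℝ) : ℂ) * (((x : ℝ) : ℂ) - Complex.I * ((y : ℝ) : ℂ) - (((x : ℝ) : ℂ) + Complex.I * ((y : ℝ) : ℂ)))).re = χ * y := by
      intro x y; simp; ring
    rw [this]
    simp only [Fin.sum_univ_three]
    ring
  · rw [covX_polar hσ hu (hk i), covX_polar hσ hu (hk j), conj_pair2, conj_pair2]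
    have : ∀ z x y x' y' : ℝ, (-(z : ℂ) * (((x : ℝ) : ℂ) + Complex.I * ((y : ℝ) : ℂ) + (((x' : ℝ) : ℂ) + Complex.I * ((y' : ℝ) : ℂ)))).re = -z * (x + x') := by
      intro z x y x' y'; simp
    rw [this]
    ring

end

lemma pxD_snd {h : V3 → ℝ} (hh : Differentiable ℝ h) (i : Fin 3) (p : ℝ × V3) :
    pxD i (fun p : ℝ × V3 => h p.2) p = pxS i h p.2 := by
  unfold pxD pxS
  have := ((hh p.2).hasFDerivAt.comp p hasFDerivAt_snd).fderiv
  change fderiv ℝ (h ∘ Prod.snd) p _ = _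
  rw [this]; simp

lemma ptD_snd {h : V3 → ℝ} (hh : Differentiable ℝ h) (p : ℝ × V3) :
    ptD (fun p : ℝ × V3 => h p.2) p = 0 := by
  unfold ptD
  have := ((hh p.2).hasFDerivAt.comp p hasFDerivAt_snd).fderiv
  change fderiv ℝ (h ∘ Prod.snd) p _ = _
  rw [this]; simp

/-- Rescaled form factor. -/
noncomputable def u0 (ψ1 : ℝ → ℝ) (a : ℝ) (y : V3) : ℝ := (a * Real.sqrt a)⁻¹ * ψ1 (‖y‖ / a)

section
variable {ψ1 : ℝ → ℝ} {a : ℝ}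

lemma kappa_sq (ha : 0 < a) : ((a * Real.sqrt a)⁻¹) ^ 2 = (a ^ 3)⁻¹ := by
  rw [inv_pow, mul_pow, Real.sq_sqrt ha.le]; ring

lemma u0_sq (ha : 0 < a) (y : V3) : (u0 ψ1 a y) ^ 2 = (a ^ 3)⁻¹ * (ψ1 (‖y‖ / a)) ^ 2 := by
  unfold u0; rw [mul_pow, kappa_sq ha]

lemma u0_eq (ha : 0 < a) : u0 ψ1 a = fun y => (a * Real.sqrt a)⁻¹ * (fun x : V3 => ψ1 ‖x‖) (a⁻¹ • y) := by
  ext y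
  unfold u0
  simp only [norm_smul, norm_inv, Real.norm_eq_abs, abs_of_pos ha]
  rw [div_eq_inv_mul]

lemma u0_contDiff (hs : ContDiff ℝ 2 fun x : V3 => ψ1 ‖x‖) (ha : 0 < a) : ContDiff ℝ 2 (u0 ψ1 a) := by
  rw [u0_eq ha]
  exact contDiff_const.mul (hs.comp (contDiff_id.const_smul a⁻¹))

lemma pxS_scale {f : V3 → ℝ} (hf : Differentiable ℝ f) (k s : ℝ) (i : Fin 3) (y : V3) :
    pxS i (fun y => k * f (s • y)) y = (k * s) * pxS i f (s • y) := by
  unfold pxS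
  have h1 : HasFDerivAt (fun y : V3 => s • y) (s • ContinuousLinearMap.id ℝ V3) y :=
    (hasFDerivAt_id y).const_smul s
  have := (((hf (s • y)).hasFDerivAt.comp y h1).const_mul k).fderiv
  change fderiv ℝ (fun y => k * (f ∘ fun y => s • y) y) y _ = _
  rw [this]; simp; ring

lemma pxS_contDiff {f : V3 → ℝ} (hf : ContDiff ℝ 2 f) (i : Fin 3) : ContDiff ℝ 1 (pxS i f) := by
  unfold pxS
  exact (hf.fderiv_right (by norm_num)).clm_apply contDiff_const

lemma u0_lap {G1' : ℝ → ℝ} (hs : ContDiff ℝ 2 fun x : V3 => ψ1 ‖x‖) (ha : 0 < a)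
    (hsteady : ∀ x : V3, lap3 (fun x' => ψ1 ‖x'‖) x = G1' ((ψ1 ‖x‖) ^ 2) * ψ1 ‖x‖) (y : V3) :
    ∑ i, pxS i (pxS i (u0 ψ1 a)) y = ((a ^ 2)⁻¹ * G1' (a ^ 3 * (u0 ψ1 a y) ^ 2)) * u0 ψ1 a y := by
  have e1 : ∀ i, pxS i (u0 ψ1 a) = fun y => ((a * Real.sqrt a)⁻¹ * a⁻¹) * pxS i (fun x : V3 => ψ1 ‖x‖) (a⁻¹ • y) := by
    intro i; ext y
    rw [u0_eq ha, pxS_scale (hs.differentiable (by norm_num))]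
  have e2 : ∀ i, pxS i (pxS i (u0 ψ1 a)) y = ((a * Real.sqrt a)⁻¹ * a⁻¹ * a⁻¹) * pxS i (pxS i (fun x : V3 => ψ1 ‖x‖)) (a⁻¹ • y) := by
    intro i
    rw [e1, pxS_scale ((pxS_contDiff hs i).differentiable (by norm_num))]
  simp only [e2]
  rw [← Finset.mul_sum]
  have h := hsteady (a⁻¹ • y)
  unfold lap3 at h
  rw [h, u0_sq ha]
  have hn : ‖a⁻¹ • y‖ = ‖y‖ / a := by
    rw [norm_smul, norm_inv, Real.norm_eq_abs, abs_of_pos ha, div_eq_inv_mul]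
  rw [hn, mul_inv_cancel_left₀ (by positivity)]
  unfold u0
  rw [sq a, mul_inv]; ring

lemma u0_grad_bound (h1 : ContDiff ℝ 2 ψ1) (ha : 0 < a) {y : V3} (hy : y ≠ 0) (i : Fin 3) :
    |pxS i (u0 ψ1 a) y| ≤ (a * Real.sqrt a)⁻¹ * a⁻¹ * |deriv ψ1 (‖y‖ / a)| := by
  have hn : DifferentiableAt ℝ (fun x : V3 => ‖x‖) y := (contDiffAt_norm ℝ hy (n := 1)).differentiableAt (by norm_num)
  have h2 : HasFDerivAt (fun x : V3 => ‖x‖ / a) (a⁻¹ • fderiv ℝ (fun x : V3 => ‖x‖) y) y := by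
    simpa [div_eq_inv_mul] using hn.hasFDerivAt.const_mul a⁻¹
  have h3 := (((h1.differentiable (by norm_num) (‖y‖ / a)).hasDerivAt.comp_hasFDerivAt y h2).const_mul (a * Real.sqrt a)⁻¹).fderiv
  have h4 : pxS i (u0 ψ1 a) y = (a * Real.sqrt a)⁻¹ * (deriv ψ1 (‖y‖ / a) * (a⁻¹ * fderiv ℝ (fun x : V3 => ‖x‖) y (EuclideanSpace.single i 1))) := by
    unfold pxS
    change fderiv ℝ (fun y => (a * Real.sqrt a)⁻¹ * (ψ1 ∘ fun x : V3 => ‖x‖ / a) y) y _ = _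
    rw [h3]; simp
  have h5 : |fderiv ℝ (fun x : V3 => ‖x‖) y (EuclideanSpace.single i 1)| ≤ 1 := by
    have := (fderiv ℝ (fun x : V3 => ‖x‖) y).le_opNorm (EuclideanSpace.single i 1)
    have h6 : ‖fderiv ℝ (fun x : V3 => ‖x‖) y‖ ≤ 1 := by
      simpa using norm_fderiv_le_of_lipschitz ℝ (x₀ := y) (lipschitzWith_one_norm (E := V3))
    simp at this
    exact this.trans h6
  rw [h4, abs_mul, abs_mul, abs_mul, abs_of_pos (a := (a * Real.sqrt a)⁻¹) (by positivity), abs_of_pos (a := a⁻¹) (by positivity)]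
  have : 0 ≤ (a * Real.sqrt a)⁻¹ * a⁻¹ * |deriv ψ1 (‖y‖ / a)| := by positivity
  nlinarith
end


/-- Rescaled form factor around a trajectory. -/
noncomputable def uT (ψ1 : ℝ → ℝ) (r : ℝ → V3) (a : ℝ) (p : ℝ × V3) : ℝ := u0 ψ1 a (p.2 - r p.1)

lemma uT_contDiff {ψ1 : ℝ → ℝ} {r : ℝ → V3} {a : ℝ} (hs : ContDiff ℝ 2 fun x : V3 => ψ1 ‖x‖) (ha : 0 < a)
    (hr : ContDiff ℝ 2 r) : ContDiff ℝ 2 (uT ψ1 r a) :=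
  (u0_contDiff hs ha).comp (contDiff_snd.sub (hr.comp contDiff_fst))

lemma pxD_uT {ψ1 : ℝ → ℝ} {r : ℝ → V3} {a : ℝ} (hs : ContDiff ℝ 2 fun x : V3 => ψ1 ‖x‖) (ha : 0 < a)
    (hr : ContDiff ℝ 2 r) (i : Fin 3) (p : ℝ × V3) : pxD i (uT ψ1 r a) p = pxS i (u0 ψ1 a) (p.2 - r p.1) := by
  have h := (u0_contDiff hs ha).differentiable (by norm_num)
  have h2 := pxD_comp_PhiM (hr.differentiable (by norm_num) p.1) (H := fun p : ℝ × V3 => u0 ψ1 a p.2)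
    (p := p) (h.comp differentiable_snd _) i
  rw [pxD_snd h] at h2
  exact h2

lemma ptD_uT {ψ1 : ℝ → ℝ} {r : ℝ → V3} {a : ℝ} (hs : ContDiff ℝ 2 fun x : V3 => ψ1 ‖x‖) (ha : 0 < a)
    (hr : ContDiff ℝ 2 r) (p : ℝ × V3) : ptD (uT ψ1 r a) p = - ∑ i, deriv r p.1 i * pxS i (u0 ψ1 a) (p.2 - r p.1) := by
  have h := (u0_contDiff hs ha).differentiable (by norm_num)
  have h2 := ptD_comp_PhiM (hr.differentiable (by norm_num) p.1) (H := fun p : ℝ × V3 => u0 ψ1 a p.2)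
    (p := p) (h.comp differentiable_snd _)
  rw [ptD_snd h, zero_sub] at h2
  simp only [pxD_snd h] at h2
  exact h2

lemma pxD2_uT {ψ1 : ℝ → ℝ} {r : ℝ → V3} {a : ℝ} (hs : ContDiff ℝ 2 fun x : V3 => ψ1 ‖x‖) (ha : 0 < a)
    (hr : ContDiff ℝ 2 r) (i : Fin 3) (p : ℝ × V3) :
    pxD i (pxD i (uT ψ1 r a)) p = pxS i (pxS i (u0 ψ1 a)) (p.2 - r p.1) := by
  have h := (pxS_contDiff (u0_contDiff hs ha) i).differentiable (by norm_num)
  have e : pxD i (uT ψ1 r a) = fun p => pxS i (u0 ψ1 a) (p.2 - r p.1) := funext fun p => pxD_uT hs ha hr i p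
  rw [e]
  have h2 := pxD_comp_PhiM (hr.differentiable (by norm_num) p.1) (H := fun p : ℝ × V3 => pxS i (u0 ψ1 a) p.2)
    (p := p) (h.comp differentiable_snd _) i
  rw [pxD_snd h] at h2
  exact h2

lemma u0_orth {ψ1 : ℝ → ℝ} {a : ℝ} (hs : ContDiff ℝ 2 fun x : V3 => ψ1 ‖x‖) (ha : 0 < a)
    (A1 : ℝ → Fin 3 → Fin 3 → ℝ) (t : ℝ) (y : V3) :
    ∑ i, breveA A1 t (fun i => y i) i * pxS i (u0 ψ1 a) y = 0 := by
  have h := fderivS_space (u0 ψ1 a) y (WithLp.toLp 2 (breveA A1 t (fun i => y i)))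
  have h2 := radial_orth (f := fun s => (a * Real.sqrt a)⁻¹ * ψ1 (s / a)) (y := y)
    (v := WithLp.toLp 2 (breveA A1 t (fun i => y i))) ((u0_contDiff hs ha).differentiable (by norm_num) y) (by
      simp [PiLp.inner_apply, breveA, Fin.sum_univ_three]; ring)
  change fderiv ℝ (u0 ψ1 a) y _ = 0 at h2
  rw [h2] at h
  exact h.symm

/-- Everything we need to know about wave-corpuscles. -/
lemma wc_main
    {χ m q c : ℝ} (hχ : 0 < χ) (hm : 0 < m) (hc : 0 < c)
    {G1' : ℝ → ℝ} {ψ1 : ℝ → ℝ}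
    (hψ1smooth : ContDiff ℝ 2 fun x : V3 => ψ1 ‖x‖)
    (hsteady : ∀ x : V3, lap3 (fun x' => ψ1 ‖x'‖) x = G1' ((ψ1 ‖x‖) ^ 2) * ψ1 ‖x‖)
    {r : ℝ → V3} (hr : ContDiff ℝ 2 r)
    {φ0 : ℝ → ℝ} {φ1 : ℝ → Fin 3 → ℝ} {A0 : ℝ → Fin 3 → ℝ}
    {A1 : ℝ → Fin 3 → Fin 3 → ℝ} {P3 : ℝ → V3 → ℝ}
    (hφ0 : ContDiff ℝ 2 φ0) (hφ1 : ContDiff ℝ 2 φ1)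
    (hA0 : ContDiff ℝ 2 A0) (hA1 : ContDiff ℝ 3 A1)
    (hP3hom : ∀ t : ℝ, ∀ ζ > (0 : ℝ), ∀ y : V3, P3 t (ζ • y) = ζ ^ 3 * P3 t y)
    (hP : ContDiff ℝ 4 (Pj P3))
    (hNewton : ∀ t : ℝ, ∀ j : Fin 3,
      m * deriv (deriv r) t j
        = q * ED c (phiWC m q c r φ0 φ1 A1 P3) (AWC r A0 A1 P3) (t, r t) j
          + (q / c) * cross3 (fun i => deriv r t i)
              (BD (AWC r A0 A1 P3) (t, r t)) j) :
    ∃ (σ : ℝ × V3 → ℝ) (K : Fin 3 → ℝ × V3 → ℝ), ContDiff ℝ 2 σ ∧ (∀ i, Continuous (K i)) ∧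
      (∀ i p, pxD i σ p - q / (χ * c) * AWC r A0 A1 P3 p i = K i p) ∧
      (∀ p, ptD σ p + q / χ * phiWC m q c r φ0 φ1 A1 P3 p = -(χ / (2 * m)) * ∑ i, (K i p) ^ 2) ∧
      (∀ a : ℝ, psiWC χ m q c r φ0 A0 A1 P3 (fun s => (a * Real.sqrt a)⁻¹ * ψ1 (s / a)) = polar σ (uT ψ1 r a)) ∧
      (∀ a : ℝ, 0 < a → ∀ p, SatisfiesNLS χ m q c a G1' (phiWC m q c r φ0 φ1 A1 P3) (AWC r A0 A1 P3)
        (polar σ (uT ψ1 r a)) p) := by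
  have hN := newton_explicit hr hφ0 hφ1 hA0 hA1 hP hP3hom hNewton
  have hr' := r_contDiff3 hm hr hφ1 hA0 hA1 hN
  have hrd : Differentiable ℝ r := hr.differentiable (by norm_num)
  have hSE := SE_contDiff (χ := χ) (m := m) (q := q) (c := c) hr' hφ0 hA0 hA1 hP
  have hSEd := hSE.differentiable (by norm_num)
  have hKE := fun i => KE_contDiff (χ := χ) (m := m) (q := q) (c := c) hr' hA1 i
  have hKEd := fun i => (hKE i).differentiable (by norm_num)
  have hσ : ContDiff ℝ 2 (fun p => SE χ m q c r φ0 A0 A1 P3 (PhiM r p)) := phi_comp_contDiff hr hSE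
  have hKc := fun i => phi_comp_contDiff hr (hKE i)
  have hK : ∀ i p, pxD i (fun p => SE χ m q c r φ0 A0 A1 P3 (PhiM r p)) p - q / (χ * c) * AWC r A0 A1 P3 p i
      = KE χ m q c r A1 i (PhiM r p) := by
    intro i p
    rw [pxD_comp_PhiM (hrd _) (hSEd _), AWC_eq hP]
    exact KE_eq hr' hφ0 hA0 hA1 hP i (PhiM r p)
  have hT : ∀ p, ptD (fun p => SE χ m q c r φ0 A0 A1 P3 (PhiM r p)) p + q / χ * phiWC m q c r φ0 φ1 A1 P3 p
      = -(χ / (2 * m)) * ∑ i, (KE χ m q c r A1 i (PhiM r p)) ^ 2 := by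
    intro p
    rw [ptD_comp_PhiM (hrd _) (hSEd _), phiWC_eq hA1 hP]
    exact phase_t hχ hm hc hr' hφ0 hA0 hA1 hP hN (PhiM r p)
  refine ⟨fun p => SE χ m q c r φ0 A0 A1 P3 (PhiM r p), fun i p => KE χ m q c r A1 i (PhiM r p), hσ,
    fun i => (hKc i).continuous, hK, hT, ?_, ?_⟩
  · intro a
    ext p
    unfold psiWC polar
    rw [SWC_eq hP hP3hom]
    rfl
  · intro a ha p
    refine NLS_of hm hχ (hσ.differentiable (by norm_num)) (uT_contDiff hψ1smooth ha hr)
      (fun i => (hKc i).differentiable (by norm_num)) hK ?_ p ?_ ?_ (hT p)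
    · intro i p
      rw [pxD_comp_PhiM (hrd _) (hKEd i _)]
      exact pxD_KE hr' hA1 i _
    · simp only [pxD2_uT hψ1smooth ha hr]
      exact u0_lap hψ1smooth ha hsteady _
    · rw [ptD_uT hψ1smooth ha hr]
      simp only [pxD_uT hψ1smooth ha hr]
      have h := u0_orth hψ1smooth ha A1 p.1 (p.2 - r p.1)
      have e : ∀ i, KE χ m q c r A1 i (PhiM r p) * pxS i (u0 ψ1 a) (p.2 - r p.1)
          = (m / χ) * (deriv r p.1 i * pxS i (u0 ψ1 a) (p.2 - r p.1))
            - (q / (χ * c)) * (breveA A1 p.1 (fun i => (p.2 - r p.1) i) i * pxS i (u0 ψ1 a) (p.2 - r p.1)) := by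
        intro i; unfold KE PhiM; ring
      simp only [e]
      rw [Finset.sum_sub_distrib, ← Finset.mul_sum, ← Finset.mul_sum, h]
      field_simp
      ring


lemma conv_core {F : Type} [NormedAddCommGroup F] [NormedSpace ℝ F] {r : ℝ → V3} (hr : Continuous r) {R : ℕ → ℝ}
    (hR0 : Tendsto R atTop (nhds 0)) (Tm Tp : ℝ) {L E : ℝ × V3 → F} (hL : ContDiff ℝ 1 L) (hE : ContDiff ℝ 1 E)
    (h0 : ∀ t, E (t, r t) = 0) (h1 : ∀ t, fderiv ℝ E (t, r t) = 0) :
    ∀ ε > (0 : ℝ), ∃ N, ∀ n ≥ N, ∀ p ∈ Tube Tm Tp r (R n),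
      ‖(L p + E p) - L p‖ + ‖ptD (fun p => L p + E p) p - ptD L p‖
        + (∑ i, ‖pxD i (fun p => L p + E p) p - pxD i L p‖) < ε := by
  intro ε hε
  have hc : Continuous (fun p => ‖E p‖ + ‖ptD E p‖ + ∑ i, ‖pxD i E p‖) := by
    have h2 : Continuous (ptD E) := (ptD_contDiff (k := 0) hE (by norm_num)).continuous
    have h3 := fun i => (pxD_contDiff (k := 0) hE (by norm_num) i).continuous
    exact (hE.continuous.norm.add h2.norm).add (continuous_finsetSum _ fun i _ => (h3 i).norm)
  obtain ⟨N, hN⟩ := tube_small (Tm := Tm) (Tp := Tp) hr hR0 hc (fun t => by simp [h0, h1, ptD, pxD]) hε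
  refine ⟨N, fun n hn p hp => ?_⟩
  have e : fderiv ℝ (fun p => L p + E p) p = fderiv ℝ L p + fderiv ℝ E p :=
    fderiv_fun_add (hL.differentiable (by norm_num) p) (hE.differentiable (by norm_num) p)
  have := hN n hn p hp
  unfold ptD pxD at *
  rw [e]
  simpa using this

lemma bound_core {F : Type} [NormedAddCommGroup F] [NormedSpace ℝ F] {r : ℝ → V3} (hr : Continuous r) {R : ℕ → ℝ}
    (hR0 : Tendsto R atTop (nhds 0)) (Tm Tp : ℝ) {L : ℝ × V3 → F} (hL : ContDiff ℝ 1 L) :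
    ∃ C, ∀ n, ∀ p ∈ Tube Tm Tp r (R n), ‖L p‖ ≤ C ∧ ‖ptD L p‖ ≤ C ∧ ∀ i, ‖pxD i L p‖ ≤ C := by
  have h2 : Continuous (ptD L) := (ptD_contDiff (k := 0) hL (by norm_num)).continuous
  have h3 := fun i => (pxD_contDiff (k := 0) hL (by norm_num) i).continuous
  have hc : Continuous (fun p => ‖L p‖ + ‖ptD L p‖ + ∑ i, ‖pxD i L p‖) :=
    (hL.continuous.norm.add h2.norm).add (continuous_finsetSum _ fun i _ => (h3 i).norm)
  obtain ⟨C, -, hC⟩ := tube_bdd (Tm := Tm) (Tp := Tp) hr hR0 hc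
  refine ⟨C, fun n p hp => ?_⟩
  have h := (le_abs_self _).trans (hC n p hp)
  have hs : ∀ i, ‖pxD i L p‖ ≤ ∑ i, ‖pxD i L p‖ := fun i =>
    Finset.single_le_sum (f := fun i => ‖pxD i L p‖) (fun _ _ => norm_nonneg _) (Finset.mem_univ i)
  have h0 : 0 ≤ ∑ i, ‖pxD i L p‖ := Finset.sum_nonneg fun _ _ => norm_nonneg _
  have ha := norm_nonneg (L p)
  have hb := norm_nonneg (ptD L p)
  refine ⟨by linarith, by linarith, fun i => ?_⟩
  have := hs i
  linarith

lemma icc_bdd {F : Type*} [NormedAddCommGroup F] {f : ℝ → F} (hf : Continuous f) (Tm Tp : ℝ) :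
    ∃ C, 0 ≤ C ∧ ∀ t ∈ Set.Icc Tm Tp, ‖f t‖ ≤ C := by
  obtain ⟨C, hC⟩ := isCompact_Icc.exists_bound_of_continuousOn hf.continuousOn
  exact ⟨max C 0, le_max_right _ _, fun t ht => (hC t ht).trans (le_max_left _ _)⟩

lemma icc_bdd_C1 {F : Type*} [NormedAddCommGroup F] [NormedSpace ℝ F] {f : ℝ → F} (hf : ContDiff ℝ 1 f) (Tm Tp : ℝ) :
    ∃ C, 0 ≤ C ∧ ∀ t ∈ Set.Icc Tm Tp, ‖f t‖ ≤ C ∧ ‖deriv f t‖ ≤ C := by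
  obtain ⟨C, h0, hC⟩ := icc_bdd hf.continuous Tm Tp
  obtain ⟨C', h0', hC'⟩ := icc_bdd (hf.continuous_deriv (by norm_num)) Tm Tp
  exact ⟨max C C', h0.trans (le_max_left _ _), fun t ht => ⟨(hC t ht).trans (le_max_left _ _), (hC' t ht).trans (le_max_right _ _)⟩⟩

section
variable {m q c : ℝ} {r : ℝ → V3} {φ0 : ℝ → ℝ} {φ1 : ℝ → Fin 3 → ℝ} {A0 : ℝ → Fin 3 → ℝ}
    {A1 : ℝ → Fin 3 → Fin 3 → ℝ} {P3 : ℝ → V3 → ℝ}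

lemma phi2E_core (hr : ContDiff ℝ 2 r) (hA1 : ContDiff ℝ 3 A1) (hP : ContDiff ℝ 4 (Pj P3))
    (hP3hom : ∀ t : ℝ, ∀ ζ > (0 : ℝ), ∀ y : V3, P3 t (ζ • y) = ζ ^ 3 * P3 t y) (t : ℝ) :
    phi2E m q c r A1 P3 (PhiM r (t, r t)) = 0 := by
  have := (phi2E_zero (m := m) (q := q) (c := c) (deriv_contDiff1 hr) hA1 hP hP3hom t).1
  simpa [PhiM] using this

lemma gP_core (hP : ContDiff ℝ 4 (Pj P3))
    (hP3hom : ∀ t : ℝ, ∀ ζ > (0 : ℝ), ∀ y : V3, P3 t (ζ • y) = ζ ^ 3 * P3 t y) (t : ℝ) :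
    gP P3 (PhiM r (t, r t)) = 0 := by
  have h : gP P3 (t, 0) = 0 := (gradP_zero hP hP3hom t).1
  simpa [PhiM] using h

lemma phiinf_eq (hr : ContDiff ℝ 2 r) (hφ0 : ContDiff ℝ 2 φ0) (hφ1 : ContDiff ℝ 2 φ1)
    (hA1 : ContDiff ℝ 3 A1) (hP : ContDiff ℝ 4 (Pj P3))
    (hP3hom : ∀ t : ℝ, ∀ ζ > (0 : ℝ), ∀ y : V3, P3 t (ζ • y) = ζ ^ 3 * P3 t y) :
    (fun p : ℝ × V3 => phiWC m q c r φ0 φ1 A1 P3 (p.1, r p.1)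
          + ∑ i, (p.2 i - r p.1 i) * pxD i (phiWC m q c r φ0 φ1 A1 P3) (p.1, r p.1))
      = fun p => phiL φ0 φ1 (PhiM r p) := by
  ext p
  simp only [pxD_phi_core hr hφ0 hφ1 hA1 hP hP3hom]
  rw [phiWC_eq hA1 hP]
  simp only
  rw [phi2E_core hr hA1 hP hP3hom]
  simp [phiL, PhiM, dot3]

lemma Ainf_eq (hr : ContDiff ℝ 2 r) (hA0 : ContDiff ℝ 2 A0)
    (hA1 : ContDiff ℝ 3 A1) (hP : ContDiff ℝ 4 (Pj P3))
    (hP3hom : ∀ t : ℝ, ∀ ζ > (0 : ℝ), ∀ y : V3, P3 t (ζ • y) = ζ ^ 3 * P3 t y) :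
    (fun (p : ℝ × V3) j => AWC r A0 A1 P3 (p.1, r p.1) j
          + ∑ i, (p.2 i - r p.1 i) * pxD i (AWC r A0 A1 P3) (p.1, r p.1) j)
      = fun p => AL A0 A1 (PhiM r p) := by
  ext p j
  simp only [pxD_A_core hr hA0 hA1 hP hP3hom]
  rw [AWC_eq hP]
  simp only
  rw [gP_core hP hP3hom]
  simp [AL, PhiM, matVec, mul_comm]

end


section
variable {ψ1 : ℝ → ℝ} {r : ℝ → V3}

lemma mass_eq {a : ℝ} (ha : 0 < a) (R t : ℝ) :
    ∫ x in closedBall (r t) R, (uT ψ1 r a (t, x)) ^ 2 = ∫ z in closedBall (0 : V3) (R / a), (ψ1 ‖z‖) ^ 2 := by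
  rw [← integral_indicator measurableSet_closedBall, ← integral_indicator measurableSet_closedBall]
  have e : ∀ x : V3, (closedBall (r t) R).indicator (fun x => (uT ψ1 r a (t, x)) ^ 2) x
      = (a ^ 3)⁻¹ * (fun y : V3 => (closedBall (0 : V3) (R / a)).indicator (fun z => (ψ1 ‖z‖) ^ 2) (a⁻¹ • y)) (x - r t) := by
    intro x
    have hn : ‖a⁻¹ • (x - r t)‖ = ‖x - r t‖ / a := by
      rw [norm_smul, norm_inv, Real.norm_eq_abs, abs_of_pos ha, div_eq_inv_mul]
    by_cases h : x ∈ closedBall (r t) R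
    · have h' : a⁻¹ • (x - r t) ∈ closedBall (0 : V3) (R / a) := by
        rw [mem_closedBall_zero_iff, hn]
        rw [mem_closedBall, dist_eq_norm] at h
        gcongr
      beta_reduce
      rw [Set.indicator_of_mem h, Set.indicator_of_mem h', hn]
      exact u0_sq ha _
    · have h' : a⁻¹ • (x - r t) ∉ closedBall (0 : V3) (R / a) := by
        rw [mem_closedBall_zero_iff, hn]
        rw [mem_closedBall, dist_eq_norm] at h
        intro h2
        exact h ((div_le_div_iff_of_pos_right ha).1 h2)
      beta_reduce
      rw [Set.indicator_of_notMem h, Set.indicator_of_notMem h', mul_zero]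
  simp only [e]
  rw [integral_const_mul, integral_sub_right_eq_self
    (fun y : V3 => (closedBall (0 : V3) (R / a)).indicator (fun z => (ψ1 ‖z‖) ^ 2) (a⁻¹ • y)) (r t),
    Measure.integral_comp_inv_smul]
  simp only [finrank_euclideanSpace, Fintype.card_fin, smul_eq_mul]
  rw [abs_of_pos (by positivity), inv_mul_cancel_left₀ (by positivity)]

lemma W_pos (hψ1pos : ∀ s : ℝ, 0 ≤ s → 0 < ψ1 s) (hψ1int : Integrable fun x : V3 => (ψ1 ‖x‖) ^ 2) :
    0 < ∫ x : V3, (ψ1 ‖x‖) ^ 2 := by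
  rw [integral_pos_iff_support_of_nonneg (fun x => sq_nonneg _) hψ1int]
  have : Function.support (fun x : V3 => (ψ1 ‖x‖) ^ 2) = Set.univ := by
    ext x; simpa using (hψ1pos _ (norm_nonneg x)).ne'
  rw [this]
  exact isOpen_univ.measure_pos volume Set.univ_nonempty

lemma mass_le (hψ1int : Integrable fun x : V3 => (ψ1 ‖x‖) ^ 2) {a : ℝ} (ha : 0 < a) (R t : ℝ) :
    ∫ x in closedBall (r t) R, (uT ψ1 r a (t, x)) ^ 2 ≤ ∫ x : V3, (ψ1 ‖x‖) ^ 2 := by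
  rw [mass_eq ha]
  exact setIntegral_le_integral hψ1int (Eventually.of_forall fun x => sq_nonneg _)

lemma mass_tendsto (hψ1int : Integrable fun x : V3 => (ψ1 ‖x‖) ^ 2) {ℓ : ℕ → ℝ} (hℓ : Tendsto ℓ atTop atTop) :
    Tendsto (fun n => ∫ z in closedBall (0 : V3) (ℓ n), (ψ1 ‖z‖) ^ 2) atTop (nhds (∫ x : V3, (ψ1 ‖x‖) ^ 2)) :=
  (aecover_closedBall (μ := volume) hℓ).integral_tendsto_of_countably_generated hψ1int

lemma uT_cont {a : ℝ} (hs : ContDiff ℝ 2 fun x : V3 => ψ1 ‖x‖) (ha : 0 < a) (t : ℝ) :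
    Continuous fun x => uT ψ1 r a (t, x) := by
  exact (u0_contDiff hs ha).continuous.comp ((continuous_id (X := V3)).sub (continuous_const (y := r t)))

lemma u_sphere {C a R : ℝ} (hd : ∀ θ : ℝ, 1 ≤ θ → θ ^ 2 * |ψ1 θ| ≤ C ∧ θ ^ 3 * |deriv ψ1 θ| ≤ C)
    (ha : 0 < a) (haR : a ≤ R) {t : ℝ} {x : V3} (hx : x ∈ sphere (r t) R) :
    (uT ψ1 r a (t, x)) ^ 2 ≤ C ^ 2 * (a / R ^ 4) := by
  have hR : 0 < R := ha.trans_le haR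
  have hn : ‖x - r t‖ = R := by rwa [mem_sphere, dist_eq_norm] at hx
  unfold uT
  rw [u0_sq ha]
  simp only [hn]
  have h := (hd (R / a) ((one_le_div ha).2 haR)).1
  have h2 : (R / a) ^ 4 * (ψ1 (R / a)) ^ 2 ≤ C ^ 2 := by
    calc (R / a) ^ 4 * (ψ1 (R / a)) ^ 2 = ((R / a) ^ 2 * |ψ1 (R / a)|) ^ 2 := by rw [mul_pow, sq_abs]; ring
      _ ≤ C ^ 2 := by gcongr
  calc (a ^ 3)⁻¹ * (ψ1 (R / a)) ^ 2 = ((R / a) ^ 4 * (ψ1 (R / a)) ^ 2) * (a / R ^ 4) := by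
        field_simp
    _ ≤ _ := by gcongr

lemma du_sphere {C a R : ℝ} (h1 : ContDiff ℝ 2 ψ1) (hs : ContDiff ℝ 2 fun x : V3 => ψ1 ‖x‖)
    (hr : ContDiff ℝ 2 r)
    (hd : ∀ θ : ℝ, 1 ≤ θ → θ ^ 2 * |ψ1 θ| ≤ C ∧ θ ^ 3 * |deriv ψ1 θ| ≤ C)
    (ha : 0 < a) (haR : a ≤ R) {t : ℝ} {x : V3} (hx : x ∈ sphere (r t) R) (i : Fin 3) :
    (pxD i (uT ψ1 r a) (t, x)) ^ 2 ≤ C ^ 2 * (a / R ^ 6) := by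
  have hR : 0 < R := ha.trans_le haR
  have hn : ‖x - r t‖ = R := by rwa [mem_sphere, dist_eq_norm] at hx
  rw [pxD_uT hs ha hr]
  simp only
  have hb := u0_grad_bound h1 ha (y := x - r t) (by rw [← norm_pos_iff, hn]; exact hR) i
  rw [hn] at hb
  have h := (hd (R / a) ((one_le_div ha).2 haR)).2
  have h2 : (R / a) ^ 6 * (deriv ψ1 (R / a)) ^ 2 ≤ C ^ 2 := by
    calc (R / a) ^ 6 * (deriv ψ1 (R / a)) ^ 2 = ((R / a) ^ 3 * |deriv ψ1 (R / a)|) ^ 2 := by rw [mul_pow, sq_abs]; ring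
      _ ≤ C ^ 2 := by gcongr
  calc (pxS i (u0 ψ1 a) (x - r t)) ^ 2 = |pxS i (u0 ψ1 a) (x - r t)| ^ 2 := (sq_abs _).symm
    _ ≤ ((a * Real.sqrt a)⁻¹ * a⁻¹ * |deriv ψ1 (R / a)|) ^ 2 := by gcongr
    _ = (a ^ 3)⁻¹ * (a⁻¹) ^ 2 * (deriv ψ1 (R / a)) ^ 2 := by rw [mul_pow, mul_pow, kappa_sq ha, sq_abs]
    _ = ((R / a) ^ 6 * (deriv ψ1 (R / a)) ^ 2) * (a / R ^ 6) := by field_simp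
    _ ≤ _ := by gcongr

lemma rbar_eq {q : ℝ} {a R : ℕ → ℝ} {σ : ℝ × V3 → ℝ} (n : ℕ) (t : ℝ) :
    rbar q r R (fun n => polar σ (uT ψ1 r (a n))) n t = q * ∫ x in closedBall (r t) (R n), (uT ψ1 r (a n) (t, x)) ^ 2 := by
  unfold rbar
  simp only [rhoD_polar]
  rw [integral_const_mul]

lemma rcen_dist {q : ℝ} {a R : ℕ → ℝ} {σ : ℝ × V3 → ℝ} (hq : 0 < q) (hs : ContDiff ℝ 2 fun x : V3 => ψ1 ‖x‖)
    (n : ℕ) (ha : 0 < a n) (t : ℝ)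
    (hpos : 0 < rbar q r R (fun n => polar σ (uT ψ1 r (a n))) n t) :
    ‖rcen q r R (fun n => polar σ (uT ψ1 r (a n))) n t - r t‖ ≤ R n := by
  have hc := uT_cont (r := r) hs ha t
  have hρ : Continuous fun x : V3 => rhoD q (polar σ (uT ψ1 r (a n))) (t, x) := by
    simp only [rhoD_polar]; exact continuous_const.mul (hc.pow 2)
  have hρ0 : ∀ x : V3, 0 ≤ rhoD q (polar σ (uT ψ1 r (a n))) (t, x) := by
    intro x; rw [rhoD_polar]; positivity
  have hi1 : IntegrableOn (fun x : V3 => rhoD q (polar σ (uT ψ1 r (a n))) (t, x)) (closedBall (r t) (R n)) :=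
    hρ.continuousOn.integrableOn_compact (isCompact_closedBall _ _)
  have hi2 : IntegrableOn (fun x : V3 => rhoD q (polar σ (uT ψ1 r (a n))) (t, x) • x) (closedBall (r t) (R n)) :=
    (hρ.smul continuous_id).continuousOn.integrableOn_compact (isCompact_closedBall _ _)
  set b := rbar q r R (fun n => polar σ (uT ψ1 r (a n))) n t with hb
  have e : rcen q r R (fun n => polar σ (uT ψ1 r (a n))) n t - r t
      = b⁻¹ • ∫ x in closedBall (r t) (R n), rhoD q (polar σ (uT ψ1 r (a n))) (t, x) • (x - r t) := by
    simp only [smul_sub]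
    rw [integral_sub hi2 (hi1.smul_const _), integral_smul_const]
    change _ = b⁻¹ • (_ - b • r t)
    rw [smul_sub, smul_smul, inv_mul_cancel₀ hpos.ne', one_smul]
    rfl
  rw [e, norm_smul, norm_inv, Real.norm_eq_abs, abs_of_pos hpos, inv_mul_le_iff₀ hpos]
  calc _ ≤ ∫ x in closedBall (r t) (R n), R n * rhoD q (polar σ (uT ψ1 r (a n))) (t, x) := by
        refine norm_integral_le_of_norm_le (hi1.const_mul _) ?_
        refine (ae_restrict_iff' measurableSet_closedBall).2 (Eventually.of_forall fun x hx => ?_)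
        rw [norm_smul, Real.norm_eq_abs, abs_of_nonneg (hρ0 x), mul_comm]
        rw [mem_closedBall, dist_eq_norm] at hx
        exact mul_le_mul_of_nonneg_right hx (hρ0 x)
    _ = b * R n := by rw [integral_const_mul, mul_comm]; rfl

end


lemma unif_of_bound {F : Type*} [NormedAddCommGroup F] {f : ℕ → ℝ → F} {b : ℕ → ℝ} {s : Set ℝ}
    (hb : Tendsto b atTop (nhds 0)) (h : ∀ᶠ n in atTop, ∀ t ∈ s, ‖f n t‖ ≤ b n) :
    TendstoUniformlyOn f (fun _ => 0) atTop s := by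
  rw [Metric.tendstoUniformlyOn_iff]
  intro ε hε
  filter_upwards [h, hb.eventually_lt_const hε] with n h1 h2 t ht
  rw [dist_zero_left]
  exact (h1 t ht).trans_lt h2

lemma unif_time {F : Type*} [NormedAddCommGroup F] [NormedSpace ℝ F] {f : ℕ → ℝ → F} {b : ℕ → ℝ} {Tm Tp t₀ : ℝ}
    (ht₀ : t₀ ∈ Set.Icc Tm Tp)
    (hb : Tendsto b atTop (nhds 0)) (hb0 : ∀ n, 0 ≤ b n) (h : ∀ᶠ n in atTop, ∀ t ∈ Set.Icc Tm Tp, ‖f n t‖ ≤ b n) :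
    TendstoUniformlyOn (fun n t => ∫ t' in t₀..t, f n t') (fun _ => 0) atTop (Set.Icc Tm Tp) := by
  refine unif_of_bound (b := fun n => b n * (Tp - Tm)) (by simpa using hb.mul_const (Tp - Tm)) ?_
  filter_upwards [h] with n hn t ht
  refine (intervalIntegral.norm_integral_le_of_norm_le_const (C := b n) fun x hx => hn x ?_).trans ?_
  · have := Set.uIoc_subset_uIcc hx
    exact Set.uIcc_subset_Icc ht₀ ht this
  · refine mul_le_mul_of_nonneg_left ?_ (hb0 n)
    rw [abs_le]
    constructor <;> linarith [ht.1, ht.2, ht₀.1, ht₀.2]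

lemma sphere_bound : ∃ Cs : ℝ, 0 ≤ Cs ∧ ∀ (F : Type) [NormedAddCommGroup F] [NormedSpace ℝ F] (x : V3) (R : ℝ) (f : V3 → F) (b : ℝ),
    0 < R → (∀ y ∈ sphere x R, ‖f y‖ ≤ b) → ‖∫ y in sphere x R, f y ∂μH[2]‖ ≤ b * (Cs * R ^ 2) := by
  obtain ⟨Cs, h0, h⟩ := aux_sphere
  refine ⟨Cs, h0, fun F _ _ x R f b hR hf => ?_⟩
  rw [← (h x R hR).2]
  exact norm_setIntegral_le_of_norm_le_const (h x R hR).1 hf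

lemma sphere_bound_odd : ∃ Cs : ℝ, 0 ≤ Cs ∧ ∀ (x : V3) (R : ℝ) (f g : V3 → Fin 3 → ℝ) (b : ℝ),
    0 < R → Continuous g → (∀ y, g (x - y) = - g (x + y)) →
    (∀ y ∈ sphere x R, ‖f y‖ ≤ b) → ‖∫ y in sphere x R, (g y + f y) ∂μH[2]‖ ≤ b * (Cs * R ^ 2) := by
  obtain ⟨Cs, h0, hS⟩ := sphere_bound
  obtain ⟨Cs', h0', hS'⟩ := aux_sphere
  refine ⟨Cs, h0, fun x R f g b hR hg hodd hf => ?_⟩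
  have hb0 : 0 ≤ b := by
    have : (sphere x R).Nonempty := NormedSpace.sphere_nonempty.2 hR.le
    obtain ⟨y, hy⟩ := this
    exact (norm_nonneg _).trans (hf y hy)
  have hgi : IntegrableOn g (sphere x R) μH[2] := by
    obtain ⟨M, hM⟩ := (isCompact_sphere x R).exists_bound_of_continuousOn hg.continuousOn
    have : IsFiniteMeasure ((μH[2] : Measure V3).restrict (sphere x R)) := ⟨by
      rw [Measure.restrict_apply_univ]; exact (hS' x R hR).1⟩
    refine Integrable.of_bound (C := M) hg.aestronglyMeasurable ?_
    exact (ae_restrict_iff' isClosed_sphere.measurableSet).2 (Eventually.of_forall fun y hy => hM y hy)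
  by_cases hfi : IntegrableOn f (sphere x R) μH[2]
  · rw [integral_add hgi hfi, aux_sphere_odd x R g hodd, zero_add]
    exact hS _ x R f b hR hf
  · have : ¬ Integrable (fun y => g y + f y) ((μH[2] : Measure V3).restrict (sphere x R)) := by
      intro h
      apply hfi
      have := h.sub hgi
      refine this.congr (Eventually.of_forall fun y => ?_)
      simp
    rw [integral_undef this, norm_zero]
    positivity

/-- Data of a wave-corpuscle sequence, with uniform bounds. -/
structure WCData (χ m q c Tm Tp : ℝ) (ψ1 : ℝ → ℝ) (r : ℝ → V3) (a R : ℕ → ℝ) (φ : ℝ × V3 → ℝ)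
    (A : ℝ × V3 → Fin 3 → ℝ) (σ : ℝ × V3 → ℝ) (K : Fin 3 → ℝ × V3 → ℝ) (C V CK : ℝ) : Prop where
  hχ : 0 < χ
  hm : 0 < m
  hq : 0 < q
  hc : 0 < c
  hr : ContDiff ℝ 2 r
  h1 : ContDiff ℝ 2 ψ1
  hs : ContDiff ℝ 2 fun x : V3 => ψ1 ‖x‖
  hpos : ∀ s : ℝ, 0 ≤ s → 0 < ψ1 s
  hsqi : Integrable fun x : V3 => (ψ1 ‖x‖) ^ 2
  hd : ∀ θ : ℝ, 1 ≤ θ → θ ^ 2 * |ψ1 θ| ≤ C ∧ θ ^ 3 * |deriv ψ1 θ| ≤ C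
  ha : ∀ n, 0 < a n
  hR : ∀ n, 0 < R n
  hR0 : Tendsto R atTop (nhds 0)
  heps : Tendsto (fun n => a n / (R n) ^ 4) atTop (nhds 0)
  hratio : Tendsto (fun n => R n / a n) atTop atTop
  hσ : Differentiable ℝ σ
  hk : ∀ i p, pxD i σ p - q / (χ * c) * A p i = K i p
  ht : ∀ p, ptD σ p + q / χ * φ p = -(χ / (2 * m)) * ∑ i, (K i p) ^ 2
  hV0 : 0 ≤ V
  hV : ∀ t ∈ Set.Icc Tm Tp, ∀ i, |deriv r t i| ≤ V
  hC0 : 0 ≤ CK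
  hCK : ∀ n, ∀ p ∈ Tube Tm Tp r (R n), ∀ i, |K i p| ≤ CK

namespace WCData
variable {χ m q c Tm Tp : ℝ} {ψ1 : ℝ → ℝ} {r : ℝ → V3} {a R : ℕ → ℝ} {φ : ℝ × V3 → ℝ}
    {A : ℝ × V3 → Fin 3 → ℝ} {σ : ℝ × V3 → ℝ} {K : Fin 3 → ℝ × V3 → ℝ} {C V CK : ℝ}

lemma haR (W : WCData χ m q c Tm Tp ψ1 r a R φ A σ K C V CK) : ∀ᶠ n in atTop, a n ≤ R n := by
  filter_upwards [W.hratio.eventually_ge_atTop 1] with n hn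
  exact (one_le_div (W.ha n)).1 hn

lemma hu (W : WCData χ m q c Tm Tp ψ1 r a R φ A σ K C V CK) (n : ℕ) : Differentiable ℝ (uT ψ1 r (a n)) :=
  (uT_contDiff W.hs (W.ha n) W.hr).differentiable (by norm_num)

lemma PD_eq (W : WCData χ m q c Tm Tp ψ1 r a R φ A σ K C V CK) (n : ℕ) (p : ℝ × V3) (i : Fin 3) :
    PD χ q c A (polar σ (uT ψ1 r (a n))) p i = χ * K i p * (uT ψ1 r (a n) p) ^ 2 :=
  PD_polar (W.hσ p) (W.hu n) (W.hk i p)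

lemma JD_eq (W : WCData χ m q c Tm Tp ψ1 r a R φ A σ K C V CK) (n : ℕ) (p : ℝ × V3) (i : Fin 3) :
    JD χ m q c A (polar σ (uT ψ1 r (a n))) p i = (q * χ / m) * K i p * (uT ψ1 r (a n) p) ^ 2 :=
  JD_polar (W.hσ p) (W.hu n) (W.hk i p)

lemma PD_le (W : WCData χ m q c Tm Tp ψ1 r a R φ A σ K C V CK) (n : ℕ) {p : ℝ × V3} (hp : p ∈ Tube Tm Tp r (R n)) :
    ‖PD χ q c A (polar σ (uT ψ1 r (a n))) p‖ ≤ χ * CK * (uT ψ1 r (a n) p) ^ 2 := by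
  have h0 := W.hC0
  have h1 := W.hχ
  rw [pi_norm_le_iff_of_nonneg (by positivity)]
  intro i
  rw [W.PD_eq, Real.norm_eq_abs, abs_mul, abs_mul, abs_of_pos h1, abs_of_nonneg (sq_nonneg (uT ψ1 r (a n) p))]
  have := W.hCK n p hp i
  gcongr

lemma JD_le (W : WCData χ m q c Tm Tp ψ1 r a R φ A σ K C V CK) (n : ℕ) {p : ℝ × V3} (hp : p ∈ Tube Tm Tp r (R n)) (i : Fin 3) :
    |JD χ m q c A (polar σ (uT ψ1 r (a n))) p i| ≤ (q * χ / m) * CK * (uT ψ1 r (a n) p) ^ 2 := by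
  have h0 := W.hC0
  have h1 := W.hχ
  have h2 := W.hq
  have h3 := W.hm
  rw [W.JD_eq, abs_mul, abs_mul, abs_of_pos (by positivity : 0 < q * χ / m), abs_of_nonneg (sq_nonneg (uT ψ1 r (a n) p))]
  have := W.hCK n p hp i
  gcongr

lemma mem_tube_sphere {n : ℕ} {t : ℝ} (ht : t ∈ Set.Icc Tm Tp) {x : V3} (hx : x ∈ sphere (r t) (R n)) :
    (t, x) ∈ Tube Tm Tp r (R n) := ⟨ht, by rw [mem_sphere, dist_eq_norm] at hx; exact hx.le⟩

lemma mem_tube_ball {n : ℕ} {t : ℝ} (ht : t ∈ Set.Icc Tm Tp) {x : V3} (hx : x ∈ closedBall (r t) (R n)) :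
    (t, x) ∈ Tube Tm Tp r (R n) := ⟨ht, by rw [mem_closedBall, dist_eq_norm] at hx; exact hx⟩

lemma coord_le (v : V3) (i : Fin 3) : |v i| ≤ ‖v‖ := by
  have := PiLp.norm_apply_le v i
  simpa using this

lemma nrm_le {x y : V3} {ρ : ℝ} (hρ : 0 < ρ) (hy : y ∈ sphere x ρ) (i : Fin 3) : |nrm x ρ y i| ≤ 1 := by
  unfold nrm
  rw [mem_sphere, dist_eq_norm] at hy
  rw [abs_div, abs_of_pos hρ, div_le_one hρ]
  have := coord_le (y - x) i
  rw [hy] at this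
  simpa using this

lemma dot3_le {v w : Fin 3 → ℝ} {a b : ℝ} (hv : ∀ i, |v i| ≤ a) (hw : ∀ i, |w i| ≤ b) : |dot3 v w| ≤ 3 * (a * b) := by
  have ha : 0 ≤ a := (abs_nonneg _).trans (hv 0)
  unfold dot3
  refine (Finset.abs_sum_le_sum_abs _ _).trans ?_
  calc ∑ i, |v i * w i| ≤ ∑ i : Fin 3, a * b := by
        refine Finset.sum_le_sum fun i _ => ?_
        rw [abs_mul]
        exact mul_le_mul (hv i) (hw i) (abs_nonneg _) ha
    _ = 3 * (a * b) := by simp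

lemma Q01 (W : WCData χ m q c Tm Tp ψ1 r a R φ A σ K C V CK) {t₀ : ℝ} (ht₀ : t₀ ∈ Set.Icc Tm Tp) :
    TendstoUniformlyOn
    (fun n t => ∫ t' in t₀..t, ∫ x in sphere (r t') (R n),
      dot3 (fun i => deriv r t' i) (nrm (r t') (R n) x) •
        PD χ q c A (polar σ (uT ψ1 r (a n))) (t', x) ∂μH[2])
    (fun _ => 0) atTop (Set.Icc Tm Tp) := by
  obtain ⟨Cs, hCs, hS⟩ := sphere_bound
  have hV0 := W.hV0
  have hC0 := W.hC0
  have hχ := W.hχ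
  refine unif_time ht₀ (b := fun n => (3 * (V * 1) * (χ * CK * (C ^ 2 * (a n / R n ^ 4)))) * (Cs * R n ^ 2)) ?_ ?_ ?_
  · have := (((W.heps.const_mul (C ^ 2)).const_mul (χ * CK)).const_mul (3 * (V * 1))).mul ((W.hR0.pow 2).const_mul Cs)
    simpa using this
  · intro n
    have := W.ha n
    have := W.hR n
    positivity
  · filter_upwards [W.haR] with n hn t ht
    refine hS _ _ _ _ _ (W.hR n) fun x hx => ?_
    rw [norm_smul]
    refine mul_le_mul (dot3_le (W.hV t ht) (nrm_le (W.hR n) hx)) ?_ (norm_nonneg _) (by positivity)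
    refine (W.PD_le n (mem_tube_sphere ht hx)).trans ?_
    have := u_sphere W.hd (W.ha n) hn hx
    gcongr

lemma xcen_le (W : WCData χ m q c Tm Tp ψ1 r a R φ A σ K C V CK) {n : ℕ} {t : ℝ}
    (hpos : 0 < rbar q r R (fun n => polar σ (uT ψ1 r (a n))) n t) {x : V3} (hx : x ∈ sphere (r t) (R n)) :
    ‖(fun i => x i - rcen q r R (fun n => polar σ (uT ψ1 r (a n))) n t i : Fin 3 → ℝ)‖ ≤ 2 * R n := by
  have hR := W.hR n
  have h1 := rcen_dist W.hq W.hs n (W.ha n) t hpos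
  rw [mem_sphere, dist_eq_norm] at hx
  rw [pi_norm_le_iff_of_nonneg (by positivity)]
  intro i
  have h2 := coord_le (x - rcen q r R (fun n => polar σ (uT ψ1 r (a n))) n t) i
  have h3 : ‖x - rcen q r R (fun n => polar σ (uT ψ1 r (a n))) n t‖ ≤ 2 * R n := by
    have e : x - rcen q r R (fun n => polar σ (uT ψ1 r (a n))) n t
        = (x - r t) - (rcen q r R (fun n => polar σ (uT ψ1 r (a n))) n t - r t) := by abel
    rw [e]
    refine (norm_sub_le _ _).trans ?_
    linarith
  exact (by simpa using h2 : |_| ≤ _).trans h3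

lemma rbar_tendsto (W : WCData χ m q c Tm Tp ψ1 r a R φ A σ K C V CK) (t : ℝ) :
    Tendsto (fun n => rbar q r R (fun n => polar σ (uT ψ1 r (a n))) n t) atTop (nhds (q * ∫ x : V3, (ψ1 ‖x‖) ^ 2)) := by
  simp only [rbar_eq, mass_eq (W.ha _)]
  exact (mass_tendsto W.hsqi W.hratio).const_mul q

lemma rbar_low (W : WCData χ m q c Tm Tp ψ1 r a R φ A σ K C V CK) :
    ∀ᶠ n in atTop, ∀ t, (q * ∫ x : V3, (ψ1 ‖x‖) ^ 2) / 2 ≤ rbar q r R (fun n => polar σ (uT ψ1 r (a n))) n t := by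
  have hp := mul_pos W.hq (W_pos W.hpos W.hsqi)
  filter_upwards [(W.rbar_tendsto 0).eventually_const_le (half_lt_self hp)] with n hn t
  rw [rbar_eq, mass_eq (W.ha n)] at hn ⊢
  exact hn

lemma rbar_up (W : WCData χ m q c Tm Tp ψ1 r a R φ A σ K C V CK) (n : ℕ) (t : ℝ) :
    rbar q r R (fun n => polar σ (uT ψ1 r (a n))) n t ≤ q * ∫ x : V3, (ψ1 ‖x‖) ^ 2 := by
  rw [rbar_eq]
  exact mul_le_mul_of_nonneg_left (mass_le W.hsqi (W.ha n) _ _) W.hq.le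

lemma rbar_pos (W : WCData χ m q c Tm Tp ψ1 r a R φ A σ K C V CK) :
    ∀ᶠ n in atTop, ∀ t, 0 < rbar q r R (fun n => polar σ (uT ψ1 r (a n))) n t := by
  have hp := mul_pos W.hq (W_pos W.hpos W.hsqi)
  filter_upwards [W.rbar_low] with n hn t
  linarith [hn t]

lemma rho_sphere (W : WCData χ m q c Tm Tp ψ1 r a R φ A σ K C V CK) {n : ℕ} (hn : a n ≤ R n) {t : ℝ} {x : V3}
    (hx : x ∈ sphere (r t) (R n)) : |rhoD q (polar σ (uT ψ1 r (a n))) (t, x)| ≤ q * (C ^ 2 * (a n / R n ^ 4)) := by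
  have hq := W.hq
  rw [rhoD_polar, abs_of_nonneg (by positivity)]
  have := u_sphere W.hd (W.ha n) hn hx
  gcongr

lemma JD_sphere (W : WCData χ m q c Tm Tp ψ1 r a R φ A σ K C V CK) {n : ℕ} (hn : a n ≤ R n) {t : ℝ} (ht : t ∈ Set.Icc Tm Tp) {x : V3}
    (hx : x ∈ sphere (r t) (R n)) (i : Fin 3) :
    |JD χ m q c A (polar σ (uT ψ1 r (a n))) (t, x) i| ≤ (q * χ / m) * CK * (C ^ 2 * (a n / R n ^ 4)) := by
  have h0 := W.hC0
  have h1 := W.hχ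
  have h2 := W.hq
  have h3 := W.hm
  refine (W.JD_le n (mem_tube_sphere ht hx) i).trans ?_
  have := u_sphere W.hd (W.ha n) hn hx
  gcongr

lemma Q20 (W : WCData χ m q c Tm Tp ψ1 r a R φ A σ K C V CK) :
    TendstoUniformlyOn
    (fun n t => ∫ x in sphere (r t) (R n),
      (dot3 (fun i => deriv r t i) (nrm (r t) (R n) x) * rhoD q (polar σ (uT ψ1 r (a n))) (t, x)) •
        (fun i => x i - rcen q r R (fun n => polar σ (uT ψ1 r (a n))) n t i) ∂μH[2])
    (fun _ => 0) atTop (Set.Icc Tm Tp) := by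
  obtain ⟨Cs, hCs, hS⟩ := sphere_bound
  have hV0 := W.hV0
  have hq := W.hq
  refine unif_of_bound (b := fun n => (3 * (V * 1) * (q * (C ^ 2 * (a n / R n ^ 4))) * (2 * R n)) * (Cs * R n ^ 2)) ?_ ?_
  · have := (((((W.heps.const_mul (C ^ 2)).const_mul q).const_mul (3 * (V * 1))).mul (W.hR0.const_mul 2))).mul ((W.hR0.pow 2).const_mul Cs)
    simpa using this
  · filter_upwards [W.haR, W.rbar_pos] with n hn hp t ht
    have h1 := W.ha n
    have h2 := W.hR n
    refine hS _ _ _ _ _ (W.hR n) fun x hx => ?_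
    rw [norm_smul, norm_mul]
    refine mul_le_mul ?_ (W.xcen_le (hp t) hx) (norm_nonneg _) (by positivity)
    exact mul_le_mul (dot3_le (W.hV t ht) (nrm_le (W.hR n) hx)) (W.rho_sphere hn hx) (norm_nonneg _) (by positivity)

lemma Q22 (W : WCData χ m q c Tm Tp ψ1 r a R φ A σ K C V CK) :
    TendstoUniformlyOn
    (fun n t => ∫ x in sphere (r t) (R n),
      dot3 (nrm (r t) (R n) x) (JD χ m q c A (polar σ (uT ψ1 r (a n))) (t, x)) •
        (fun i => x i - rcen q r R (fun n => polar σ (uT ψ1 r (a n))) n t i) ∂μH[2])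
    (fun _ => 0) atTop (Set.Icc Tm Tp) := by
  obtain ⟨Cs, hCs, hS⟩ := sphere_bound
  have hC0 := W.hC0
  have hχ := W.hχ
  have hm := W.hm
  have hq := W.hq
  refine unif_of_bound (b := fun n => (3 * (1 * ((q * χ / m) * CK * (C ^ 2 * (a n / R n ^ 4)))) * (2 * R n)) * (Cs * R n ^ 2)) ?_ ?_
  · have := ((((((W.heps.const_mul (C ^ 2)).const_mul ((q * χ / m) * CK)).const_mul 1).const_mul 3).mul (W.hR0.const_mul 2))).mul ((W.hR0.pow 2).const_mul Cs)
    simpa using this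
  · filter_upwards [W.haR, W.rbar_pos] with n hn hp t ht
    have h1 := W.ha n
    have h2 := W.hR n
    refine hS _ _ _ _ _ (W.hR n) fun x hx => ?_
    rw [norm_smul]
    refine mul_le_mul ?_ (W.xcen_le (hp t) hx) (norm_nonneg _) (by positivity)
    exact dot3_le (nrm_le (W.hR n) hx) (W.JD_sphere hn ht hx)

lemma Q23 (W : WCData χ m q c Tm Tp ψ1 r a R φ A σ K C V CK) {t₀ : ℝ} (ht₀ : t₀ ∈ Set.Icc Tm Tp) :
    TendstoUniformlyOn
    (fun n t => ∫ t' in t₀..t, ∫ x in sphere (r t') (R n),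
      (rhoD q (polar σ (uT ψ1 r (a n))) (t', x) * dot3 (fun i => deriv r t' i) (nrm (r t') (R n) x)
        - dot3 (nrm (r t') (R n) x) (JD χ m q c A (polar σ (uT ψ1 r (a n))) (t', x))) ∂μH[2])
    (fun _ => 0) atTop (Set.Icc Tm Tp) := by
  obtain ⟨Cs, hCs, hS⟩ := sphere_bound
  have hC0 := W.hC0
  have hχ := W.hχ
  have hm := W.hm
  have hq := W.hq
  have hV0 := W.hV0
  refine unif_time ht₀ (b := fun n => (q * (C ^ 2 * (a n / R n ^ 4)) * (3 * (V * 1))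
    + 3 * (1 * ((q * χ / m) * CK * (C ^ 2 * (a n / R n ^ 4))))) * (Cs * R n ^ 2)) ?_ ?_ ?_
  · have := ((((W.heps.const_mul (C ^ 2)).const_mul q).mul_const (3 * (V * 1))).add
      ((((W.heps.const_mul (C ^ 2)).const_mul ((q * χ / m) * CK)).const_mul 1).const_mul 3)).mul ((W.hR0.pow 2).const_mul Cs)
    simpa using this
  · intro n
    have := W.ha n
    have := W.hR n
    positivity
  · filter_upwards [W.haR] with n hn t ht
    have h1 := W.ha n
    have h2 := W.hR n
    refine hS _ _ _ _ _ (W.hR n) fun x hx => ?_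
    refine (norm_sub_le _ _).trans (add_le_add ?_ ?_)
    · rw [norm_mul]
      exact mul_le_mul (W.rho_sphere hn hx) (dot3_le (W.hV t ht) (nrm_le (W.hR n) hx)) (norm_nonneg _) (by positivity)
    · exact dot3_le (nrm_le (W.hR n) hx) (W.JD_sphere hn ht hx)

lemma Pbound (W : WCData χ m q c Tm Tp ψ1 r a R φ A σ K C V CK) (n : ℕ) {t : ℝ} (ht : t ∈ Set.Icc Tm Tp) :
    ‖∫ x in closedBall (r t) (R n), PD χ q c A (polar σ (uT ψ1 r (a n))) (t, x)‖ ≤ χ * CK * ∫ x : V3, (ψ1 ‖x‖) ^ 2 := by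
  have hC0 := W.hC0
  have hχ := W.hχ
  have hi : IntegrableOn (fun x : V3 => (uT ψ1 r (a n) (t, x)) ^ 2) (closedBall (r t) (R n)) :=
    ((uT_cont W.hs (W.ha n) t).pow 2).continuousOn.integrableOn_compact (isCompact_closedBall _ _)
  refine (norm_integral_le_of_norm_le (hi.const_mul (χ * CK)) ?_).trans ?_
  · exact (ae_restrict_iff' measurableSet_closedBall).2 (Eventually.of_forall fun x hx => W.PD_le n (mem_tube_ball ht hx))
  · rw [integral_const_mul]
    exact mul_le_mul_of_nonneg_left (mass_le W.hsqi (W.ha n) _ _) (by positivity)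

end WCData


lemma unif_time_eps {F : Type*} [NormedAddCommGroup F] [NormedSpace ℝ F] {f : ℕ → ℝ → F} {Tm Tp t₀ : ℝ}
    (ht₀ : t₀ ∈ Set.Icc Tm Tp)
    (h : ∀ ε > (0 : ℝ), ∀ᶠ n in atTop, ∀ t ∈ Set.Icc Tm Tp, ‖f n t‖ ≤ ε) :
    TendstoUniformlyOn (fun n t => ∫ t' in t₀..t, f n t') (fun _ => 0) atTop (Set.Icc Tm Tp) := by
  rw [Metric.tendstoUniformlyOn_iff]
  intro ε hε
  have hT : 0 ≤ Tp - Tm := by linarith [ht₀.1, ht₀.2]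
  have hε' : 0 < ε / (Tp - Tm + 1) := by positivity
  filter_upwards [h _ hε'] with n hn t ht
  rw [dist_zero_left]
  refine (intervalIntegral.norm_integral_le_of_norm_le_const (C := ε / (Tp - Tm + 1)) fun x hx => hn x ?_).trans_lt ?_
  · have := Set.uIoc_subset_uIcc hx
    exact Set.uIcc_subset_Icc ht₀ ht this
  · have h1 : |t - t₀| ≤ Tp - Tm := by
      rw [abs_le]
      constructor <;> linarith [ht.1, ht.2, ht₀.1, ht₀.2]
    calc ε / (Tp - Tm + 1) * |t - t₀| ≤ ε / (Tp - Tm + 1) * (Tp - Tm) := by gcongr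
      _ < ε / (Tp - Tm + 1) * (Tp - Tm + 1) := by gcongr; linarith
      _ = ε := by field_simp

lemma cross3_le {v w : Fin 3 → ℝ} {a b : ℝ} (hv : ∀ i, |v i| ≤ a) (hw : ∀ i, |w i| ≤ b) (j : Fin 3) :
    |cross3 v w j| ≤ 2 * (a * b) := by
  have ha : 0 ≤ a := (abs_nonneg _).trans (hv 0)
  have h : ∀ i k, |v i * w k| ≤ a * b := by
    intro i k
    rw [abs_mul]
    exact mul_le_mul (hv i) (hw k) (abs_nonneg _) ha
  have h2 : ∀ i k, |v i * w k - v k * w i| ≤ 2 * (a * b) := by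
    intro i k
    refine (abs_sub _ _).trans ?_
    linarith [h i k, h k i]
  fin_cases j
  · exact h2 1 2
  · exact h2 2 0
  · exact h2 0 1

namespace WCData
variable {χ m q c Tm Tp : ℝ} {ψ1 : ℝ → ℝ} {r : ℝ → V3} {a R : ℕ → ℝ} {φ : ℝ × V3 → ℝ}
    {A : ℝ × V3 → Fin 3 → ℝ} {σ : ℝ × V3 → ℝ} {K : Fin 3 → ℝ × V3 → ℝ} {C V CK : ℝ}

lemma Q3 (W : WCData χ m q c Tm Tp ψ1 r a R φ A σ K C V CK) {t₀ : ℝ} (ht₀ : t₀ ∈ Set.Icc Tm Tp)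
    {φinf : ℝ × V3 → ℝ} {Ainf : ℝ × V3 → Fin 3 → ℝ}
    (hφconv : ∀ ε > (0 : ℝ), ∃ N, ∀ n ≥ N, ∀ p ∈ Tube Tm Tp r (R n),
      |φ p - φinf p| + |ptD φ p - ptD φinf p| + (∑ i, |pxD i φ p - pxD i φinf p|) < ε)
    (hAconv : ∀ ε > (0 : ℝ), ∃ N, ∀ n ≥ N, ∀ p ∈ Tube Tm Tp r (R n),
      ‖A p - Ainf p‖ + ‖ptD A p - ptD Ainf p‖ + (∑ i, ‖pxD i A p - pxD i Ainf p‖) < ε) :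
    TendstoUniformlyOn
    (fun n t => ∫ t' in t₀..t, ∫ x in closedBall (r t') (R n),
      (fun j => rhoD q (polar σ (uT ψ1 r (a n))) (t', x) * (ED c φ A (t', x) j - ED c φinf Ainf (t', x) j)
        + (1 / c) * cross3 (JD χ m q c A (polar σ (uT ψ1 r (a n))) (t', x))
            (fun k => BD A (t', x) k - BD Ainf (t', x) k) j))
    (fun _ => 0) atTop (Set.Icc Tm Tp) := by
  have hC0 := W.hC0
  have hχ := W.hχ
  have hm := W.hm
  have hq := W.hq
  have hc := W.hc
  have hW := W_pos W.hpos W.hsqi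
  set M : ℝ := ∫ x : V3, (ψ1 ‖x‖) ^ 2 with hM
  refine unif_time_eps ht₀ fun ε hε => ?_
  set D : ℝ := q * (1 + 1 / c) + (1 / c) * (2 * (((q * χ / m) * CK) * 2)) with hD
  have hDpos : 0 < D := by positivity
  have hδ : 0 < ε / (D * M) := by positivity
  set δ := ε / (D * M) with hδe
  obtain ⟨N1, hN1⟩ := hφconv δ hδ
  obtain ⟨N2, hN2⟩ := hAconv δ hδ
  filter_upwards [eventually_ge_atTop N1, eventually_ge_atTop N2] with n hn1 hn2 t ht
  have hi : IntegrableOn (fun x : V3 => (uT ψ1 r (a n) (t, x)) ^ 2) (closedBall (r t) (R n)) :=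
    ((uT_cont W.hs (W.ha n) t).pow 2).continuousOn.integrableOn_compact (isCompact_closedBall _ _)
  refine (norm_integral_le_of_norm_le (hi.const_mul (D * δ)) ?_).trans ?_
  · refine (ae_restrict_iff' measurableSet_closedBall).2 (Eventually.of_forall fun x hx => ?_)
    have hp := mem_tube_ball (n := n) (R := R) ht hx
    have h1 := hN1 n hn1 _ hp
    have h2 := hN2 n hn2 _ hp
    have hφx : ∀ i, |pxD i φ (t, x) - pxD i φinf (t, x)| ≤ δ := by
      intro i
      have hs := Finset.single_le_sum (f := fun i => |pxD i φ (t, x) - pxD i φinf (t, x)|) (fun _ _ => abs_nonneg _) (Finset.mem_univ i)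
      have := abs_nonneg (φ (t, x) - φinf (t, x))
      have := abs_nonneg (ptD φ (t, x) - ptD φinf (t, x))
      linarith
    have hs0 : 0 ≤ ∑ i, ‖pxD i A (t, x) - pxD i Ainf (t, x)‖ := Finset.sum_nonneg fun _ _ => norm_nonneg _
    have hA0 := norm_nonneg (A (t, x) - Ainf (t, x))
    have hA1 := norm_nonneg (ptD A (t, x) - ptD Ainf (t, x))
    have hAx : ∀ i k, |pxD i A (t, x) k - pxD i Ainf (t, x) k| ≤ δ := by
      intro i k
      have hs := Finset.single_le_sum (f := fun i => ‖pxD i A (t, x) - pxD i Ainf (t, x)‖) (fun _ _ => norm_nonneg _) (Finset.mem_univ i)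
      have h3 := norm_le_pi_norm (pxD i A (t, x) - pxD i Ainf (t, x)) k
      simp only [Pi.sub_apply, Real.norm_eq_abs] at hs h3
      linarith
    have hAt : ∀ k, |ptD A (t, x) k - ptD Ainf (t, x) k| ≤ δ := by
      intro k
      have h3 := norm_le_pi_norm (ptD A (t, x) - ptD Ainf (t, x)) k
      simp only [Pi.sub_apply, Real.norm_eq_abs] at h3
      linarith
    have hE : ∀ j, |ED c φ A (t, x) j - ED c φinf Ainf (t, x) j| ≤ (1 + 1 / c) * δ := by
      intro j
      have e : ED c φ A (t, x) j - ED c φinf Ainf (t, x) j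
          = -(pxD j φ (t, x) - pxD j φinf (t, x)) + -((1 / c) * (ptD A (t, x) j - ptD Ainf (t, x) j)) := by
        unfold ED; ring
      rw [e]
      refine (abs_add_le _ _).trans ?_
      rw [abs_neg, abs_neg, abs_mul, abs_of_pos (by positivity : 0 < 1 / c), add_mul, one_mul]
      exact add_le_add (hφx j) (mul_le_mul_of_nonneg_left (hAt j) (by positivity))
    have hB : ∀ k, |BD A (t, x) k - BD Ainf (t, x) k| ≤ 2 * δ := by
      have hh : ∀ i k, |(pxD i A (t, x) k - pxD k A (t, x) i) - (pxD i Ainf (t, x) k - pxD k Ainf (t, x) i)| ≤ 2 * δ := by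
        intro i k
        have e : (pxD i A (t, x) k - pxD k A (t, x) i) - (pxD i Ainf (t, x) k - pxD k Ainf (t, x) i)
          = (pxD i A (t, x) k - pxD i Ainf (t, x) k) - (pxD k A (t, x) i - pxD k Ainf (t, x) i) := by ring
        rw [e]
        refine (abs_sub _ _).trans ?_
        linarith [hAx i k, hAx k i]
      intro k
      fin_cases k
      · exact hh 1 2
      · exact hh 2 0
      · exact hh 0 1
    have hJ := W.JD_le n hp
    rw [pi_norm_le_iff_of_nonneg (by positivity)]
    intro j
    rw [Real.norm_eq_abs]
    refine (abs_add_le _ _).trans ?_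
    rw [abs_mul, abs_mul, rhoD_polar, abs_of_nonneg (by positivity : 0 ≤ q * uT ψ1 r (a n) (t, x) ^ 2),
      abs_of_pos (by positivity : 0 < 1 / c)]
    have hX := cross3_le hJ hB j
    calc _ ≤ q * uT ψ1 r (a n) (t, x) ^ 2 * ((1 + 1 / c) * δ)
          + (1 / c) * (2 * ((q * χ / m) * CK * (uT ψ1 r (a n) (t, x)) ^ 2 * (2 * δ))) := by
            refine add_le_add (mul_le_mul_of_nonneg_left (hE j) (by positivity)) (mul_le_mul_of_nonneg_left hX (by positivity))
      _ = D * δ * uT ψ1 r (a n) (t, x) ^ 2 := by rw [hD]; ring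
  · rw [integral_const_mul]
    calc D * δ * _ ≤ D * δ * M := mul_le_mul_of_nonneg_left (mass_le W.hsqi (W.ha n) _ _) (by positivity)
      _ = ε := by rw [hδe]; field_simp

lemma Q0 (W : WCData χ m q c Tm Tp ψ1 r a R φ A σ K C V CK) {t₀ : ℝ} (ht₀ : t₀ ∈ Set.Icc Tm Tp) (Ga : ℕ → ℝ → ℝ) :
    TendstoUniformlyOn
    (fun n t => ∫ t' in t₀..t, ∫ x in sphere (r t') (R n),
      (fun j => ∑ i, nrm (r t') (R n) x i *
        TD χ m q c (Ga n) φ A (polar σ (uT ψ1 r (a n))) i j (t', x)) ∂μH[2])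
    (fun _ => 0) atTop (Set.Icc Tm Tp) := by
  obtain ⟨Cs, hCs, hS⟩ := sphere_bound_odd
  have hC0 := W.hC0
  have hχ := W.hχ
  have hm := W.hm
  refine unif_time ht₀ (b := fun n => (3 * (1 * ((χ ^ 2 / (2 * m)) * (3 * (C ^ 2 * (a n / R n ^ 6)))
    + (χ ^ 2 / m) * (C ^ 2 * (a n / R n ^ 6) + CK ^ 2 * (C ^ 2 * (a n / R n ^ 4)))))) * (Cs * R n ^ 2)) ?_ ?_ ?_
  · have h2 := ((W.hR0.pow 2).const_mul (CK ^ 2)).mul W.heps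
    have h3 := ((W.heps.const_mul ((χ ^ 2 / (2 * m)) * 3 + χ ^ 2 / m)).add (h2.const_mul (χ ^ 2 / m))).const_mul (3 * C ^ 2 * Cs)
    have h4 : 3 * C ^ 2 * Cs * ((χ ^ 2 / (2 * m) * 3 + χ ^ 2 / m) * 0 + χ ^ 2 / m * (CK ^ 2 * 0 ^ 2 * 0)) = 0 := by ring
    rw [h4] at h3
    refine h3.congr fun n => ?_
    have := W.hR n
    field_simp
    ring
  · intro n
    have := W.ha n
    have := W.hR n
    positivity
  · filter_upwards [W.haR] with n hn t ht
    have ha := W.ha n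
    have hR := W.hR n
    set g0 : ℝ := (χ ^ 2 / (2 * m)) * Ga n (((a n * Real.sqrt (a n))⁻¹ * ψ1 (R n / a n)) ^ 2) with hg0
    set G : V3 → Fin 3 → ℝ := fun y j => nrm (r t) (R n) y j * g0 with hG
    have hGc : Continuous G := by
      refine continuous_pi fun j => ?_
      have : Continuous fun y : V3 => y j := by fun_prop
      exact (((this.sub continuous_const).div_const _)).mul continuous_const
    have hGo : ∀ y, G (r t - y) = - G (r t + y) := by
      intro y
      ext j
      simp only [hG, nrm, Pi.neg_apply, PiLp.sub_apply, PiLp.add_apply]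
      ring
    have key := hS (r t) (R n) (fun x j => (∑ i, nrm (r t) (R n) x i *
        TD χ m q c (Ga n) φ A (polar σ (uT ψ1 r (a n))) i j (t, x)) - G x j) G
        (3 * (1 * ((χ ^ 2 / (2 * m)) * (3 * (C ^ 2 * (a n / R n ^ 6)))
    + (χ ^ 2 / m) * (C ^ 2 * (a n / R n ^ 6) + CK ^ 2 * (C ^ 2 * (a n / R n ^ 4)))))) hR hGc hGo ?_
    · have e : ∀ x : V3, G x + (fun j => (∑ i, nrm (r t) (R n) x i *
        TD χ m q c (Ga n) φ A (polar σ (uT ψ1 r (a n))) i j (t, x)) - G x j)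
          = fun j => ∑ i, nrm (r t) (R n) x i * TD χ m q c (Ga n) φ A (polar σ (uT ψ1 r (a n))) i j (t, x) := by
        intro x; ext j; simp
      simp only [e] at key
      exact key
    · intro x hx
      have hp := mem_tube_sphere (n := n) (R := R) ht hx
      have hu2 := u_sphere W.hd ha hn hx
      have hdu := du_sphere W.h1 W.hs W.hr W.hd ha hn hx
      have hK := W.hCK n _ hp
      have hxn : ‖x - r t‖ = R n := by rwa [mem_sphere, dist_eq_norm] at hx
      have huv : uT ψ1 r (a n) (t, x) = (a n * Real.sqrt (a n))⁻¹ * ψ1 (R n / a n) := by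
        unfold uT u0; simp only [hxn]
      rw [pi_norm_le_iff_of_nonneg (by positivity)]
      intro j
      have hT := fun i => TD_polar (Ga := Ga n) (m := m) (W.hσ (t, x)) (W.hu n) (fun i => W.hk i (t, x)) (W.ht (t, x)) i j
      set X : Fin 3 → ℝ := fun i => (if i = j then (χ ^ 2 / (2 * m)) * ∑ k, (pxD k (uT ψ1 r (a n)) (t, x)) ^ 2 else 0)
        - (χ ^ 2 / m) * (pxD i (uT ψ1 r (a n)) (t, x) * pxD j (uT ψ1 r (a n)) (t, x)
          + K i (t, x) * K j (t, x) * (uT ψ1 r (a n) (t, x)) ^ 2) with hX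
      have e : (∑ i, nrm (r t) (R n) x i * TD χ m q c (Ga n) φ A (polar σ (uT ψ1 r (a n))) i j (t, x)) - G x j
          = dot3 (nrm (r t) (R n) x) X := by
        simp only [hT]
        rw [huv]
        simp only [mul_add, Finset.sum_add_distrib]
        simp only [mul_ite, mul_zero, Finset.sum_ite_eq', Finset.mem_univ, if_true]
        rw [hG, hg0]
        simp only [add_sub_cancel_left]
        unfold dot3
        refine Finset.sum_congr rfl fun i _ => ?_
        rw [hX, huv]; ring
      rw [Real.norm_eq_abs, e]
      refine dot3_le (nrm_le hR hx) fun i => ?_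
      rw [hX]
      simp only
      refine (abs_sub _ _).trans (add_le_add ?_ ?_)
      · have h3 : |χ ^ 2 / (2 * m) * ∑ k, (pxD k (uT ψ1 r (a n)) (t, x)) ^ 2| ≤ χ ^ 2 / (2 * m) * (3 * (C ^ 2 * (a n / R n ^ 6))) := by
          rw [abs_of_nonneg (by positivity), Fin.sum_univ_three]
          refine mul_le_mul_of_nonneg_left ?_ (by positivity)
          linarith [hdu 0, hdu 1, hdu 2]
        split_ifs
        · exact h3
        · rw [abs_zero]; positivity
      · rw [abs_mul, abs_of_nonneg (by positivity : 0 ≤ χ ^ 2 / m)]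
        refine mul_le_mul_of_nonneg_left ((abs_add_le _ _).trans (add_le_add ?_ ?_)) (by positivity)
        · have h5 := hdu i
          have h6 := hdu j
          rw [abs_le]
          constructor
          · nlinarith [sq_nonneg (pxD i (uT ψ1 r (a n)) (t, x) + pxD j (uT ψ1 r (a n)) (t, x))]
          · nlinarith [sq_nonneg (pxD i (uT ψ1 r (a n)) (t, x) - pxD j (uT ψ1 r (a n)) (t, x))]
        · rw [abs_mul, abs_mul, abs_of_nonneg (sq_nonneg (uT ψ1 r (a n) (t, x))), sq CK]
          exact mul_le_mul (mul_le_mul (hK i) (hK j) (abs_nonneg _) hC0) hu2 (sq_nonneg _) (by positivity)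

end WCData

/-- Let `ψ̊₁` be a positive, square-integrable, `C²` radial form factor
solving `Δψ̊₁ = G'₁(ψ̊₁²)ψ̊₁` and obeying the decay conditions `θ²|ψ̊₁(θ)| ≤ C`,
`θ³|ψ̊₁'(θ)| ≤ C` for `θ ≥ 1`; let `a_n, R_n > 0` with `a_n R_n⁻⁴ → 0`, `a_n → 0`,
`R_n → 0`. Then the wave-corpuscle solutions
`ψ_n(t,x) = e^{iS} a_n^{−3/2} ψ̊₁(a_n^{−1}|x − r(t)|)` for the special potentials
admitting wave-corpuscles, with `r` satisfying Newton's law, concentrate at the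
trajectory `r̂ = r` in the sense of the concentration definition. -/
theorem statement10
    (χ m q c : ℝ) (hχ : 0 < χ) (hm : 0 < m) (hq : 0 < q) (hc : 0 < c)
    (G1' G1 : ℝ → ℝ)
    (hG1'cont : ContinuousOn G1' (Set.Ioi 0))
    (hG1deriv : ∀ s ∈ Set.Ioi (0 : ℝ), HasDerivAt G1 (G1' s) s)
    (hG1cont : ContinuousOn G1 (Set.Ici 0))
    (hgcont : Continuous fun z : ℂ =>
      if z = 0 then (0 : ℂ) else ((G1' (Complex.normSq z) : ℝ) : ℂ) * z)
    (ψ1 : ℝ → ℝ) (hψ1C2 : ContDiff ℝ 2 ψ1)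
    (hψ1pos : ∀ s : ℝ, 0 ≤ s → 0 < ψ1 s)
    (hψ1smooth : ContDiff ℝ 2 fun x : V3 => ψ1 ‖x‖)
    (hψ1int : Integrable fun x : V3 => (ψ1 ‖x‖) ^ 2)
    (hsteady : ∀ x : V3, lap3 (fun x' => ψ1 ‖x'‖) x = G1' ((ψ1 ‖x‖) ^ 2) * ψ1 ‖x‖)
    (hdecay : ∃ C : ℝ, ∀ θ : ℝ, 1 ≤ θ →
      θ ^ 2 * |ψ1 θ| ≤ C ∧ θ ^ 3 * |deriv ψ1 θ| ≤ C)
    (a R : ℕ → ℝ) (hapos : ∀ n, 0 < a n) (hRpos : ∀ n, 0 < R n)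
    (ha0 : Tendsto a atTop (nhds 0)) (hR0 : Tendsto R atTop (nhds 0))
    (haR4 : Tendsto (fun n => a n / (R n) ^ 4) atTop (nhds 0))
    (Tm Tp t₀ : ℝ) (hTmTp : Tm ≤ Tp) (ht₀ : t₀ ∈ Set.Icc Tm Tp)
    (r : ℝ → V3) (hr : ContDiff ℝ 2 r)
    (φ0 : ℝ → ℝ) (φ1 : ℝ → Fin 3 → ℝ) (A0 : ℝ → Fin 3 → ℝ)
    (A1 : ℝ → Fin 3 → Fin 3 → ℝ) (P3 : ℝ → V3 → ℝ)
    (hφ0 : ContDiff ℝ 2 φ0) (hφ1 : ContDiff ℝ 2 φ1)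
    (hA0 : ContDiff ℝ 2 A0) (hA1 : ContDiff ℝ 3 A1)
    (hP3hom : ∀ t : ℝ, ∀ ζ > (0 : ℝ), ∀ y : V3, P3 t (ζ • y) = ζ ^ 3 * P3 t y)
    (hP3smooth : ContDiff ℝ 4 fun p : ℝ × V3 => P3 p.1 p.2)
    (hNewton : ∀ t : ℝ, ∀ j : Fin 3,
      m * deriv (deriv r) t j
        = q * ED c (phiWC m q c r φ0 φ1 A1 P3) (AWC r A0 A1 P3) (t, r t) j
          + (q / c) * cross3 (fun i => deriv r t i)
              (BD (AWC r A0 A1 P3) (t, r t)) j) :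
    ∃ ρinf : ℝ,
      Concentrates χ m q c G1' G1 Tm Tp t₀ r a R
        (fun _ => phiWC m q c r φ0 φ1 A1 P3) (fun _ => AWC r A0 A1 P3)
        (fun p => phiWC m q c r φ0 φ1 A1 P3 (p.1, r p.1)
          + ∑ i, (p.2 i - r p.1 i) * pxD i (phiWC m q c r φ0 φ1 A1 P3) (p.1, r p.1))
        (fun p j => AWC r A0 A1 P3 (p.1, r p.1) j
          + ∑ i, (p.2 i - r p.1 i) * pxD i (AWC r A0 A1 P3) (p.1, r p.1) j)
        (fun n => psiWC χ m q c r φ0 A0 A1 P3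
          (fun s => ((a n) * Real.sqrt (a n))⁻¹ * ψ1 (s / a n)))
        ρinf := by
  have hP : ContDiff ℝ 4 (Pj P3) := hP3smooth
  have hN := newton_explicit hr hφ0 hφ1 hA0 hA1 hP hP3hom hNewton
  have hr' := r_contDiff3 hm hr hφ1 hA0 hA1 hN
  obtain ⟨σ, K, hσ, hKc, hk, ht, hpsi, hsol⟩ :=
    wc_main hχ hm hc hψ1smooth hsteady hr hφ0 hφ1 hA0 hA1 hP3hom hP hNewton
  have e : (fun n => psiWC χ m q c r φ0 A0 A1 P3
      (fun s => ((a n) * Real.sqrt (a n))⁻¹ * ψ1 (s / a n))) = fun n => polar σ (uT ψ1 r (a n)) :=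
    funext fun n => hpsi (a n)
  rw [e, phiinf_eq hr hφ0 hφ1 hA1 hP hP3hom, Ainf_eq hr hA0 hA1 hP hP3hom]
  have hratio : Tendsto (fun n => R n / a n) atTop atTop := by
    have h1 : Tendsto (fun n => a n / R n ^ 4 * R n ^ 3) atTop (nhds 0) := by
      simpa using haR4.mul (hR0.pow 3)
    have h2 : Tendsto (fun n => a n / R n) atTop (𝓝[>] 0) := by
      refine tendsto_nhdsWithin_iff.2 ⟨h1.congr fun n => ?_, Eventually.of_forall fun n => div_pos (hapos n) (hRpos n)⟩
      have := (hRpos n).ne'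
      field_simp
    have h3 := h2.inv_tendsto_nhdsGT_zero
    exact h3.congr fun n => by simp
  obtain ⟨V, hV0, hV⟩ := icc_bdd_C1 (deriv_contDiff1 hr) Tm Tp
  obtain ⟨CK, hCK0, hCK⟩ := tube_bdd (Tm := Tm) (Tp := Tp) hr.continuous hR0
    (D := fun p i => K i p) (continuous_pi hKc)
  obtain ⟨C, hC⟩ := hdecay
  have W : WCData χ m q c Tm Tp ψ1 r a R (phiWC m q c r φ0 φ1 A1 P3) (AWC r A0 A1 P3) σ K C V CK :=
    { hχ := hχ, hm := hm, hq := hq, hc := hc, hr := hr, h1 := hψ1C2, hs := hψ1smooth, hpos := hψ1pos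
      hsqi := hψ1int, hd := hC, ha := hapos, hR := hRpos, hR0 := hR0, heps := haR4, hratio := hratio
      hσ := hσ.differentiable (by norm_num), hk := hk, ht := ht, hV0 := hV0
      hV := fun t ht i => (WCData.coord_le _ i).trans (hV t ht).1
      hC0 := hCK0
      hCK := fun n p hp i => by
        have := (norm_le_pi_norm (fun i => K i p) i).trans (hCK n p hp)
        simpa using this }
  have hL2 : ContDiff ℝ 2 (fun p => phiL φ0 φ1 (PhiM r p)) := phi_comp_contDiff hr (phiL_contDiff hφ0 hφ1)
  have hE2 : ContDiff ℝ 2 (fun p => phi2E m q c r A1 P3 (PhiM r p)) :=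
    phi_comp_contDiff hr (phi2E_contDiff le_rfl hr' hA1 hP)
  have hAL2 : ContDiff ℝ 2 (fun p => AL A0 A1 (PhiM r p)) :=
    phi_comp_contDiff hr (AL_contDiff hA0 (hA1.of_le (by norm_num)))
  have hAE2 : ContDiff ℝ 2 (fun p => gP P3 (PhiM r p)) :=
    phi_comp_contDiff hr ((gP_contDiff hP).of_le (by norm_num))
  have hφ2 : ContDiff ℝ 2 (phiWC m q c r φ0 φ1 A1 P3) := by
    rw [phiWC_eq hA1 hP]; exact hL2.add hE2
  have hA2 : ContDiff ℝ 2 (AWC r A0 A1 P3) := by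
    rw [AWC_eq hP]; exact hAL2.add hAE2
  have hφconv : ∀ ε > (0 : ℝ), ∃ N, ∀ n ≥ N, ∀ p ∈ Tube Tm Tp r (R n),
      |phiWC m q c r φ0 φ1 A1 P3 p - phiL φ0 φ1 (PhiM r p)|
        + |ptD (phiWC m q c r φ0 φ1 A1 P3) p - ptD (fun p => phiL φ0 φ1 (PhiM r p)) p|
        + (∑ i, |pxD i (phiWC m q c r φ0 φ1 A1 P3) p - pxD i (fun p => phiL φ0 φ1 (PhiM r p)) p|) < ε := by
    rw [phiWC_eq hA1 hP]
    exact conv_core hr.continuous hR0 Tm Tp (hL2.of_le (by norm_num)) (hE2.of_le (by norm_num))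
      (fun t => phi2E_core hr hA1 hP hP3hom t) (fun t => fderiv_phi2_core hr hA1 hP hP3hom t)
  have hAconv : ∀ ε > (0 : ℝ), ∃ N, ∀ n ≥ N, ∀ p ∈ Tube Tm Tp r (R n),
      ‖AWC r A0 A1 P3 p - AL A0 A1 (PhiM r p)‖
        + ‖ptD (AWC r A0 A1 P3) p - ptD (fun p => AL A0 A1 (PhiM r p)) p‖
        + (∑ i, ‖pxD i (AWC r A0 A1 P3) p - pxD i (fun p => AL A0 A1 (PhiM r p)) p‖) < ε := by
    rw [AWC_eq hP]
    exact conv_core hr.continuous hR0 Tm Tp (hAL2.of_le (by norm_num)) (hAE2.of_le (by norm_num))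
      (fun t => gP_core hP hP3hom t) (fun t => fderiv_gP_core hr hP hP3hom t)
  have hWpos := mul_pos hq (W_pos hψ1pos hψ1int)
  refine ⟨q * ∫ x : V3, (ψ1 ‖x‖) ^ 2, ?_⟩
  exact
    { ht0 := ht₀
      htraj := ⟨hr, V, fun t ht => hV t ht⟩
      hG1'cont := hG1'cont
      hG1deriv := hG1deriv
      hG1cont := hG1cont
      hgcont := hgcont
      hapos := hapos
      hRpos := hRpos
      ha0 := ha0
      hR0 := hR0
      hratio := hratio
      hφsmooth := fun _ => hφ2.contDiffOn
      hAsmooth := fun _ => hA2.contDiffOn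
      hφbound := bound_core hr.continuous hR0 Tm Tp (hφ2.of_le (by norm_num))
      hAbound := bound_core hr.continuous hR0 Tm Tp (hA2.of_le (by norm_num))
      hφconv := hφconv
      hAconv := hAconv
      hφlin := by
        obtain ⟨C0, -, h0⟩ := icc_bdd_C1 (hφ0.of_le (by norm_num) : ContDiff ℝ 1 φ0) Tm Tp
        obtain ⟨C1, -, h1⟩ := icc_bdd_C1 (hφ1.of_le (by norm_num) : ContDiff ℝ 1 φ1) Tm Tp
        refine ⟨φ0, φ1, hφ0.of_le (by norm_num), hφ1.of_le (by norm_num), ⟨max C0 C1, fun t ht => ?_⟩, fun p => rfl⟩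
        exact ⟨(h0 t ht).1.trans (le_max_left _ _), (h1 t ht).1.trans (le_max_right _ _),
          (h0 t ht).2.trans (le_max_left _ _), (h1 t ht).2.trans (le_max_right _ _)⟩
      hAlin := by
        have hB : ContDiff ℝ 1 (fun t (i j : Fin 3) => A1 t j i) := by
          rw [contDiff_pi]; intro i
          rw [contDiff_pi]; intro j
          exact contDiff_pi.1 (contDiff_pi.1 (hA1.of_le (by norm_num)) j) i
        obtain ⟨C0, -, h0⟩ := icc_bdd_C1 (hA0.of_le (by norm_num) : ContDiff ℝ 1 A0) Tm Tp
        obtain ⟨C1, -, h1⟩ := icc_bdd_C1 hB Tm Tp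
        refine ⟨A0, fun t i j => A1 t j i, hA0.of_le (by norm_num), hB, ⟨max C0 C1, fun t ht => ?_⟩, fun p j => ?_⟩
        · exact ⟨(h0 t ht).1.trans (le_max_left _ _), (h1 t ht).1.trans (le_max_right _ _),
            (h0 t ht).2.trans (le_max_left _ _), (h1 t ht).2.trans (le_max_right _ _)⟩
        · simp [AL, PhiM, matVec, mul_comm]
      hψsmooth := fun n => by
        have hu := uT_contDiff hψ1smooth (hapos n) hr
        have h1 : ContDiff ℝ 2 (fun p => ((σ p : ℝ) : ℂ)) := Complex.ofRealCLM.contDiff.comp hσ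
        have h2 : ContDiff ℝ 2 (fun p => ((uT ψ1 r (a n) p : ℝ) : ℂ)) := Complex.ofRealCLM.contDiff.comp hu
        have h3 : ContDiff ℝ 2 (polar σ (uT ψ1 r (a n))) := (contDiff_const.mul h1).cexp.mul h2
        exact h3.contDiffOn
      hsolves := fun n p _ => hsol (a n) (hapos n) p
      hPbound := ⟨_, fun n t ht => W.Pbound n ht⟩
      hρbound := by
        obtain ⟨n₀, h⟩ := eventually_atTop.1 W.rbar_low
        exact ⟨_, half_pos hWpos, _, n₀, fun n hn t _ => ⟨h n hn t, W.rbar_up n t⟩⟩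
      hρconv := W.rbar_tendsto t₀
      hQ0 := W.Q0 ht₀ (fun n s => ((a n) ^ (5 : ℕ))⁻¹ * G1 ((a n) ^ (3 : ℕ) * s))
      hQ01 := W.Q01 ht₀
      hQ20 := W.Q20
      hQ22 := W.Q22
      hQ23 := W.Q23 ht₀
      hQ3 := W.Q3 ht₀ hφconv hAconv }

end
end
end

section
/- Let V : ℝ³ → ℝ³ be continuously differentiable. Define P(y) = ∫₀^{|y|} (y/|y|)·V(r y/|y|) dr for y ≠ 0 and P(0) = 0. Then P is differentiable, the field V̆ := V − ∇P is continuous and sphere-tangent, i.e. V̆(y)·y = 0 for every y ∈ ℝ³; moreover the splitting is unique: if V = ∇P′ + V̆′ with P′ differentiable on ℝ³ and V̆′ continuous with V̆′(y)·y = 0 for all y, then P′ − P is constant and V̆′ = V̆. -/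
noncomputable section
open MeasureTheory Complex Filter Topology Metric

/-- Spatial gradient of a scalar function on `ℝ³`. -/
def gradS (f : V3 → ℝ) (y : V3) : Fin 3 → ℝ := fun i => pxS i f y

/-- Radial potential `P(y) = ∫₀^{|y|} (y/|y|)·V(r y/|y|) dr` of a vector field `V`. -/
def Pot (V : V3 → Fin 3 → ℝ) (y : V3) : ℝ :=
  ∫ r in (0 : ℝ)..‖y‖, ‖y‖⁻¹ * dot3 (fun i => y i) (V ((r / ‖y‖) • y))

/-- The integrand after rescaling the radial variable to the unit interval. -/
def PotF (V : V3 → Fin 3 → ℝ) (p : V3 × ℝ) : ℝ := ∑ i, p.1 i * V (p.2 • p.1) i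

theorem PotF_contDiff (V : V3 → Fin 3 → ℝ) (hV : ContDiff ℝ 1 V) : ContDiff ℝ 1 (PotF V) := by
  unfold PotF
  refine ContDiff.sum fun i _ => ContDiff.mul ?_ ?_
  · have h : ContDiff ℝ 1 (fun x : V3 => x i) := (EuclideanSpace.proj (𝕜 := ℝ) i).contDiff
    exact h.comp contDiff_fst
  · have h : ContDiff ℝ 1 (fun x : V3 => V x i) := contDiff_pi.1 hV i
    exact h.comp (contDiff_snd.smul contDiff_fst)

theorem Pot_smul (V : V3 → Fin 3 → ℝ) (y : V3) :
    Pot V y = ∫ t in (0 : ℝ)..1, PotF V (y, t) := by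
  by_cases hy : y = 0
  · subst hy
    simp [Pot, PotF]
  · have hn : ‖y‖ ≠ 0 := norm_ne_zero_iff.2 hy
    unfold Pot
    rw [intervalIntegral.integral_const_mul]
    have := intervalIntegral.integral_comp_div (a := 0) (b := ‖y‖)
      (fun t => PotF V (y, t)) hn
    simp only [PotF, zero_div, div_self hn, smul_eq_mul] at this
    simp only [dot3, PotF]
    rw [this]
    field_simp

/-- Differentiation under the integral sign for `C¹` integrands. -/
theorem hasFDerivAt_param (F : V3 × ℝ → ℝ) (hF : ContDiff ℝ 1 F) (y : V3) :
    HasFDerivAt (fun x => ∫ t in (0 : ℝ)..1, F (x, t))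
      (∫ t in (0 : ℝ)..1, (fderiv ℝ F (y, t)).comp (ContinuousLinearMap.inl ℝ V3 ℝ)) y := by
  have hc : Continuous fun p : V3 × ℝ =>
      (fderiv ℝ F p).comp (ContinuousLinearMap.inl ℝ V3 ℝ) :=
    (hF.continuous_fderiv (by norm_num)).clm_comp continuous_const
  obtain ⟨C, hC⟩ := ((isCompact_closedBall y 1).prod
    (isCompact_Icc (a := (0 : ℝ)) (b := 1))).exists_bound_of_continuousOn hc.continuousOn
  refine intervalIntegral.hasFDerivAt_integral_of_dominated_of_fderiv_le
    (F := fun x t => F (x, t))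
    (F' := fun x t => (fderiv ℝ F (x, t)).comp (ContinuousLinearMap.inl ℝ V3 ℝ))
    (bound := fun _ => C) (closedBall_mem_nhds y one_pos) ?_ ?_ ?_ ?_ ?_ ?_
  · refine Eventually.of_forall fun x => Continuous.aestronglyMeasurable ?_
    exact hF.continuous.comp (by fun_prop)
  · refine Continuous.intervalIntegrable ?_ _ _
    exact hF.continuous.comp (by fun_prop)
  · refine Continuous.aestronglyMeasurable ?_
    exact hc.comp (f := fun t : ℝ => (y, t)) (by fun_prop)
  · refine Eventually.of_forall fun t ht x hx => hC (x, t) ⟨hx, ?_⟩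
    rw [Set.uIoc_of_le zero_le_one] at ht
    exact Set.Ioc_subset_Icc_self ht
  · simp
  · refine Eventually.of_forall fun t _ x _ => ?_
    exact ((hF.differentiable (by norm_num)) (x, t)).hasFDerivAt.comp x
      (hasFDerivAt_prodMk_left x t)

theorem Pot_hasFDerivAt (V : V3 → Fin 3 → ℝ) (hV : ContDiff ℝ 1 V) (y : V3) :
    HasFDerivAt (Pot V) (∫ t in (0 : ℝ)..1,
      (fderiv ℝ (PotF V) (y, t)).comp (ContinuousLinearMap.inl ℝ V3 ℝ)) y := by
  rw [show Pot V = fun y => ∫ t in (0 : ℝ)..1, PotF V (y, t) from funext (Pot_smul V)]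
  exact hasFDerivAt_param _ (PotF_contDiff V hV) y

theorem Pot_fderiv_continuous (V : V3 → Fin 3 → ℝ) (hV : ContDiff ℝ 1 V) :
    Continuous (fderiv ℝ (Pot V)) := by
  rw [show fderiv ℝ (Pot V) = _ from funext fun y => (Pot_hasFDerivAt V hV y).fderiv]
  apply intervalIntegral.continuous_parametric_intervalIntegral_of_continuous'
  exact ((PotF_contDiff V hV).continuous_fderiv (by norm_num)).clm_comp continuous_const

theorem fderiv_self (f : V3 → ℝ) (y : V3) :
    fderiv ℝ f y y = ∑ i, gradS f y i * y i := by
  have h : y = ∑ i, y i • EuclideanSpace.single i (1 : ℝ) := by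
    ext j
    simp [Finset.sum_apply, Pi.single_apply]
  conv_lhs => rw [h]
  rw [map_sum]
  refine Finset.sum_congr rfl fun i _ => ?_
  rw [map_smul, smul_eq_mul, mul_comm, ← h]
  rfl

theorem Pot_ray (V : V3 → Fin 3 → ℝ) (y : V3) (s : ℝ) :
    Pot V (s • y) = ∫ t in (0 : ℝ)..s, PotF V (y, t) := by
  rw [Pot_smul]
  have h : ∀ t : ℝ, PotF V (s • y, t) = s * PotF V (y, t * s) := by
    intro t
    simp only [PotF, smul_smul, Finset.mul_sum, PiLp.smul_apply, smul_eq_mul, mul_assoc]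
  simp only [h]
  rw [intervalIntegral.integral_const_mul]
  have := intervalIntegral.mul_integral_comp_mul_right (a := 0) (b := 1)
      (f := fun t => PotF V (y, t)) s
  simpa using this

theorem Pot_radial (V : V3 → Fin 3 → ℝ) (hV : ContDiff ℝ 1 V) (y : V3) :
    fderiv ℝ (Pot V) y y = ∑ i, V y i * y i := by
  have hc : Continuous fun t : ℝ => PotF V (y, t) :=
    (PotF_contDiff V hV).continuous.comp (by fun_prop)
  have h1 : HasDerivAt (fun s : ℝ => Pot V (s • y)) (PotF V (y, 1)) 1 := by
    simp only [Pot_ray]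
    exact intervalIntegral.integral_hasDerivAt_right (hc.intervalIntegrable _ _)
      (hc.stronglyMeasurableAtFilter _ _) hc.continuousAt
  have hs : HasDerivAt (fun s : ℝ => s • y) y 1 := by
    simpa using (hasDerivAt_id (1 : ℝ)).smul_const y
  have h2 : HasDerivAt (fun s : ℝ => Pot V (s • y)) (fderiv ℝ (Pot V) y y) 1 := by
    have hd : HasFDerivAt (Pot V) (fderiv ℝ (Pot V) y) ((1 : ℝ) • y) := by
      rw [one_smul]
      exact (Pot_hasFDerivAt V hV y).differentiableAt.hasFDerivAt
    exact hd.comp_hasDerivAt (1 : ℝ) hs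
  rw [h2.unique h1]
  simp [PotF, mul_comm]

theorem const_of_radial (D : V3 → ℝ) (hD : Differentiable ℝ D)
    (h : ∀ y, fderiv ℝ D y y = 0) (y : V3) : D y = D 0 := by
  have hd : ∀ s : ℝ, HasDerivAt (fun s : ℝ => D (s • y)) (fderiv ℝ D (s • y) y) s := by
    intro s
    have hs : HasDerivAt (fun s : ℝ => s • y) y s := by
      simpa using (hasDerivAt_id s).smul_const y
    exact (hD (s • y)).hasFDerivAt.comp_hasDerivAt s hs
  obtain ⟨c, hc, he⟩ := exists_hasDerivAt_eq_slope (fun s : ℝ => D (s • y))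
    (fun s => fderiv ℝ D (s • y) y) zero_lt_one
    (fun s _ => (hd s).continuousAt.continuousWithinAt) (fun s _ => hd s)
  have h0 := h (c • y)
  rw [map_smul, smul_eq_mul] at h0
  have h1 : fderiv ℝ D (c • y) y = 0 := (mul_eq_zero.1 h0).resolve_left hc.1.ne'
  simp only [h1, one_smul, zero_smul, sub_zero, div_one] at he
  linarith

/-- For a `C¹` vector field `V` on `ℝ³`, the potential `P = Pot V` is
differentiable, `V̆ = V − ∇P` is continuous and sphere-tangent (`V̆(y)·y = 0`), and the
splitting `V = ∇P + V̆` into a gradient part and a continuous sphere-tangent part is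
unique up to an additive constant in the potential. -/
theorem statement13 (V : V3 → Fin 3 → ℝ) (hV : ContDiff ℝ 1 V) :
    Differentiable ℝ (Pot V) ∧
    Continuous (fun y => (fun i => V y i - gradS (Pot V) y i)) ∧
    (∀ y : V3, dot3 (fun i => V y i - gradS (Pot V) y i) (fun i => y i) = 0) ∧
    ∀ (P' : V3 → ℝ) (W' : V3 → Fin 3 → ℝ), Differentiable ℝ P' → Continuous W' →
      (∀ y : V3, ∀ i, V y i = gradS P' y i + W' y i) →
      (∀ y : V3, dot3 (W' y) (fun i => y i) = 0) →
      (∃ k : ℝ, ∀ y : V3, P' y = Pot V y + k) ∧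
      ∀ y : V3, ∀ i, W' y i = V y i - gradS (Pot V) y i := by
  have hdiff : Differentiable ℝ (Pot V) := fun y => (Pot_hasFDerivAt V hV y).differentiableAt
  refine ⟨hdiff, ?_, ?_, ?_⟩
  · refine continuous_pi fun i => ?_
    have h1 : Continuous fun y => V y i := (continuous_apply i).comp hV.continuous
    have h2 : Continuous fun y => gradS (Pot V) y i :=
      (Pot_fderiv_continuous V hV).clm_apply continuous_const
    exact h1.sub h2
  · intro y
    have := Pot_radial V hV y
    rw [fderiv_self] at this
    simp only [dot3, sub_mul, Finset.sum_sub_distrib]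
    rw [this, sub_self]
  · intro P' W' hP' _ hsplit htan
    have hrad : ∀ y, fderiv ℝ (fun z => P' z - Pot V z) y y = 0 := by
      intro y
      rw [fderiv_fun_sub (hP' y) (hdiff y), ContinuousLinearMap.sub_apply, Pot_radial V hV y,
        fderiv_self]
      have ht := htan y
      simp only [dot3] at ht
      simp only [hsplit y, add_mul, Finset.sum_add_distrib]
      rw [ht]
      ring
    have hconst := const_of_radial _ (hP'.sub hdiff) hrad
    have hk : ∀ y, P' y = Pot V y + (P' 0 - Pot V 0) := by
      intro y
      have := hconst y
      simp only [Pi.sub_apply] at this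
      linarith
    refine ⟨⟨_, hk⟩, fun y i => ?_⟩
    have hg : gradS P' y i = gradS (Pot V) y i := by
      unfold gradS pxS
      rw [show P' = fun y => Pot V y + (P' 0 - Pot V 0) from funext hk, fderiv_add_const]
    rw [hsplit y i, hg]
    ring


end
end
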